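/- arXiv:2309.06904 — 3 statements merged into one kernel-verified Lean document; each statement's English description precedes it below -/
import Mathlib

section
/- Let D=(V1,V2;A) be a 2-arc-strong split digraph such that every vertex of V1 has out-degree at least 3 and in-degree at least 3 in D. Then D has a good (u,v)-pair for every ordered pair of vertices u,v of D. -/
/-- A digraph on vertex set `V` given by its arc set `A` is strong if every vertex
can reach every other vertex by a directed path. -/
def DigraphStrong {V : Type*} (A : Finset (V × V)) : Prop :=
  ∀ x y : V, Relation.ReflTransGen (fun a b => (a, b) ∈ A) x y

/-- A digraph is `k`-arc-strong if it remains strong after deleting any set of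
at most `k - 1` arcs. -/
def ArcStrong {V : Type*} [DecidableEq V] (k : ℕ) (A : Finset (V × V)) : Prop :=
  ∀ B ⊆ A, B.card < k → DigraphStrong (A \ B)

/-- A strong arc decomposition: a partition of the arc set into two disjoint sets,
each of which forms a strong spanning subdigraph. -/
def StrongArcDecomp {V : Type*} [DecidableEq V] (A : Finset (V × V)) : Prop :=
  ∃ A₁ A₂ : Finset (V × V), A₁ ∪ A₂ = A ∧ Disjoint A₁ A₂ ∧
    DigraphStrong A₁ ∧ DigraphStrong A₂

/-- `(V₁, V₂; A)` is a split digraph: `V₁, V₂` are nonempty, partition the vertex set,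
there are no loops, `V₁` is an independent set, and the subdigraph induced by `V₂`
is semicomplete. -/
def IsSplitDigraph {V : Type*} [Fintype V] [DecidableEq V]
    (V₁ V₂ : Finset V) (A : Finset (V × V)) : Prop :=
  V₁.Nonempty ∧ V₂.Nonempty ∧ Disjoint V₁ V₂ ∧ V₁ ∪ V₂ = Finset.univ ∧
  (∀ v : V, (v, v) ∉ A) ∧
  (∀ u ∈ V₁, ∀ v ∈ V₁, (u, v) ∉ A) ∧
  (∀ u ∈ V₂, ∀ v ∈ V₂, u ≠ v → (u, v) ∈ A ∨ (v, u) ∈ A)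

/-- The out-degree of a vertex. -/
def outDeg {V : Type*} [DecidableEq V] (A : Finset (V × V)) (t : V) : ℕ :=
  (A.filter fun e => e.1 = t).card

/-- The in-degree of a vertex. -/
def inDeg {V : Type*} [DecidableEq V] (A : Finset (V × V)) (t : V) : ℕ :=
  (A.filter fun e => e.2 = t).card

/-- `B ⊆ A` is an out-branching of the digraph `A` rooted at `u`: a spanning oriented
tree in which every vertex other than `u` has in-degree exactly one (so `u` has
in-degree zero and every vertex is reachable from `u`). -/
def IsOutBranching {V : Type*} [DecidableEq V] (A : Finset (V × V)) (u : V)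
    (B : Finset (V × V)) : Prop :=
  B ⊆ A ∧ (∀ v : V, Relation.ReflTransGen (fun a b => (a, b) ∈ B) u v) ∧
  (∀ v : V, v ≠ u → (B.filter fun e => e.2 = v).card = 1) ∧
  (B.filter fun e => e.2 = u) = ∅

/-- `B ⊆ A` is an in-branching of the digraph `A` rooted at `u`: a spanning oriented
tree in which every vertex other than `u` has out-degree exactly one (so `u` has
out-degree zero and every vertex can reach `u`). -/
def IsInBranching {V : Type*} [DecidableEq V] (A : Finset (V × V)) (u : V)
    (B : Finset (V × V)) : Prop :=
  B ⊆ A ∧ (∀ v : V, Relation.ReflTransGen (fun a b => (a, b) ∈ B) v u) ∧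
  (∀ v : V, v ≠ u → (B.filter fun e => e.1 = v).card = 1) ∧
  (B.filter fun e => e.1 = u) = ∅

/-- A good `(u, v)`-pair: an out-branching rooted at `u` and an in-branching rooted
at `v` having no arc in common. -/
def GoodPair {V : Type*} [DecidableEq V] (A : Finset (V × V)) (u v : V) : Prop :=
  ∃ B₁ B₂ : Finset (V × V), IsOutBranching A u B₁ ∧ IsInBranching A v B₂ ∧
    Disjoint B₁ B₂

section MultiDigraph

variable {V : Type*}

/-- Reachability in a multidigraph given by its multiset of arcs. -/
def MReach (M : Multiset (V × V)) : V → V → Prop :=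
  Relation.ReflTransGen fun a b => (a, b) ∈ M

theorem MReach.mono {M N : Multiset (V × V)} (h : ∀ e ∈ M, e ∈ N) {x y : V}
    (hxy : MReach M x y) : MReach N x y :=
  Relation.ReflTransGen.mono (fun a b hab => h (a, b) hab) _ _ hxy

theorem MReach.closed {M : Multiset (V × V)} {u : V} (P : V → Prop) (hu : P u)
    (h : ∀ a b, P a → (a, b) ∈ M → P b) {x : V} (hx : MReach M u x) : P x := by
  induction hx with
  | refl => exact hu
  | tail _ hab ih => exact h _ _ ih hab

theorem MReach.step {M : Multiset (V × V)} {x y z : V} (hxy : MReach M x y)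
    (h : (y, z) ∈ M) : MReach M x z :=
  Relation.ReflTransGen.tail hxy h

/-- The arcs of the directed path visiting the vertices of a list in order. -/
def pathArcs : List V → Multiset (V × V)
  | a :: b :: l => (a, b) ::ₘ pathArcs (b :: l)
  | _ => 0

@[simp] theorem pathArcs_nil : pathArcs ([] : List V) = 0 := rfl

@[simp] theorem pathArcs_singleton (a : V) : pathArcs [a] = 0 := rfl

@[simp] theorem pathArcs_cons_cons (a b : V) (l : List V) :
    pathArcs (a :: b :: l) = (a, b) ::ₘ pathArcs (b :: l) := rfl

theorem pathArcs_append (l₁ l₂ : List V) (x : V) :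
    pathArcs (l₁ ++ x :: l₂) = pathArcs (l₁ ++ [x]) + pathArcs (x :: l₂) := by
  induction l₁ with
  | nil => simp
  | cons a l ih =>
    cases l with
    | nil => simp
    | cons b l => simpa using ih

theorem exists_of_mem_pathArcs {l : List V} {a b : V} (h : (a, b) ∈ pathArcs l) :
    ∃ l₁ l₂, l = l₁ ++ a :: b :: l₂ := by
  induction l with
  | nil => simp at h
  | cons c l ih =>
    cases l with
    | nil => simp at h
    | cons d l =>
      simp only [pathArcs_cons_cons, Multiset.mem_cons, Prod.mk.injEq] at h
      rcases h with ⟨rfl, rfl⟩ | h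
      · exact ⟨[], l, rfl⟩
      · obtain ⟨l₁, l₂, h⟩ := ih h
        exact ⟨c :: l₁, l₂, by simp [h]⟩

theorem left_mem_of_mem_pathArcs {l : List V} {a b : V} (h : (a, b) ∈ pathArcs l) : a ∈ l := by
  obtain ⟨l₁, l₂, rfl⟩ := exists_of_mem_pathArcs h
  simp

theorem right_mem_of_mem_pathArcs {l : List V} {a b : V} (h : (a, b) ∈ pathArcs l) : b ∈ l := by
  obtain ⟨l₁, l₂, rfl⟩ := exists_of_mem_pathArcs h
  simp

theorem exists_index_of_mem_pathArcs {l : List V} {a b : V} (h : (a, b) ∈ pathArcs l) :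
    ∃ i, l[i]? = some a ∧ l[i + 1]? = some b := by
  obtain ⟨l₁, l₂, rfl⟩ := exists_of_mem_pathArcs h
  exact ⟨l₁.length, by simp, by simp⟩

theorem List.Nodup.index_unique {l : List V} (hl : l.Nodup) {i j : ℕ} {a : V}
    (hi : l[i]? = some a) (hj : l[j]? = some a) : i = j := by
  rw [List.getElem?_eq_some_iff] at hi hj
  obtain ⟨hi, rfl⟩ := hi
  obtain ⟨hj, h⟩ := hj
  exact ((List.Nodup.getElem_inj_iff hl).1 h).symm

theorem pathArcs_nodup {l : List V} (hl : l.Nodup) : (pathArcs l).Nodup := by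
  induction l with
  | nil => simp
  | cons a l ih =>
    cases l with
    | nil => simp
    | cons b l =>
      rw [pathArcs_cons_cons, Multiset.nodup_cons]
      refine ⟨fun h => ?_, ih (List.nodup_cons.1 hl).2⟩
      exact (List.nodup_cons.1 hl).1 (left_mem_of_mem_pathArcs h)

theorem mreach_pathArcs {l : List V} {v : V} (hv : l.getLast? = some v) {x : V} (hx : x ∈ l) :
    MReach (pathArcs l) x v := by
  induction l generalizing x with
  | nil => simp at hx
  | cons a l ih =>
    cases l with
    | nil =>
      simp at hx hv
      subst hx hv
      exact Relation.ReflTransGen.refl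
    | cons b l =>
      have hv' : (b :: l).getLast? = some v := by simpa using hv
      have hsub : ∀ e ∈ pathArcs (b :: l), e ∈ pathArcs (a :: b :: l) := by
        intro e he
        simp [he]
      rcases List.mem_cons.1 hx with rfl | hx
      · exact Relation.ReflTransGen.head (b := b) (by simp) ((ih hv' (by simp)).mono hsub)
      · exact (ih hv' hx).mono hsub

theorem exists_path_of_mreach {M : Multiset (V × V)} {u v : V} (h : MReach M u v) :
    ∃ l : List V, l.Nodup ∧ l.head? = some u ∧ l.getLast? = some v ∧
      ∀ e ∈ pathArcs l, e ∈ M := by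
  induction h with
  | refl => exact ⟨[u], by simp⟩
  | @tail b c _ hbc ih =>
    obtain ⟨l, hnd, hu, hb, hM⟩ := ih
    by_cases hc : c ∈ l
    · obtain ⟨l₁, l₂, rfl⟩ := List.append_of_mem hc
      refine ⟨l₁ ++ [c], ?_, ?_, by simp, ?_⟩
      · exact hnd.sublist (by simp)
      · cases l₁ <;> simpa using hu
      · intro e he
        apply hM
        rw [pathArcs_append]
        exact Multiset.mem_add.2 (Or.inl he)
    · have hne : l ≠ [] := by rintro rfl; simp at hu
      obtain ⟨l', b', rfl⟩ := List.eq_nil_or_concat l |>.resolve_left hne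
      simp at hb
      subst hb
      refine ⟨l' ++ b' :: [c], ?_, ?_, by simp, ?_⟩
      · have : l' ++ b' :: [c] = (l' ++ [b']) ++ [c] := by simp
        rw [this, List.nodup_append]
        simp only [List.concat_eq_append] at hnd hc
        refine ⟨hnd, by simp, ?_⟩
        intro a ha b hb
        simp at hb
        subst hb
        rintro rfl
        exact hc ha
      · cases l' <;> simpa using hu
      · intro e he
        rw [pathArcs_append] at he
        rcases Multiset.mem_add.1 he with he | he
        · exact hM e (by simpa using he)
        · simp at he
          subst he
          exact hbc

variable [DecidableEq V]

/-- The number of arcs leaving a vertex set. -/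
def cutOut (M : Multiset (V × V)) (X : Finset V) : ℕ :=
  M.countP fun e => e.1 ∈ X ∧ e.2 ∉ X

/-- The number of arcs entering a vertex set. -/
def cutIn (M : Multiset (V × V)) (X : Finset V) : ℕ :=
  M.countP fun e => e.1 ∉ X ∧ e.2 ∈ X

theorem cutIn_eq_cutOut_compl [Fintype V] (M : Multiset (V × V)) (X : Finset V) :
    cutIn M X = cutOut M Xᶜ := by
  unfold cutIn cutOut
  refine Multiset.countP_congr rfl fun e _ => ?_
  simp

theorem exists_pair_of_two_le_countP {α : Type*} [DecidableEq α] (M : Multiset α) (p : α → Prop)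
    [DecidablePred p] (h : 2 ≤ M.countP p) :
    ∃ e e', {e, e'} ≤ M ∧ p e ∧ p e' := by
  obtain ⟨e, he, hpe⟩ := Multiset.countP_pos.1 (lt_of_lt_of_le two_pos h)
  obtain ⟨M, rfl⟩ := Multiset.exists_cons_of_mem he
  rw [Multiset.countP_cons_of_pos _ hpe] at h
  obtain ⟨e', he', hpe'⟩ := Multiset.countP_pos.1 (lt_of_lt_of_le one_pos (Nat.le_of_succ_le_succ h))
  refine ⟨e, e', ?_, hpe, hpe'⟩
  rw [Multiset.insert_eq_cons]
  exact Multiset.cons_le_cons _ (Multiset.singleton_le.2 he')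

theorem mem_erase_of_pair_le {α : Type*} [DecidableEq α] {M : Multiset α} {e e' : α}
    (h : {e, e'} ≤ M) : e' ∈ M.erase e := by
  have := Multiset.erase_le_erase e h
  exact Multiset.mem_of_le this (by simp [Multiset.insert_eq_cons])

theorem MReach.of_erase {M : Multiset (V × V)} {u y w x : V}
    (hw : MReach (M.erase (y, w)) u w) (hx : MReach M u x) : MReach (M.erase (y, w)) u x := by
  refine hx.closed (fun x => MReach (M.erase (y, w)) u x) .refl ?_
  intro a b ha hab
  by_cases h : (a, b) = (y, w)
  · cases h
    exact hw
  · exact ha.step ((Multiset.mem_erase_of_ne h).2 hab)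

/-- In a multidigraph in which two arcs enter every set avoiding `u`, some path from `u` to `v`
can be removed so that everything stays reachable from `u`. -/
theorem exists_path_removal [Fintype V] (M : Multiset (V × V)) (u v : V)
    (h : ∀ X : Finset V, X.Nonempty → u ∉ X → 2 ≤ cutIn M X) :
    ∃ l : List V, l.Nodup ∧ l.head? = some u ∧ l.getLast? = some v ∧ pathArcs l ≤ M ∧
      ∀ x, MReach (M - pathArcs l) u x := by
  classical
  let good : Finset V → Prop := fun U => u ∈ U ∧ ∃ F ≤ M, (∀ x ∈ U, MReach F u x) ∧
    (∀ e ∈ F, e.2 ∈ U) ∧ ∀ x, MReach (M - F) u x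
  have hreach : ∀ x, MReach M u x := by
    by_contra! hx
    have := h (Finset.univ.filter fun x => ¬ MReach M u x)
      (by obtain ⟨x, hx⟩ := hx; exact ⟨x, by simpa using hx⟩)
      (by simp only [Finset.mem_filter, Finset.mem_univ, true_and, not_not]; exact .refl)
    obtain ⟨e, he, h1, h2⟩ := Multiset.countP_pos.1 (lt_of_lt_of_le (by norm_num) this)
    simp only [Finset.mem_filter, Finset.mem_univ, true_and, not_not] at h1 h2
    exact h2 (h1.step he)
  obtain ⟨U, hU, hmax⟩ := Finset.exists_max_image (Finset.univ.filter good) Finset.card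
    ⟨{u}, by
      simp only [Finset.mem_filter, Finset.mem_univ, true_and, good]
      refine ⟨by simp, 0, by simp, ?_, by simp, by simpa using hreach⟩
      intro x hx
      rw [Finset.mem_singleton.1 hx]
      exact .refl⟩
  simp only [Finset.mem_filter, Finset.mem_univ, true_and] at hU hmax
  obtain ⟨huU, F, hFM, hFU, hFhead, hspan⟩ := hU
  have key : ∀ e ∈ M - F, e.1 ∈ U → e.2 ∉ U → ¬ MReach ((M - F).erase e) u e.2 := by
    rintro ⟨y, w⟩ he hy hw hr
    have : good (insert w U) := by
      refine ⟨by simp [huU], (y, w) ::ₘ F, ?_, ?_, ?_, ?_⟩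
      · rw [← tsub_add_cancel_of_le hFM, ← Multiset.singleton_add]
        gcongr
        simpa using he
      · intro x hx
        have hsub : ∀ e ∈ F, e ∈ (y, w) ::ₘ F := fun e he => by simp [he]
        rcases Finset.mem_insert.1 hx with rfl | hx
        · exact ((hFU y hy).mono hsub).step (by simp)
        · exact (hFU x hx).mono hsub
      · intro e he
        rcases Multiset.mem_cons.1 he with rfl | he
        · simp
        · simp [hFhead e he]
      · intro x
        have := MReach.of_erase hr (hspan x)
        rwa [← Multiset.sub_singleton, tsub_tsub, add_comm, Multiset.singleton_add] at this
    have := hmax _ this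
    rw [Finset.card_insert_of_notMem hw] at this
    omega
  let R : V × V → Finset V := fun e => Finset.univ.filter fun x => MReach ((M - F).erase e) u x
  have hR : ∀ e x, x ∈ R e ↔ MReach ((M - F).erase e) u x := fun e x => by simp [R]
  by_cases hv : v ∈ U
  · obtain ⟨l, hnd, hhd, hlast, hl⟩ := exists_path_of_mreach (hFU v hv)
    have hlF : pathArcs l ≤ F := (Multiset.le_iff_subset (pathArcs_nodup hnd)).2 fun e he => hl e he
    exact ⟨l, hnd, hhd, hlast, hlF.trans hFM, fun x =>
      (hspan x).mono fun e he => Multiset.mem_of_le (tsub_le_tsub_left hlF M) he⟩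
  exfalso
  have hne : ((M - F).toFinset.filter fun e => e.1 ∈ U ∧ e.2 ∉ U).Nonempty := by
    by_contra hne
    rw [Finset.not_nonempty_iff_eq_empty, Finset.filter_eq_empty_iff] at hne
    refine hv ((hspan v).closed (fun x => x ∈ U) huU fun a b ha hab => ?_)
    by_contra hb
    exact hne (Multiset.mem_toFinset.2 hab) ⟨ha, hb⟩
  obtain ⟨⟨y, w⟩, he, hemax⟩ := Finset.exists_max_image _ (fun e => (R e).card) hne
  simp only [Finset.mem_filter, Multiset.mem_toFinset] at he hemax
  obtain ⟨he, hy, hw⟩ := he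
  have hwR := key _ he hy hw
  have hyR : MReach ((M - F).erase (y, w)) u y := by
    by_contra hyR
    refine hwR ((hspan w).closed (fun x => MReach ((M - F).erase (y, w)) u x) .refl ?_)
    intro a b ha hab
    refine ha.step ((Multiset.mem_erase_of_ne ?_).2 hab)
    rintro ⟨⟩
    exact hyR ha
  have hX := h ((R (y, w))ᶜ \ U) ⟨w, by simpa [hR] using ⟨hwR, hw⟩⟩ (by simp [huU])
  have hX' : 2 ≤ cutIn (M - F) ((R (y, w))ᶜ \ U) := by
    rw [← tsub_add_cancel_of_le hFM, cutIn, Multiset.countP_add] at hX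
    rwa [(Multiset.countP_eq_zero (s := F)).2, add_zero] at hX
    intro e he h
    exact (Finset.mem_sdiff.1 h.2).2 (hFhead e he)
  have : ∃ g ∈ (M - F).erase (y, w), g.1 ∉ (R (y, w))ᶜ \ U ∧ g.2 ∈ (R (y, w))ᶜ \ U := by
    obtain ⟨g, g', hgg, hg, hg'⟩ := exists_pair_of_two_le_countP _ _ hX'
    by_cases hge : g = (y, w)
    · subst hge
      exact ⟨g', mem_erase_of_pair_le hgg, hg'⟩
    · exact ⟨g, (Multiset.mem_erase_of_ne hge).2 (Multiset.mem_of_le hgg (by simp)), hg⟩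
  obtain ⟨⟨p, q⟩, hg, hp, hq⟩ := this
  simp only [Finset.mem_sdiff, Finset.mem_compl, hR] at hp hq
  have hpR : ¬ MReach ((M - F).erase (y, w)) u p := fun hp => hq.1 (hp.step hg)
  have hpU : p ∈ U := by tauto
  have hle := hemax _ ⟨Multiset.mem_of_mem_erase hg, hpU, hq.2⟩
  have hsub : ∀ x, MReach ((M - F).erase (y, w)) u x → MReach ((M - F).erase (p, q)) u x := by
    intro x hx
    refine (hx.closed (fun x => MReach ((M - F).erase (y, w)) u x ∧
      MReach ((M - F).erase (p, q)) u x) ⟨.refl, .refl⟩ ?_).2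
    rintro a b ⟨ha, ha'⟩ hab
    refine ⟨ha.step hab, ha'.step ((Multiset.mem_erase_of_ne ?_).2 (Multiset.mem_of_mem_erase hab))⟩
    rintro ⟨⟩
    exact hpR ha
  have hwR' : MReach ((M - F).erase (p, q)) u w := by
    refine (hsub y hyR).step ((Multiset.mem_erase_of_ne ?_).2 he)
    rintro ⟨⟩
    exact hpR hyR
  refine absurd (Finset.card_lt_card (Finset.ssubset_iff.2 ⟨w, ?_, ?_⟩)) (not_lt.2 hle)
  · rwa [hR]
  · intro x hx
    rcases Finset.mem_insert.1 hx with rfl | hx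
    · rwa [hR]
    · exact (hR _ _).2 (hsub x ((hR _ _).1 hx))

end MultiDigraph

section SemicompleteRooted

variable {V : Type*} [DecidableEq V]

/-- Arc-disjoint spanning sets of arcs, one reaching everything from `u`, one reaching `v` from
everything. -/
def HasRootedPair (M : Multiset (V × V)) (u v : V) : Prop :=
  ∃ M₁ M₂, M₁ + M₂ ≤ M ∧ (∀ x, MReach M₁ u x) ∧ ∀ x, MReach M₂ x v

/-- A `u`–`v` path whose removal keeps everything reachable from `u`. -/
structure IsRemovablePath (M : Multiset (V × V)) (u v : V) (l : List V) : Prop where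
  nodup : l.Nodup
  head : l.head? = some u
  last : l.getLast? = some v
  le : pathArcs l ≤ M
  span : ∀ x, MReach (M - pathArcs l) u x

/-- The vertices off the path `l` that do not dominate `u`. -/
def offPath [Fintype V] (M : Multiset (V × V)) (u : V) (l : List V) : Finset V :=
  Finset.univ.filter fun x => x ∉ l ∧ (x, u) ∉ M

theorem mem_offPath [Fintype V] {M : Multiset (V × V)} {u x : V} {l : List V} :
    x ∈ offPath M u l ↔ x ∉ l ∧ (x, u) ∉ M := by
  simp [offPath]

theorem mem_sub_of_notMem {α : Type*} [DecidableEq α] {M N : Multiset α} {e : α} (h : e ∈ M)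
    (h' : e ∉ N) : e ∈ M - N := by
  rw [← Multiset.count_pos, Multiset.count_sub, Multiset.count_eq_zero.2 h', tsub_zero]
  exact Multiset.count_pos.2 h

theorem mem_sub_pathArcs_left {M : Multiset (V × V)} {l : List V} {a b : V} (h : (a, b) ∈ M)
    (ha : a ∉ l) : (a, b) ∈ M - pathArcs l :=
  mem_sub_of_notMem h fun h => ha (left_mem_of_mem_pathArcs h)

theorem mem_sub_pathArcs_right {M : Multiset (V × V)} {l : List V} {a b : V} (h : (a, b) ∈ M)
    (hb : b ∉ l) : (a, b) ∈ M - pathArcs l :=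
  mem_sub_of_notMem h fun h => hb (right_mem_of_mem_pathArcs h)

variable [Fintype V] {M : Multiset (V × V)} {u v : V} {l : List V}

namespace IsRemovablePath

theorem ne_of_mem_offPath (h : IsRemovablePath M u v l) {n : V} (hn : n ∈ offPath M u l) :
    n ≠ u := by
  rintro rfl
  exact (mem_offPath.1 hn).1 (List.mem_of_head? h.head)

theorem mem_of_mem_offPath (h : IsRemovablePath M u v l)
    (hsc : ∀ x y, x ≠ y → (x, y) ∈ M ∨ (y, x) ∈ M) {n : V} (hn : n ∈ offPath M u l) :
    (u, n) ∈ M - pathArcs l := by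
  refine mem_sub_pathArcs_right ?_ (mem_offPath.1 hn).1
  exact (hsc n u (h.ne_of_mem_offPath hn)).resolve_left (mem_offPath.1 hn).2

theorem hasRootedPair_of_offPath_eq_empty (h : IsRemovablePath M u v l)
    (hN : offPath M u l = ∅) : HasRootedPair M u v := by
  refine ⟨(M - pathArcs l).filter fun e => e.2 ≠ u,
    pathArcs l + (M - pathArcs l).filter fun e => ¬ e.2 ≠ u, ?_, ?_, ?_⟩
  · rw [add_left_comm, Multiset.filter_add_not, add_tsub_cancel_of_le h.le]
  · intro x
    refine (h.span x).closed _ .refl fun a b ha hab => ?_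
    by_cases hb : b = u
    · subst hb
      exact .refl
    · exact ha.step (Multiset.mem_filter.2 ⟨hab, hb⟩)
  · have key : ∀ x ∈ l, MReach (pathArcs l + (M - pathArcs l).filter fun e => ¬ e.2 ≠ u) x v :=
      fun x hx => (mreach_pathArcs h.last hx).mono fun e he => Multiset.mem_add.2 (Or.inl he)
    intro x
    by_cases hx : x ∈ l
    · exact key x hx
    · have hxu : (x, u) ∈ M := by
        by_contra hxu
        have : x ∈ offPath M u l := mem_offPath.2 ⟨hx, hxu⟩
        simp [hN] at this
      refine Relation.ReflTransGen.head (b := u) ?_ (key u (List.mem_of_head? h.head))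
      exact Multiset.mem_add.2 (Or.inr (Multiset.mem_filter.2
        ⟨mem_sub_pathArcs_left hxu hx, by simp⟩))

/-- An arc leaving a set that all off-path vertices reach completes the construction as soon as
it is not needed for reaching its head. -/
theorem hasRootedPair_of_exit (h : IsRemovablePath M u v l)
    (hsc : ∀ x y, x ≠ y → (x, y) ∈ M ∨ (y, x) ∈ M) {y w : V} (hy : y ∈ offPath M u l)
    (hw : w ∉ offPath M u l) (hyw : (y, w) ∈ M)
    (hreach : ∀ n ∈ offPath M u l, Relation.ReflTransGen
      (fun a b => a ∈ offPath M u l ∧ b ∈ offPath M u l ∧ (a, b) ∈ M) n y)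
    (hR : MReach ((M - pathArcs l).erase (y, w)) u w) : HasRootedPair M u v := by
  have hwu : w ≠ u := by
    rintro rfl
    exact (mem_offPath.1 hy).2 hyw
  have hyH : (y, w) ∈ M - pathArcs l := mem_sub_pathArcs_left hyw (mem_offPath.1 hy).1
  let p : V × V → Prop := fun e => e.2 = u ∨ (e.1 ∈ offPath M u l ∧ e.2 ∈ offPath M u l)
  let M₂ := pathArcs l + {(y, w)} + ((M - pathArcs l).erase (y, w)).filter p
  refine ⟨((M - pathArcs l).erase (y, w)).filter fun e => ¬ p e, M₂, ?_, ?_, ?_⟩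
  · have h1 : ((M - pathArcs l).erase (y, w)).filter (fun e => ¬ p e) + M₂ =
        pathArcs l + ({(y, w)} + (((M - pathArcs l).erase (y, w)).filter p +
          ((M - pathArcs l).erase (y, w)).filter fun e => ¬ p e)) := by
      simp only [M₂]
      abel
    rw [h1, Multiset.filter_add_not, Multiset.singleton_add, Multiset.cons_erase hyH,
      add_tsub_cancel_of_le h.le]
  · intro x
    refine (MReach.of_erase hR (h.span x)).closed _ .refl fun a b ha hab => ?_
    by_cases hp : p (a, b)
    · rcases hp with hb | ⟨-, hb⟩
      · simp only at hb
        subst hb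
        exact .refl
      · refine MReach.step .refl (Multiset.mem_filter.2 ⟨(Multiset.mem_erase_of_ne ?_).2
          (h.mem_of_mem_offPath hsc hb), ?_⟩)
        · rintro ⟨⟩
          exact hw hb
        · rintro (hb' | ⟨hu, -⟩)
          · exact h.ne_of_mem_offPath hb hb'
          · exact h.ne_of_mem_offPath hu rfl
    · exact ha.step (Multiset.mem_filter.2 ⟨hab, hp⟩)
  · have key : ∀ x ∈ l, MReach M₂ x v :=
      fun x hx => (mreach_pathArcs h.last hx).mono fun e he => by simp [M₂, he]
    have key' : ∀ x, x ∉ offPath M u l → MReach M₂ x v := by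
      intro x hx
      by_cases hxl : x ∈ l
      · exact key x hxl
      · have hxu : (x, u) ∈ M := by
          by_contra hxu
          exact hx (mem_offPath.2 ⟨hxl, hxu⟩)
        refine Relation.ReflTransGen.head (b := u) ?_ (key u (List.mem_of_head? h.head))
        refine Multiset.mem_add.2 (Or.inr (Multiset.mem_filter.2
          ⟨(Multiset.mem_erase_of_ne ?_).2 (mem_sub_pathArcs_left hxu hxl), Or.inl rfl⟩))
        rintro ⟨⟩
        exact hwu rfl
    intro x
    by_cases hx : x ∈ offPath M u l
    · refine Relation.ReflTransGen.trans (b := y) ?_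
        (Relation.ReflTransGen.head (b := w) (by simp [M₂]) (key' w hw))
      refine Relation.ReflTransGen.mono ?_ _ _ (hreach x hx)
      rintro a b ⟨ha, hb, hab⟩
      refine Multiset.mem_add.2 (Or.inr (Multiset.mem_filter.2
          ⟨(Multiset.mem_erase_of_ne ?_).2 (mem_sub_pathArcs_left hab (mem_offPath.1 ha).1),
            Or.inr ⟨ha, hb⟩⟩))
      rintro ⟨⟩
      exact hw hb
    · exact key' x hx

end IsRemovablePath

/-- In a semicomplete digraph every nonempty set contains a vertex reachable inside the set from
all its other vertices. -/
theorem exists_sink (hsc : ∀ x y, x ≠ y → (x, y) ∈ M ∨ (y, x) ∈ M) {N : Finset V}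
    (hN : N.Nonempty) : ∃ c ∈ N, ∀ n ∈ N, Relation.ReflTransGen
      (fun a b => a ∈ N ∧ b ∈ N ∧ (a, b) ∈ M) n c := by
  classical
  obtain ⟨c, hc, hmax⟩ := Finset.exists_max_image N (fun c => (Finset.univ.filter fun n =>
    Relation.ReflTransGen (fun a b => a ∈ N ∧ b ∈ N ∧ (a, b) ∈ M) n c).card) hN
  refine ⟨c, hc, fun n hn => ?_⟩
  by_contra hnc
  have hne : c ≠ n := by
    rintro rfl
    exact hnc .refl
  have hcn : (c, n) ∈ M := (hsc c n hne).resolve_right fun h => hnc (.single ⟨hn, hc, h⟩)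
  refine absurd (Finset.card_lt_card (Finset.ssubset_iff.2 ⟨n, ?_, ?_⟩)) (not_lt.2 (hmax n hn))
  · simpa using hnc
  · intro x hx
    rcases Finset.mem_insert.1 hx with rfl | hx
    · simpa using Relation.ReflTransGen.refl
    · simp only [Finset.mem_filter, Finset.mem_univ, true_and] at hx ⊢
      exact hx.tail ⟨hc, hn, hcn⟩

theorem reroute {α : Type*} [DecidableEq α] {M P P' B C : Multiset α} (h : P' + C = P + B)
    (hP : P ≤ M) (hB : B ≤ M - P) : P' ≤ M ∧ M - P' = C + (M - P - B) := by
  obtain ⟨H, rfl⟩ := Multiset.le_iff_exists_add.1 hP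
  rw [add_tsub_cancel_left] at hB ⊢
  obtain ⟨H, rfl⟩ := Multiset.le_iff_exists_add.1 hB
  rw [← add_assoc, ← h, add_assoc, add_tsub_cancel_left, add_tsub_cancel_left]
  exact ⟨Multiset.le_add_right _ _, rfl⟩

end SemicompleteRooted

section SemicompleteRooted

variable {V : Type*} [DecidableEq V] [Fintype V] {M : Multiset (V × V)} {u v : V} {l : List V}

theorem exists_pred_of_reflTransGen {α : Type*} {r : α → α → Prop} {m y : α}
    (h : Relation.ReflTransGen r m y) (hm : m ≠ y) : ∃ b, b ≠ y ∧ r b y := by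
  induction h with
  | refl => exact absurd rfl hm
  | @tail b c hb hbc ih =>
    by_cases hbc' : b = c
    · subst hbc'
      exact ih hm
    · exact ⟨b, hbc', hbc⟩

set_option maxHeartbeats 1000000 in
/-- Two exit arcs whose heads are consecutive on a best removable path cannot both be needed. -/
theorem IsRemovablePath.exit_contradiction
    (h2 : ∀ X : Finset V, X.Nonempty → X ≠ Finset.univ → 2 ≤ cutOut M X)
    (hsc : ∀ x y, x ≠ y → (x, y) ∈ M ∨ (y, x) ∈ M)
    (h : IsRemovablePath M u v l)
    (hmin : ∀ l', IsRemovablePath M u v l' → (offPath M u l).card ≤ (offPath M u l').card)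
    {C : Finset V} (hCN : C ⊆ offPath M u l)
    (hCreach : ∀ n ∈ offPath M u l, ∀ y ∈ C, Relation.ReflTransGen
      (fun a b => a ∈ offPath M u l ∧ b ∈ offPath M u l ∧ (a, b) ∈ M) n y)
    (hNC : ∀ y ∈ C, ∀ w, w ∉ C → (y, w) ∈ M → ¬ MReach ((M - pathArcs l).erase (y, w)) u w)
    {y w y' w' : V} (hy : y ∈ C) (hw : w ∉ C) (hyw : (y, w) ∈ M) (hy' : y' ∈ C) (hw' : w' ∉ C)
    (hyw' : (y', w') ∈ M) (hww : (w, w') ∈ pathArcs l) : False := by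
  have hoff : ∀ y ∈ C, y ∉ l := fun y hy => (mem_offPath.1 (hCN hy)).1
  have hCu : ∀ y ∈ C, y ≠ u := fun y hy => h.ne_of_mem_offPath (hCN hy)
  have hul : u ∈ l := List.mem_of_head? h.head
  have hexu : ∀ y ∈ C, ∀ w, (y, w) ∈ M → w ≠ u := by
    rintro y hy w hyw rfl
    exact (mem_offPath.1 (hCN hy)).2 hyw
  have hH : ∀ y ∈ C, ∀ w, (y, w) ∈ M → (y, w) ∈ M - pathArcs l :=
    fun y hy w hyw => mem_sub_pathArcs_left hyw (hoff y hy)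
  have hun : ∀ y ∈ C, (u, y) ∈ M - pathArcs l :=
    fun y hy => h.mem_of_mem_offPath hsc (hCN hy)
  have hthree : ∀ {y w z : V} {e : V × V}, y ∈ C → (y, w) ∈ M → (w, z) ∈ M - pathArcs l →
      e ≠ (u, y) → e ≠ (y, w) → e ≠ (w, z) → MReach ((M - pathArcs l).erase e) u z := by
    intro y w z e hy hyw hwz h1 h2 h3
    refine ((MReach.step .refl (y := u) (z := y) ?_).step (z := w) ?_).step ?_
    · exact (Multiset.mem_erase_of_ne h1.symm).2 (hun y hy)
    · exact (Multiset.mem_erase_of_ne h2.symm).2 (hH y hy w hyw)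
    · exact (Multiset.mem_erase_of_ne h3.symm).2 hwz
  have hheads' : ∀ {y₁ w₁ y₂ w₂ : V}, y₁ ∈ C → w₁ ∉ C → (y₁, w₁) ∈ M → y₂ ∈ C → w₂ ∉ C →
      (y₂, w₂) ∈ M → w₁ ≠ w₂ → (w₁, w₂) ∉ M - pathArcs l := by
    intro y₁ w₁ y₂ w₂ hy₁ hw₁ he₁ hy₂ hw₂ he₂ hne hmem
    refine hNC y₂ hy₂ w₂ hw₂ he₂ (hthree hy₁ he₁ hmem ?_ ?_ ?_)
    · rintro ⟨⟩
      exact hCu _ hy₂ rfl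
    · rintro ⟨⟩
      exact hne rfl
    · rintro ⟨⟩
      exact hw₁ hy₂
  have hheads : ∀ {y₁ w₁ y₂ w₂ : V}, y₁ ∈ C → w₁ ∉ C → (y₁, w₁) ∈ M → y₂ ∈ C → w₂ ∉ C →
      (y₂, w₂) ∈ M → w₁ ≠ w₂ → (w₁, w₂) ∈ pathArcs l ∨ (w₂, w₁) ∈ pathArcs l := by
    intro y₁ w₁ y₂ w₂ hy₁ hw₁ he₁ hy₂ hw₂ he₂ hne
    by_contra! hcon
    rcases hsc w₁ w₂ hne with hm | hm
    · exact hheads' hy₁ hw₁ he₁ hy₂ hw₂ he₂ hne (mem_sub_of_notMem hm hcon.1)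
    · exact hheads' hy₂ hw₂ he₂ hy₁ hw₁ he₁ hne.symm (mem_sub_of_notMem hm hcon.2)
  have hyl := hoff y hy
  have hwu := hexu y hy w hyw
  have hywH := hH y hy w hyw
  obtain ⟨l₀, l₂, hl⟩ := exists_of_mem_pathArcs hww
  obtain ⟨l₁, x, rfl⟩ : ∃ l₁ x, l₀ = l₁ ++ [x] := by
    rcases List.eq_nil_or_concat l₀ with rfl | ⟨l₁, x, rfl⟩
    · have := h.head
      rw [hl] at this
      simp at this
      exact absurd this hwu
    · exact ⟨l₁, x, by simp⟩
  have hl : l = l₁ ++ x :: w :: w' :: l₂ := by simpa using hl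
  have hix : l[l₁.length]? = some x := by simp [hl]
  have hiw : l[l₁.length + 1]? = some w := by simp [hl]
  have hiw' : l[l₁.length + 2]? = some w' := by simp [hl]
  have hxl : x ∈ l := by simp [hl]
  have hnd := h.nodup
  have hww_ne : w ≠ w' := by
    rintro rfl
    have := hnd.index_unique hiw hiw'
    omega
  have hxw' : x ≠ w' := by
    rintro rfl
    have := hnd.index_unique hix hiw'
    omega
  have hxC : x ∉ C := fun hx => hoff x hx hxl
  have hxw'_path : (x, w') ∉ pathArcs l := by
    intro hm
    obtain ⟨i, h1, h2⟩ := exists_index_of_mem_pathArcs hm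
    have := hnd.index_unique h1 hix
    have := hnd.index_unique h2 hiw'
    omega
  have hw'x_path : (w', x) ∉ pathArcs l := by
    intro hm
    obtain ⟨i, h1, h2⟩ := exists_index_of_mem_pathArcs hm
    have := hnd.index_unique h1 hiw'
    have := hnd.index_unique h2 hix
    omega
  -- the predecessor of `w` on the path stays reachable without `(y, w)`
  have hxR : MReach ((M - pathArcs l).erase (y, w)) u x := by
    rcases hsc w' x hxw'.symm with hm | hm
    · refine hthree hy' hyw' (mem_sub_of_notMem hm hw'x_path) ?_ ?_ ?_
      · rintro ⟨⟩
        exact hCu _ hy rfl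
      · rintro ⟨⟩
        exact hww_ne rfl
      · rintro ⟨⟩
        exact hw' hy
    · have hmH := mem_sub_of_notMem hm hxw'_path
      have hor : MReach ((M - pathArcs l).erase (y, w)) u x ∨
          MReach ((M - pathArcs l).erase (y', w')) u x := by
        refine (h.span x).closed (fun z => MReach ((M - pathArcs l).erase (y, w)) u z ∨
          MReach ((M - pathArcs l).erase (y', w')) u z) (Or.inl .refl) ?_
        rintro a b (ha | ha) hab
        · by_cases hab' : (a, b) = (y, w)
          · cases hab'
            right
            refine (MReach.step .refl (y := u) (z := y) ?_).step ?_
            · refine (Multiset.mem_erase_of_ne ?_).2 (hun y hy)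
              rintro ⟨⟩
              exact hCu _ hy' rfl
            · refine (Multiset.mem_erase_of_ne ?_).2 hywH
              rintro ⟨⟩
              exact hww_ne rfl
          · exact Or.inl (ha.step ((Multiset.mem_erase_of_ne hab').2 hab))
        · by_cases hab' : (a, b) = (y', w')
          · cases hab'
            left
            refine (MReach.step .refl (y := u) (z := y') ?_).step ?_
            · refine (Multiset.mem_erase_of_ne ?_).2 (hun y' hy')
              rintro ⟨⟩
              exact hCu _ hy rfl
            · refine (Multiset.mem_erase_of_ne ?_).2 (hH y' hy' w' hyw')
              rintro ⟨⟩
              exact hww_ne rfl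
          · exact Or.inr (ha.step ((Multiset.mem_erase_of_ne hab').2 hab))
      refine hor.resolve_right fun hx => hNC y' hy' w' hw' hyw' (hx.step ?_)
      refine (Multiset.mem_erase_of_ne ?_).2 hmH
      rintro ⟨⟩
      exact hxC hy'
  have hxy : (x, y) ∈ M - pathArcs l := by
    by_cases hxu : x = u
    · subst hxu
      exact hun y hy
    · refine mem_sub_pathArcs_right ?_ hyl
      refine (hsc x y ?_).resolve_right fun hyx => ?_
      · rintro rfl
        exact hyl hxl
      · rcases hheads hy hxC hyx hy' hw' hyw' hxw' with hm | hm
        · exact hxw'_path hm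
        · exact hw'x_path hm
  -- reroute the path through `y`
  have hB : {(x, y), (y, w)} ≤ M - pathArcs l := by
    have hne : (x, y) ≠ (y, w) := by
      rintro ⟨⟩
      exact hyl hxl
    rw [Multiset.insert_eq_cons, ← Multiset.cons_erase hxy]
    exact Multiset.cons_le_cons _ (Multiset.singleton_le.2
      ((Multiset.mem_erase_of_ne hne.symm).2 hywH))
  have hpl : pathArcs l = pathArcs (l₁ ++ [x]) + ((x, w) ::ₘ pathArcs (w :: w' :: l₂)) := by
    rw [hl, pathArcs_append]
    rfl
  have hpl' : pathArcs (l₁ ++ x :: y :: w :: w' :: l₂) = pathArcs (l₁ ++ [x]) +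
      ((x, y) ::ₘ (y, w) ::ₘ pathArcs (w :: w' :: l₂)) := by
    rw [pathArcs_append]
    rfl
  obtain ⟨hle', hsub'⟩ := reroute (P' := pathArcs (l₁ ++ x :: y :: w :: w' :: l₂))
    (C := {(x, w)}) (B := {(x, y), (y, w)}) (by
      rw [hpl, hpl']
      simp only [Multiset.insert_eq_cons, ← Multiset.singleton_add]
      abel) h.le hB
  have hres' : ¬ ∀ z, MReach (M - pathArcs (l₁ ++ x :: y :: w :: w' :: l₂)) u z := by
    intro hspan
    have hres : IsRemovablePath M u v (l₁ ++ x :: y :: w :: w' :: l₂) := by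
      refine ⟨?_, ?_, ?_, hle', hspan⟩
      · have : (y :: l).Nodup := List.nodup_cons.2 ⟨hyl, hnd⟩
        refine (List.Perm.nodup_iff ?_).1 this
        rw [hl]
        have := (List.perm_middle (a := y) (l₁ := l₁ ++ [x]) (l₂ := w :: w' :: l₂)).symm
        simpa using this
      · rw [← h.head, hl]
        cases l₁ <;> simp
      · rw [← h.last, hl]
        simp [List.getLast?_append]
    refine absurd (hmin _ hres) (not_le.2 (Finset.card_lt_card
      (Finset.ssubset_iff.2 ⟨y, ?_, ?_⟩)))
    · simp [mem_offPath]
    · intro z hz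
      rcases Finset.mem_insert.1 hz with rfl | hz
      · exact hCN hy
      · rw [mem_offPath] at hz ⊢
        refine ⟨fun hzl => hz.1 ?_, hz.2⟩
        rw [hl] at hzl
        simp at hzl ⊢
        tauto
  rw [hsub'] at hres'
  generalize hK : {(x, w)} + (M - pathArcs l - {(x, y), (y, w)}) = K at hres'
  generalize hH1 : M - pathArcs l - {(x, y), (y, w)} = H₁ at hK
  have hH1' : M - pathArcs l = (x, y) ::ₘ (y, w) ::ₘ H₁ := by
    rw [← tsub_add_cancel_of_le hB, hH1, add_comm, Multiset.insert_eq_cons, Multiset.cons_add,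
      Multiset.singleton_add]
  have hmem1 : ∀ a b, (a, b) ∈ M - pathArcs l → (a, b) ≠ (x, y) → (a, b) ≠ (y, w) →
      (a, b) ∈ K := by
    intro a b hab h1 h2
    rw [hH1', Multiset.mem_cons, Multiset.mem_cons] at hab
    rw [← hK]
    simp only [Multiset.mem_add]
    tauto
  have hKw : (x, w) ∈ K := by simp [← hK]
  have hKsub : ∀ a b, (a, b) ∈ K → (a, b) = (x, w) ∨ (a, b) ∈ M - pathArcs l := by
    intro a b hab
    rw [← hK] at hab
    rw [hH1']
    simp only [Multiset.mem_add, Multiset.mem_singleton, Multiset.mem_cons] at hab ⊢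
    tauto
  have hyP : ¬ MReach K u y := by
    intro hyP
    apply hres'
    have hxP : MReach K u x := by
      refine hxR.closed _ .refl fun a b ha hab => ?_
      by_cases hab' : (a, b) = (x, y)
      · cases hab'
        exact hyP
      · rw [hH1', Multiset.cons_swap, Multiset.erase_cons_head, Multiset.mem_cons] at hab
        refine ha.step ?_
        rw [← hK]
        exact Multiset.mem_add.2 (Or.inr (hab.resolve_left hab'))
    intro z
    refine (h.span z).closed _ .refl fun a b ha hab => ?_
    by_cases h1 : (a, b) = (x, y)
    · cases h1
      exact hyP
    by_cases h2 : (a, b) = (y, w)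
    · cases h2
      exact hxP.step hKw
    exact ha.step (hmem1 a b hab h1 h2)
  have hyw_ne : y ≠ w := by
    rintro rfl
    exact hw hy
  have hxu : x = u := by
    by_contra hxu
    refine hyP (MReach.step .refl (hmem1 _ _ (hun y hy) ?_ ?_))
    · rintro ⟨⟩
      exact hxu rfl
    · rintro ⟨⟩
      exact hCu _ hy rfl
  subst hxu
  have hl1 : l₁ = [] := by
    cases l₁ with
    | nil => rfl
    | cons a l₁ =>
      have h0 : l[0]? = some x := by
        have := h.head
        rw [hl] at this ⊢
        simpa using this
      have := hnd.index_unique hix h0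
      simp at this
  subst hl1
  have hPy : ∀ p, MReach K x p → p ≠ x → (p, y) ∉ M := by
    intro p hp hpx hpy
    refine hyP (hp.step (hmem1 _ _ (mem_sub_pathArcs_right hpy hyl) ?_ ?_))
    · rintro ⟨⟩
      exact hpx rfl
    · rintro ⟨⟩
      exact hyw_ne rfl
  have hN : ∀ m ∈ offPath M x l, m = y := by
    intro m hm
    by_contra hmy
    obtain ⟨b, hby, hb, -, hbM⟩ := exists_pred_of_reflTransGen (hCreach m hm y hy) hmy
    refine hPy b (MReach.step .refl (hmem1 _ _ (h.mem_of_mem_offPath hsc hb) ?_ ?_))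
      (h.ne_of_mem_offPath hb) hbM
    · rintro ⟨⟩
      exact hby rfl
    · rintro ⟨⟩
      exact hCu _ hy rfl
  obtain rfl : y' = y := hN y' (hCN hy')
  have hout : ∀ p, p ≠ y' → (y', p) ∈ M → p = w ∨ p = w' := by
    intro p hpy hp
    have hpC : p ∉ C := fun hpC => hpy (hN p (hCN hpC))
    by_contra! hcon
    rcases hheads hy hpC hp hy hw hyw hcon.1 with hm | hm
    · obtain ⟨i, h1, h2⟩ := exists_index_of_mem_pathArcs hm
      have := hnd.index_unique h2 hiw
      obtain rfl : i = 0 := by simpa using this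
      rw [hl] at h1
      simp at h1
      exact hexu _ hy p hp h1.symm
    · obtain ⟨i, h1, h2⟩ := exists_index_of_mem_pathArcs hm
      have := hnd.index_unique h1 hiw
      obtain rfl : i = 1 := by simpa using this
      rw [hl] at h2
      simp at h2
      exact hcon.2 h2.symm
  have hw'P : ¬ MReach K x w' := by
    intro hw'P
    refine hNC y' hy w' hw' hyw' ?_
    refine (hw'P.closed (fun z => MReach K x z ∧ MReach ((M - pathArcs l).erase (y', w')) x z)
      ⟨.refl, .refl⟩ ?_).2
    rintro a b ⟨ha, ha'⟩ hab
    refine ⟨ha.step hab, ?_⟩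
    rcases hKsub a b hab with hab' | hab'
    · cases hab'
      refine (MReach.step .refl (y := x) (z := y') ?_).step ?_
      · refine (Multiset.mem_erase_of_ne ?_).2 (hun y' hy')
        rintro ⟨⟩
        exact hCu _ hy rfl
      · refine (Multiset.mem_erase_of_ne ?_).2 hywH
        rintro ⟨⟩
        exact hww_ne rfl
    · refine ha'.step ((Multiset.mem_erase_of_ne ?_).2 hab')
      rintro ⟨⟩
      exact hyP ha
  have hP : ∀ p, MReach K x p → p = x ∨ p = w := by
    intro p hp
    by_contra! hcon
    have hpy : p ≠ y' := by
      rintro rfl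
      exact hyP hp
    rcases hout p hpy ((hsc p y' hpy).resolve_left (hPy p hp hcon.1)) with rfl | rfl
    · exact hcon.2 rfl
    · exact hw'P hp
  simp only [List.nil_append] at hl hpl hpl' hle' hsub'
  have hwx : (w, x) ∈ M := by
    have hcut := h2 {w} (by simp) (fun hu => hwu (by
      have := Finset.mem_univ x
      rw [← hu] at this
      exact (Finset.mem_singleton.1 this).symm))
    have hMeq : M = pathArcs (x :: y' :: w :: w' :: l₂) + K := by
      rw [← hK, ← hH1, ← hsub', add_tsub_cancel_of_le hle']
    have hw2 : w ∉ w' :: l₂ := by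
      rw [hl] at hnd
      simp only [List.nodup_cons] at hnd
      exact hnd.2.1
    have h0 : Multiset.countP (fun e : V × V => e.1 ∈ ({w} : Finset V) ∧ e.2 ∉ ({w} : Finset V))
        (pathArcs (w' :: l₂)) = 0 := by
      rw [Multiset.countP_eq_zero]
      rintro ⟨a, b⟩ he ⟨h1, -⟩
      obtain rfl : a = w := Finset.mem_singleton.1 h1
      exact hw2 (left_mem_of_mem_pathArcs he)
    rw [cutOut, hMeq, Multiset.countP_add] at hcut
    simp only [pathArcs_cons_cons w, pathArcs_cons_cons x, pathArcs_cons_cons y',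
      Multiset.countP_cons, h0] at hcut
    simp [hyw_ne, hwu.symm] at hcut
    have hpos : 0 < Multiset.countP (fun e : V × V => e.1 = w ∧ ¬ e.2 = w) K := by
      split_ifs at hcut <;> omega
    obtain ⟨⟨a, b⟩, hab, rfl, hb⟩ := Multiset.countP_pos.1 hpos
    simp only at hb
    rcases hP b ((MReach.step .refl hKw).step hab) with rfl | rfl
    · rw [hMeq]
      exact Multiset.mem_add.2 (Or.inr hab)
    · exact absurd rfl hb
  -- reroute the path through `y`, skipping `w`
  have hB2 : {(x, y'), (y', w')} ≤ M - pathArcs l := by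
    have hne : (x, y') ≠ (y', w') := by
      rintro ⟨⟩
      exact hyl hxl
    rw [Multiset.insert_eq_cons, ← Multiset.cons_erase hxy]
    exact Multiset.cons_le_cons _ (Multiset.singleton_le.2
      ((Multiset.mem_erase_of_ne hne.symm).2 (hH y' hy w' hyw')))
  obtain ⟨hle2, hsub2⟩ := reroute (P' := pathArcs (x :: y' :: w' :: l₂))
    (C := {(x, w), (w, w')}) (B := {(x, y'), (y', w')}) (by
      rw [hpl]
      simp only [pathArcs_cons_cons, pathArcs_singleton, Multiset.insert_eq_cons,
        ← Multiset.singleton_add]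
      abel) h.le hB2
  have hmem2 : ∀ a b, (a, b) ∈ M - pathArcs l → (a, b) ≠ (x, y') → (a, b) ≠ (y', w') →
      (a, b) ∈ M - pathArcs (x :: y' :: w' :: l₂) := by
    intro a b hab h1 h2
    rw [← tsub_add_cancel_of_le hB2] at hab
    rw [hsub2]
    simp only [Multiset.mem_add, Multiset.insert_eq_cons, Multiset.mem_cons,
      Multiset.mem_singleton] at hab ⊢
    tauto
  have hw2 : MReach (M - pathArcs (x :: y' :: w' :: l₂)) x w :=
    MReach.step .refl (by rw [hsub2]; simp)
  have hw2' : MReach (M - pathArcs (x :: y' :: w' :: l₂)) x w' :=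
    hw2.step (by rw [hsub2]; simp)
  have hspan2 : ∀ z, z = y' ∨ MReach (M - pathArcs (x :: y' :: w' :: l₂)) x z := by
    intro z
    refine (h.span z).closed (fun z => z = y' ∨ MReach (M - pathArcs (x :: y' :: w' :: l₂)) x z)
      (Or.inr .refl) ?_
    intro a b ha hab
    by_cases hb : b = y'
    · exact Or.inl hb
    right
    rcases ha with rfl | ha
    · rcases hout b hb (Multiset.mem_of_le (Multiset.sub_le_self _ _) hab) with rfl | rfl
      · exact hw2
      · exact hw2'
    · by_cases ha' : a = y'
      · subst ha'
        rcases hout b hb (Multiset.mem_of_le (Multiset.sub_le_self _ _) hab) with rfl | rfl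
        · exact hw2
        · exact hw2'
      · refine ha.step (hmem2 a b hab ?_ ?_)
        · rintro ⟨⟩
          exact hb rfl
        · rintro ⟨⟩
          exact ha' rfl
  have hy2 : MReach (M - pathArcs (x :: y' :: w' :: l₂)) x y' := by
    have hcut := h2 {y'}ᶜ ⟨x, by simpa using (hCu _ hy).symm⟩ (fun hu => by
      have := Finset.mem_univ y'
      rw [← hu] at this
      simp at this)
    rw [← cutIn_eq_cutOut_compl, cutIn, ← add_tsub_cancel_of_le h.le, hH1',
      Multiset.countP_add, (Multiset.countP_eq_zero (s := pathArcs l)).2] at hcut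
    · simp only [Multiset.countP_cons] at hcut
      simp [hyw_ne.symm] at hcut
      have hpos : 0 < Multiset.countP (fun e : V × V => ¬ e.1 = y' ∧ e.2 = y') H₁ := by
        split_ifs at hcut <;> omega
      obtain ⟨⟨a, b⟩, hab, ha, hb⟩ := Multiset.countP_pos.1 hpos
      obtain rfl : b = y' := hb
      simp only at ha
      have hax : a ≠ x := by
        rintro rfl
        refine hyP (MReach.step .refl ?_)
        rw [← hK]
        exact Multiset.mem_add.2 (Or.inr hab)
      refine ((hspan2 a).resolve_left ha).step (hmem2 _ _ ?_ ?_ ?_)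
      · rw [hH1']
        simp [hab]
      · rintro ⟨⟩
        exact hax rfl
      · rintro ⟨⟩
        exact ha rfl
    · rintro ⟨a, b⟩ he ⟨-, hb⟩
      obtain rfl : b = y' := Finset.mem_singleton.1 hb
      exact hyl (right_mem_of_mem_pathArcs he)
  have hres2 : IsRemovablePath M x v (x :: y' :: w' :: l₂) := by
    refine ⟨?_, rfl, ?_, hle2, fun z => ?_⟩
    · rw [hl] at hnd hyl
      simp only [List.nodup_cons, List.mem_cons, not_or] at hnd hyl ⊢
      tauto
    · rw [← h.last, hl]
      simp
    · rcases hspan2 z with rfl | hz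
      · exact hy2
      · exact hz
  have hempty : offPath M x (x :: y' :: w' :: l₂) = ∅ := by
    rw [Finset.eq_empty_iff_forall_notMem]
    intro z hz
    rw [mem_offPath] at hz
    have hzw : z ≠ w := by
      rintro rfl
      exact hz.2 hwx
    have hzy := hN z (mem_offPath.2 ⟨fun hzl => hz.1 ?_, hz.2⟩)
    · simp [hzy] at hz
    · rw [hl] at hzl
      simp only [List.mem_cons] at hzl ⊢
      tauto
  have := hmin _ hres2
  rw [hempty, Finset.card_empty, Nat.le_zero, Finset.card_eq_zero] at this
  have hyN := hCN hy
  simp [this] at hyN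

/-- A semicomplete multidigraph in which at least two arcs leave every nonempty proper vertex set
contains a rooted pair for every choice of the two roots. -/
theorem hasRootedPair_of_semicomplete (M : Multiset (V × V)) (u v : V)
    (h2 : ∀ X : Finset V, X.Nonempty → X ≠ Finset.univ → 2 ≤ cutOut M X)
    (hsc : ∀ x y, x ≠ y → (x, y) ∈ M ∨ (y, x) ∈ M) : HasRootedPair M u v := by
  classical
  by_contra hcon
  have hex : ∃ n l, IsRemovablePath M u v l ∧ (offPath M u l).card = n := by
    obtain ⟨l, h1, h2, h3, h4, h5⟩ := exists_path_removal M u v fun X hX hu => by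
      rw [cutIn_eq_cutOut_compl]
      refine h2 _ ⟨u, by simpa using hu⟩ ?_
      rwa [Ne, Finset.compl_eq_univ_iff, ← Finset.not_nonempty_iff_eq_empty, not_not]
    exact ⟨_, l, ⟨h1, h2, h3, h4, h5⟩, rfl⟩
  obtain ⟨l, h, hl⟩ := Nat.find_spec hex
  have hmin : ∀ l', IsRemovablePath M u v l' → (offPath M u l).card ≤ (offPath M u l').card :=
    fun l' h' => hl.trans_le (Nat.find_min' hex ⟨l', h', rfl⟩)
  rcases (offPath M u l).eq_empty_or_nonempty with hN | hN
  · exact hcon (h.hasRootedPair_of_offPath_eq_empty hN)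
  obtain ⟨c, hc, hsink⟩ := exists_sink hsc hN
  let r : V → V → Prop := fun a b => a ∈ offPath M u l ∧ b ∈ offPath M u l ∧ (a, b) ∈ M
  let C : Finset V := Finset.univ.filter fun n => Relation.ReflTransGen r c n
  have hC : ∀ n, n ∈ C ↔ Relation.ReflTransGen r c n := fun n => by simp [C]
  have hCN : C ⊆ offPath M u l := by
    intro n hn
    rw [hC] at hn
    cases hn with
    | refl => exact hc
    | tail _ h => exact h.2.1
  have hCcl : ∀ y ∈ C, ∀ z ∈ offPath M u l, (y, z) ∈ M → z ∈ C := by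
    intro y hy z hz hyz
    rw [hC]
    exact ((hC y).1 hy).tail ⟨hCN hy, hz, hyz⟩
  have hCreach : ∀ n ∈ offPath M u l, ∀ y ∈ C, Relation.ReflTransGen r n y :=
    fun n hn y hy => (hsink n hn).trans ((hC y).1 hy)
  have hNC : ∀ y ∈ C, ∀ w, w ∉ C → (y, w) ∈ M →
      ¬ MReach ((M - pathArcs l).erase (y, w)) u w := by
    intro y hy w hw hyw hR
    exact hcon (h.hasRootedPair_of_exit hsc (hCN hy) (fun hwN => hw (hCcl y hy w hwN hyw)) hyw
      (fun n hn => hCreach n hn y hy) hR)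
  have hcut := h2 C ⟨c, (hC c).2 .refl⟩ (fun hu => by
    have := hCN (hu ▸ Finset.mem_univ u)
    exact h.ne_of_mem_offPath this rfl)
  obtain ⟨⟨y, w⟩, ⟨y', w'⟩, hle, ⟨hy, hw⟩, ⟨hy', hw'⟩⟩ := exists_pair_of_two_le_countP _ _ hcut
  simp only at hy hw hy' hw'
  have hyw : (y, w) ∈ M := Multiset.mem_of_le hle (by simp)
  have hyw' : (y', w') ∈ M := Multiset.mem_of_le hle (by simp)
  have hywH := mem_sub_pathArcs_left hyw (mem_offPath.1 (hCN hy)).1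
  have hywH' := mem_sub_pathArcs_left hyw' (mem_offPath.1 (hCN hy')).1
  have hun : ∀ n ∈ C, (u, n) ∈ M - pathArcs l := fun n hn => h.mem_of_mem_offPath hsc (hCN hn)
  have hCu : ∀ y ∈ C, y ≠ u := fun y hy => h.ne_of_mem_offPath (hCN hy)
  have hne : w ≠ w' := by
    rintro rfl
    refine hNC y hy w hw hyw ((MReach.step .refl (y := u) (z := y') ?_).step ?_)
    · refine (Multiset.mem_erase_of_ne ?_).2 (hun y' hy')
      rintro ⟨⟩
      exact hCu _ hy rfl
    · by_cases hyy : y' = y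
      · subst hyy
        have h1 : ({(y', w), (y', w)} : Multiset (V × V)) ≤ M - pathArcs l := by
          rw [Multiset.le_iff_count]
          intro e
          rw [Multiset.count_sub]
          by_cases he : e = (y', w)
          · subst he
            rw [(Multiset.count_eq_zero (s := pathArcs l)).2 fun hm =>
              (mem_offPath.1 (hCN hy)).1 (left_mem_of_mem_pathArcs hm), tsub_zero]
            exact Multiset.le_iff_count.1 hle _
          · rw [Multiset.count_eq_zero.2 (by simpa using he)]
            exact Nat.zero_le _
        exact mem_erase_of_pair_le h1
      · refine (Multiset.mem_erase_of_ne ?_).2 hywH'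
        rintro ⟨⟩
        exact hyy rfl
  have hstep : ∀ {y w y' w' : V}, y ∈ C → w ∉ C → (y, w) ∈ M → y' ∈ C → w' ∉ C → (y', w') ∈ M →
      w ≠ w' → (w, w') ∈ M - pathArcs l → False := by
    intro y w y' w' hy hw hyw hy' hw' hyw' hne hmem
    refine hNC y' hy' w' hw' hyw' (((MReach.step .refl (y := u) (z := y) ?_).step
      (z := w) ?_).step ?_)
    · refine (Multiset.mem_erase_of_ne ?_).2 (hun y hy)
      rintro ⟨⟩
      exact hCu _ hy' rfl
    · refine (Multiset.mem_erase_of_ne ?_).2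
        (mem_sub_pathArcs_left hyw (mem_offPath.1 (hCN hy)).1)
      rintro ⟨⟩
      exact hne rfl
    · refine (Multiset.mem_erase_of_ne ?_).2 hmem
      rintro ⟨⟩
      exact hw hy'
  by_cases h1 : (w, w') ∈ pathArcs l
  · exact h.exit_contradiction h2 hsc hmin hCN hCreach hNC hy hw hyw hy' hw' hyw' h1
  by_cases h1' : (w', w) ∈ pathArcs l
  · exact h.exit_contradiction h2 hsc hmin hCN hCreach hNC hy' hw' hyw' hy hw hyw h1'
  rcases hsc w w' hne with hm | hm
  · exact hstep hy hw hyw hy' hw' hyw' hne (mem_sub_of_notMem hm h1)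
  · exact hstep hy' hw' hyw' hy hw hyw hne.symm (mem_sub_of_notMem hm h1')

end SemicompleteRooted

section SteinerConnectivity

variable {V : Type*} [DecidableEq V]

/-- Arc-disjoint arc sets, one reaching all of `S` from `u`, one reaching `v` from all of `S`. -/
def HasRootedPairOn (S : Finset V) (M : Multiset (V × V)) (u v : V) : Prop :=
  ∃ M₁ M₂, M₁ + M₂ ≤ M ∧ (∀ x ∈ S, MReach M₁ u x) ∧ ∀ x ∈ S, MReach M₂ x v

/-- At least two arcs leave every vertex set separating `S`. -/
def ConnOn (S : Finset V) (M : Multiset (V × V)) : Prop :=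
  ∀ X : Finset V, (∃ x ∈ S, x ∈ X) → (∃ x ∈ S, x ∉ X) → 2 ≤ cutOut M X

theorem HasRootedPairOn.mono {S : Finset V} {M N : Multiset (V × V)} {u v : V}
    (h : HasRootedPairOn S M u v) (hMN : M ≤ N) : HasRootedPairOn S N u v := by
  obtain ⟨M₁, M₂, hle, h1, h2⟩ := h
  exact ⟨M₁, M₂, hle.trans hMN, h1, h2⟩

theorem ConnOn.two_le_cutIn [Fintype V] {S : Finset V} {M : Multiset (V × V)} (h : ConnOn S M)
    (X : Finset V) (hX : ∃ x ∈ S, x ∈ X) (hX' : ∃ x ∈ S, x ∉ X) : 2 ≤ cutIn M X := by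
  rw [cutIn_eq_cutOut_compl]
  exact h _ (by simpa using hX') (by simpa using hX)

theorem hasRootedPairOn_of_semicomplete {S : Finset V} {M : Multiset (V × V)} {u v : V}
    (hu : u ∈ S) (hv : v ∈ S) (hM : ∀ e ∈ M, e.1 ∈ S ∧ e.2 ∈ S) (hconn : ConnOn S M)
    (hsc : ∀ x ∈ S, ∀ y ∈ S, x ≠ y → (x, y) ∈ M ∨ (y, x) ∈ M) : HasRootedPairOn S M u v := by
  let f : S × S → V × V := Prod.map Subtype.val Subtype.val
  obtain ⟨M', rfl⟩ : ∃ M' : Multiset (S × S), M'.map f = M := by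
    refine ⟨M.pmap (fun e h => (⟨e.1, h.1⟩, ⟨e.2, h.2⟩)) hM, ?_⟩
    rw [Multiset.map_pmap]
    simp [f, Multiset.pmap_eq_map]
  have hmem : ∀ x y : S, ((x : V), (y : V)) ∈ M'.map f ↔ (x, y) ∈ M' := by
    intro x y
    have hf : Function.Injective f := Subtype.val_injective.prodMap Subtype.val_injective
    exact Multiset.mem_map_of_injective hf (a := (x, y))
  obtain ⟨M₁, M₂, hle, h1, h2⟩ := hasRootedPair_of_semicomplete M' ⟨u, hu⟩ ⟨v, hv⟩ (by
    intro X ⟨x, hx⟩ hX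
    obtain ⟨y, hy⟩ : ∃ y, y ∉ X := by
      by_contra! h
      exact hX (Finset.eq_univ_iff_forall.2 h)
    have := hconn (X.map ⟨Subtype.val, Subtype.val_injective⟩) ⟨x, x.2, by simpa using hx⟩
      ⟨y, y.2, by simpa using hy⟩
    rw [cutOut, Multiset.countP_map] at this
    rw [cutOut, Multiset.countP_eq_card_filter]
    convert this using 4 <;> simp [f]) (by
    intro x y hxy
    rw [← hmem, ← hmem]
    exact hsc x x.2 y y.2 fun h => hxy (Subtype.ext h))
  have hlift : ∀ (N : Multiset (S × S)) (x y : S), MReach N x y → MReach (N.map f) x y :=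
    fun N x y h => Relation.ReflTransGen.lift Subtype.val
      (fun a b hab => Multiset.mem_map_of_mem f hab) _ _ h
  refine ⟨M₁.map f, M₂.map f, ?_, fun x hx => hlift _ _ _ (h1 ⟨x, hx⟩),
    fun x hx => hlift _ _ _ (h2 ⟨x, hx⟩)⟩
  rw [← Multiset.map_add]
  exact Multiset.map_le_map hle

theorem cutOut_union_add_inter_le (M : Multiset (V × V)) (X Y : Finset V) :
    cutOut M (X ∪ Y) + cutOut M (X ∩ Y) ≤ cutOut M X + cutOut M Y := by
  unfold cutOut
  induction M using Multiset.induction with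
  | empty => simp
  | cons e M ih =>
    simp only [Multiset.countP_cons]
    have : (if e.1 ∈ X ∪ Y ∧ e.2 ∉ X ∪ Y then 1 else 0) + (if e.1 ∈ X ∩ Y ∧ e.2 ∉ X ∩ Y then 1 else 0)
      ≤ (if e.1 ∈ X ∧ e.2 ∉ X then 1 else 0) + (if e.1 ∈ Y ∧ e.2 ∉ Y then 1 else 0) := by
      simp only [Finset.mem_union, Finset.mem_inter]
      by_cases e.1 ∈ X <;> by_cases e.2 ∈ X <;> by_cases e.1 ∈ Y <;> by_cases e.2 ∈ Y <;> simp [*]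
    omega

theorem cutIn_union_add_inter_le [Fintype V] (M : Multiset (V × V)) (X Y : Finset V) :
    cutIn M (X ∪ Y) + cutIn M (X ∩ Y) ≤ cutIn M X + cutIn M Y := by
  simp only [cutIn_eq_cutOut_compl, Finset.compl_union, Finset.compl_inter]
  rw [add_comm]
  exact cutOut_union_add_inter_le M _ _

/-- The number of arcs with head `t`. -/
def mInDeg (M : Multiset (V × V)) (t : V) : ℕ := M.countP fun e => e.2 = t

/-- The number of arcs with tail `t`. -/
def mOutDeg (M : Multiset (V × V)) (t : V) : ℕ := M.countP fun e => e.1 = t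

theorem one_le_countP_eq {α : Type*} [DecidableEq α] {M : Multiset α} {a : α} (h : a ∈ M) :
    1 ≤ M.countP fun e => e = a :=
  Multiset.countP_pos.2 ⟨a, h, rfl⟩

section Inequalities

variable {S X Y : Finset V} {M : Multiset (V × V)} {t y : V}

theorem cutOut_insert_add_le (htX : t ∉ X) (htY : t ∉ Y) (hyX : y ∈ X) (hyY : y ∈ Y)
    (hin : ∀ e ∈ M, e.2 = t → e.1 ∈ X ∨ e.1 ∈ Y) (hout : ∀ e ∈ M, e.1 = t → e.2 ∈ X ∨ e.2 ∈ Y)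
    (hy : (t, y) ∈ M) :
    cutOut M (insert t X) + cutOut M (insert t Y) + mInDeg M t + 1 ≤
      cutOut M X + cutOut M Y + mOutDeg M t := by
  refine (Nat.add_le_add_left (one_le_countP_eq hy) _).trans ?_
  clear hy
  unfold cutOut mInDeg mOutDeg
  induction M using Multiset.induction with
  | empty => simp
  | cons e M ih =>
    have ih := ih (fun e he => hin e (Multiset.mem_cons_of_mem he))
      (fun e he => hout e (Multiset.mem_cons_of_mem he))
    have hin := hin e (Multiset.mem_cons_self _ _)
    have hout := hout e (Multiset.mem_cons_self _ _)
    obtain ⟨a, b⟩ := e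
    simp only [Multiset.countP_cons, Finset.mem_insert, Prod.mk.injEq] at hin hout ih ⊢
    grind

theorem cutIn_insert_add_le (htX : t ∉ X) (htY : t ∉ Y) (hyX : y ∈ X) (hyY : y ∈ Y)
    (hin : ∀ e ∈ M, e.2 = t → e.1 ∈ X ∨ e.1 ∈ Y) (hout : ∀ e ∈ M, e.1 = t → e.2 ∈ X ∨ e.2 ∈ Y)
    (hy : (t, y) ∈ M) :
    cutIn M (insert t X) + cutIn M (insert t Y) + mOutDeg M t + 1 ≤
      cutIn M X + cutIn M Y + mInDeg M t := by
  refine (Nat.add_le_add_left (one_le_countP_eq hy) _).trans ?_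
  clear hy
  unfold cutIn mInDeg mOutDeg
  induction M using Multiset.induction with
  | empty => simp
  | cons e M ih =>
    have ih := ih (fun e he => hin e (Multiset.mem_cons_of_mem he))
      (fun e he => hout e (Multiset.mem_cons_of_mem he))
    have hin := hin e (Multiset.mem_cons_self _ _)
    have hout := hout e (Multiset.mem_cons_self _ _)
    obtain ⟨a, b⟩ := e
    simp only [Multiset.countP_cons, Finset.mem_insert, Prod.mk.injEq] at hin hout ih ⊢
    grind

theorem cutOut_insert_add_le_of_covers (htX : t ∉ X) (hyX : y ∈ X)
    (hin : ∀ e ∈ M, e.2 = t → e.1 ∈ X) (hy : (t, y) ∈ M) :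
    cutOut M (insert t X) + mInDeg M t + 1 ≤ cutOut M X + mOutDeg M t := by
  refine (Nat.add_le_add_left (one_le_countP_eq hy) _).trans ?_
  clear hy
  unfold cutOut mInDeg mOutDeg
  induction M using Multiset.induction with
  | empty => simp
  | cons e M ih =>
    have ih := ih (fun e he => hin e (Multiset.mem_cons_of_mem he))
    have hin := hin e (Multiset.mem_cons_self _ _)
    obtain ⟨a, b⟩ := e
    simp only [Multiset.countP_cons, Finset.mem_insert, Prod.mk.injEq] at hin ih ⊢
    grind

theorem cutIn_insert_add_le_of_covers (htX : t ∉ X) (hyX : y ∈ X)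
    (hin : ∀ e ∈ M, e.2 = t → e.1 ∈ X) (hy : (t, y) ∈ M) :
    cutIn M (insert t X) + 1 ≤ cutIn M X := by
  refine (Nat.add_le_add_left (one_le_countP_eq hy) _).trans ?_
  clear hy
  unfold cutIn
  induction M using Multiset.induction with
  | empty => simp
  | cons e M ih =>
    have ih := ih (fun e he => hin e (Multiset.mem_cons_of_mem he))
    have hin := hin e (Multiset.mem_cons_self _ _)
    obtain ⟨a, b⟩ := e
    simp only [Multiset.countP_cons, Finset.mem_insert, Prod.mk.injEq] at hin ih ⊢
    grind

theorem cutIn_sdiff_add_cutOut_sdiff_le (htX : t ∉ X) (htY : t ∉ Y) (hyX : y ∈ X) (hyY : y ∈ Y)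
    (hy : (t, y) ∈ M) :
    cutIn M (X \ Y) + cutOut M (Y \ X) + 1 ≤ cutIn M X + cutOut M Y := by
  refine (Nat.add_le_add_left (one_le_countP_eq hy) _).trans ?_
  clear hy
  unfold cutIn cutOut
  induction M using Multiset.induction with
  | empty => simp
  | cons e M ih =>
    obtain ⟨a, b⟩ := e
    simp only [Multiset.countP_cons, Finset.mem_sdiff, Prod.mk.injEq] at ih ⊢
    grind

end Inequalities

theorem HasRootedPairOn.of_split {S : Finset V} {M : Multiset (V × V)} {u v x t y : V}
    (h : HasRootedPairOn S ((x, y) ::ₘ M) u v) :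
    HasRootedPairOn S ((x, t) ::ₘ (t, y) ::ₘ M) u v := by
  obtain ⟨M₁, M₂, hle, h1, h2⟩ := h
  have hreach : ∀ {N : Multiset (V × V)} {a b : V}, MReach N a b →
      MReach ((x, t) ::ₘ (t, y) ::ₘ N.erase (x, y)) a b := by
    intro N a b hab
    refine hab.closed _ .refl fun c d hc hcd => ?_
    by_cases h : (c, d) = (x, y)
    · cases h
      exact (hc.step (z := t) (by simp)).step (by simp)
    · exact hc.step (by simp [(Multiset.mem_erase_of_ne h).2 hcd])
  by_cases hm1 : (x, y) ∈ M₁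
  · refine ⟨(x, t) ::ₘ (t, y) ::ₘ M₁.erase (x, y), M₂, ?_, fun z hz => hreach (h1 z hz), h2⟩
    rw [← Multiset.cons_erase hm1, Multiset.cons_add, Multiset.cons_le_cons_iff] at hle
    simpa [Multiset.cons_add] using hle
  by_cases hm2 : (x, y) ∈ M₂
  · refine ⟨M₁, (x, t) ::ₘ (t, y) ::ₘ M₂.erase (x, y), ?_, h1, fun z hz => hreach (h2 z hz)⟩
    rw [← Multiset.cons_erase hm2, Multiset.add_cons, Multiset.cons_le_cons_iff] at hle
    simpa [Multiset.add_cons] using hle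
  · refine ⟨M₁, M₂, ?_, h1, h2⟩
    have : M₁ + M₂ ≤ M := (Multiset.le_cons_of_notMem (by simp [hm1, hm2])).1 hle
    exact this.trans ((Multiset.le_cons_self _ _).trans (Multiset.le_cons_self _ _))

end SteinerConnectivity

section Splitting

variable {V : Type*} [DecidableEq V] [Fintype V] {S : Finset V} {M : Multiset (V × V)} {t : V}

/-- Every nonempty union-closed family of finite sets has a largest member. -/
theorem exists_largest_of_union_closed (p : Finset V → Prop) (hne : ∃ X, p X)
    (hunion : ∀ X Y, p X → p Y → p (X ∪ Y)) : ∃ Q, p Q ∧ ∀ X, p X → X ⊆ Q := by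
  classical
  obtain ⟨X₀, hX₀⟩ := hne
  obtain ⟨Q, hQ, hmax⟩ := Finset.exists_max_image (Finset.univ.filter p) Finset.card
    ⟨X₀, by simpa using hX₀⟩
  simp only [Finset.mem_filter, Finset.mem_univ, true_and] at hQ hmax
  refine ⟨Q, hQ, fun X hX => ?_⟩
  have := Finset.eq_of_subset_of_card_le Finset.subset_union_right (hmax _ (hunion X Q hX hQ))
  rw [this]
  exact Finset.subset_union_left

theorem cutOut_cons_erase_erase {x y : V} (hxt : (x, t) ∈ M) (hty : (t, y) ∈ M) (hne : x ≠ t)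
    (X : Finset V) :
    cutOut M X + (if x ∈ X ∧ y ∉ X then 1 else 0) =
      cutOut ((x, y) ::ₘ (M.erase (x, t)).erase (t, y)) X +
        (if x ∈ X ∧ t ∉ X then 1 else 0) + (if t ∈ X ∧ y ∉ X then 1 else 0) := by
  have hty' : (t, y) ∈ M.erase (x, t) := by
    refine (Multiset.mem_erase_of_ne ?_).2 hty
    rintro ⟨⟩
    exact hne rfl
  conv_lhs => rw [← Multiset.cons_erase hxt, ← Multiset.cons_erase hty']
  unfold cutOut
  simp only [Multiset.countP_cons]
  omega

/-- Splitting off a pair of arcs at a vertex outside `S` of equal in- and out-degree. -/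
theorem ConnOn.exists_split (hconn : ConnOn S M) (htS : t ∉ S)
    (hin : ∀ e ∈ M, e.2 = t → e.1 ∈ S) (hout : ∀ e ∈ M, e.1 = t → e.2 ∈ S)
    (hdeg : mInDeg M t = mOutDeg M t) {y : V} (hy : (t, y) ∈ M) :
    ∃ x, (x, t) ∈ M ∧ ConnOn S ((x, y) ::ₘ (M.erase (x, t)).erase (t, y)) := by
  by_contra! hcon
  have hyS : y ∈ S := hout _ hy rfl
  let po : Finset V → Prop := fun X => t ∉ X ∧ y ∈ X ∧ (∃ s ∈ S, s ∉ X) ∧ cutOut M X ≤ 2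
  let pi : Finset V → Prop := fun X => t ∉ X ∧ y ∈ X ∧ (∃ s ∈ S, s ∉ X) ∧ cutIn M X ≤ 2
  have hcases : ∀ x, (x, t) ∈ M → (∃ X, x ∈ X ∧ po X) ∨ ∃ X, x ∈ X ∧ pi X := by
    intro x hx
    have hxt : x ≠ t := by
      rintro rfl
      exact htS (hin _ hx rfl)
    have := hcon x hx
    simp only [ConnOn, not_forall] at this
    obtain ⟨X, hX, hX', hcut⟩ := this
    have h2 := hconn X hX hX'
    have heq := cutOut_cons_erase_erase hx hy hxt X
    by_cases h1 : x ∈ X ∧ y ∈ X ∧ t ∉ X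
    · refine Or.inl ⟨X, h1.1, h1.2.2, h1.2.1, hX', ?_⟩
      simp [h1] at heq
      omega
    by_cases h3 : x ∉ X ∧ y ∉ X ∧ t ∈ X
    · refine Or.inr ⟨Xᶜ, by simp [h3], by simp [h3], by simp [h3], by simpa using hX, ?_⟩
      rw [cutIn_eq_cutOut_compl, compl_compl]
      simp [h3] at heq
      omega
    exfalso
    by_cases hx' : x ∈ X <;> by_cases hy' : y ∈ X <;> by_cases ht' : t ∈ X <;>
      simp [hx', hy', ht'] at heq h1 h3 <;> omega
  have hins : ∀ X : Finset V, (∃ s ∈ S, s ∉ X) → ∃ s ∈ S, s ∉ insert t X := by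
    rintro X ⟨s, hs, hsX⟩
    refine ⟨s, hs, ?_⟩
    rw [Finset.mem_insert, not_or]
    exact ⟨fun h => htS (h ▸ hs), hsX⟩
  have hpo : ∀ X Y, po X → po Y → po (X ∪ Y) := by
    rintro X Y ⟨htX, hyX, hX, hcX⟩ ⟨htY, hyY, hY, hcY⟩
    by_cases hS : ∃ s ∈ S, s ∉ X ∪ Y
    · refine ⟨by simp [htX, htY], by simp [hyX], hS, ?_⟩
      have h1 := cutOut_union_add_inter_le M X Y
      have h2 := hconn (X ∩ Y) ⟨y, hyS, by simp [hyX, hyY]⟩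
        (by obtain ⟨s, hs, h⟩ := hX; exact ⟨s, hs, by simp [h]⟩)
      omega
    · push Not at hS
      have h1 := cutOut_insert_add_le htX htY hyX hyY
        (fun e he het => Finset.mem_union.1 (hS _ (hin e he het)))
        (fun e he het => Finset.mem_union.1 (hS _ (hout e he het))) hy
      have h2 := hconn (insert t X) ⟨y, hyS, by simp [hyX]⟩ (hins X hX)
      have h3 := hconn (insert t Y) ⟨y, hyS, by simp [hyY]⟩ (hins Y hY)
      omega
  have hpi : ∀ X Y, pi X → pi Y → pi (X ∪ Y) := by
    rintro X Y ⟨htX, hyX, hX, hcX⟩ ⟨htY, hyY, hY, hcY⟩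
    by_cases hS : ∃ s ∈ S, s ∉ X ∪ Y
    · refine ⟨by simp [htX, htY], by simp [hyX], hS, ?_⟩
      have h1 := cutIn_union_add_inter_le M X Y
      have h2 := hconn.two_le_cutIn (X ∩ Y) ⟨y, hyS, by simp [hyX, hyY]⟩
        (by obtain ⟨s, hs, h⟩ := hX; exact ⟨s, hs, by simp [h]⟩)
      omega
    · push Not at hS
      have h1 := cutIn_insert_add_le htX htY hyX hyY
        (fun e he het => Finset.mem_union.1 (hS _ (hin e he het)))
        (fun e he het => Finset.mem_union.1 (hS _ (hout e he het))) hy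
      have h2 := hconn.two_le_cutIn (insert t X) ⟨y, hyS, by simp [hyX]⟩ (hins X hX)
      have h3 := hconn.two_le_cutIn (insert t Y) ⟨y, hyS, by simp [hyY]⟩ (hins Y hY)
      omega
  have hocov : ∀ Q, po Q → ∃ x, (x, t) ∈ M ∧ x ∉ Q := by
    rintro Q ⟨htQ, hyQ, hQ, hcQ⟩
    by_contra! hall
    have h1 := cutOut_insert_add_le_of_covers htQ hyQ (fun e he het => hall e.1 (by
      rw [← het]
      exact he)) hy
    have h2 := hconn (insert t Q) ⟨y, hyS, by simp [hyQ]⟩ (hins Q hQ)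
    omega
  have hicov : ∀ P, pi P → ∃ x, (x, t) ∈ M ∧ x ∉ P := by
    rintro Q ⟨htQ, hyQ, hQ, hcQ⟩
    by_contra! hall
    have h1 := cutIn_insert_add_le_of_covers htQ hyQ (fun e he het => hall e.1 (by
      rw [← het]
      exact he)) hy
    have h2 := hconn.two_le_cutIn (insert t Q) ⟨y, hyS, by simp [hyQ]⟩ (hins Q hQ)
    omega
  by_cases ho : ∃ X, po X
  · obtain ⟨Q, hQ, hQmax⟩ := exists_largest_of_union_closed po ho hpo
    obtain ⟨x, hx, hxQ⟩ := hocov Q hQ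
    have hi : ∃ X, pi X := by
      rcases hcases x hx with ⟨X, hxX, hX⟩ | ⟨X, hxX, hX⟩
      · exact absurd (hQmax X hX hxX) hxQ
      · exact ⟨X, hX⟩
    obtain ⟨P, hP, hPmax⟩ := exists_largest_of_union_closed pi hi hpi
    obtain ⟨x', hx', hxP'⟩ := hicov P hP
    have hxP : x ∈ P := by
      rcases hcases x hx with ⟨X, hxX, hX⟩ | ⟨X, hxX, hX⟩
      · exact absurd (hQmax X hX hxX) hxQ
      · exact hPmax X hX hxX
    have hxQ' : x' ∈ Q := by
      rcases hcases x' hx' with ⟨X, hxX, hX⟩ | ⟨X, hxX, hX⟩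
      · exact hQmax X hX hxX
      · exact absurd (hPmax X hX hxX) hxP'
    have h1 := cutIn_sdiff_add_cutOut_sdiff_le hP.1 hQ.1 hP.2.1 hQ.2.1 hy
    have h2 := hconn.two_le_cutIn (P \ Q) ⟨x, hin _ hx rfl, by simp [hxP, hxQ]⟩
      ⟨y, hyS, by simp [hQ.2.1]⟩
    have h3 := hconn (Q \ P) ⟨x', hin _ hx' rfl, by simp [hxP', hxQ']⟩
      ⟨y, hyS, by simp [hP.2.1]⟩
    have h4 := hP.2.2.2
    have h5 := hQ.2.2.2
    omega
  · have hi : ∃ X, pi X := by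
      have : 0 < mInDeg M t := by
        rw [hdeg]
        exact Multiset.countP_pos.2 ⟨_, hy, rfl⟩
      obtain ⟨⟨x, t'⟩, hx, ht'⟩ := Multiset.countP_pos.1 this
      obtain rfl : t' = t := ht'
      rcases hcases x hx with ⟨X, hxX, hX⟩ | ⟨X, hxX, hX⟩
      · exact absurd ⟨X, hX⟩ ho
      · exact ⟨X, hX⟩
    obtain ⟨P, hP, hPmax⟩ := exists_largest_of_union_closed pi hi hpi
    obtain ⟨x', hx', hxP'⟩ := hicov P hP
    rcases hcases x' hx' with ⟨X, hxX, hX⟩ | ⟨X, hxX, hX⟩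
    · exact ho ⟨X, hX⟩
    · exact hxP' (hPmax X hX hxX)

end Splitting

section Elimination

variable {V : Type*} [DecidableEq V] [Fintype V] {S : Finset V} {M : Multiset (V × V)} {t : V}

theorem card_le_cutOut {W : Finset (V × V)} {X : Finset V} (hM : ∀ e ∈ W, e ∈ M)
    (hX : ∀ e ∈ W, e.1 ∈ X ∧ e.2 ∉ X) : W.card ≤ cutOut M X := by
  rw [cutOut, Multiset.countP_eq_card_filter]
  refine Multiset.card_le_card ((Multiset.le_iff_subset W.nodup).2 fun e he => ?_)
  exact Multiset.mem_filter.2 ⟨hM e he, hX e he⟩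

theorem card_inNeighbors_le_cutOut {I X : Finset V} (hM : ∀ x ∈ I, (x, t) ∈ M) (hX : I ⊆ X)
    (ht : t ∉ X) : I.card ≤ cutOut M X := by
  rw [← Finset.card_image_of_injective I (f := fun x => (x, t)) fun a b h => (Prod.ext_iff.1 h).1]
  refine card_le_cutOut ?_ ?_
  · intro e he
    obtain ⟨x, hx, rfl⟩ := Finset.mem_image.1 he
    exact hM x hx
  · intro e he
    obtain ⟨x, hx, rfl⟩ := Finset.mem_image.1 he
    exact ⟨hX hx, ht⟩

/-- An arc into a vertex with four in-neighbours can be deleted. -/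
theorem ConnOn.exists_erase (hconn : ConnOn S M) (htS : t ∉ S) (hin : ∀ x, (x, t) ∈ M → x ∈ S)
    (hsc : ∀ x ∈ S, ∀ y ∈ S, x ≠ y → (x, y) ∈ M ∨ (y, x) ∈ M)
    (h4 : 4 ≤ (Finset.univ.filter fun x => (x, t) ∈ M).card) :
    ∃ x, (x, t) ∈ M ∧ ConnOn S (M.erase (x, t)) := by
  by_contra! hcon
  set I : Finset V := Finset.univ.filter fun x => (x, t) ∈ M with hI
  have hIM : ∀ x, x ∈ I ↔ (x, t) ∈ M := fun x => by simp [hI]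
  have hIS : ∀ x ∈ I, x ∈ S := fun x hx => hin x ((hIM x).1 hx)
  let p : Finset V → Prop := fun X => t ∉ X ∧ (∃ s ∈ S, s ∉ X) ∧ cutOut M X ≤ 2
  have hex : ∀ x ∈ I, ∃ X, x ∈ X ∧ p X := by
    intro x hx
    have := hcon x ((hIM x).1 hx)
    simp only [ConnOn, not_forall] at this
    obtain ⟨X, hX, hX', hcut⟩ := this
    have h2 := hconn X hX hX'
    have heq : cutOut M X = cutOut (M.erase (x, t)) X + if x ∈ X ∧ t ∉ X then 1 else 0 := by
      conv_lhs => rw [← Multiset.cons_erase ((hIM x).1 hx)]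
      unfold cutOut
      rw [Multiset.countP_cons]
    split_ifs at heq with h
    · exact ⟨X, h.1, h.2, hX', by omega⟩
    · omega
  have hunion : ∀ X Y, p X → p Y → (∃ s ∈ S, s ∈ X ∧ s ∈ Y) → p (X ∪ Y) := by
    rintro X Y ⟨htX, hX, hcX⟩ ⟨htY, hY, hcY⟩ ⟨s, hs, hsX, hsY⟩
    have h1 := cutOut_union_add_inter_le M X Y
    have h2 := hconn (X ∩ Y) ⟨s, hs, by simp [hsX, hsY]⟩
      (by obtain ⟨s, hs, h⟩ := hX; exact ⟨s, hs, by simp [h]⟩)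
    have ht : t ∉ X ∪ Y := by simp [htX, htY]
    refine ⟨ht, ?_, by omega⟩
    by_contra! hS
    have := card_inNeighbors_le_cutOut (fun x hx => (hIM x).1 hx)
      (fun x hx => hS x (hIS x hx)) ht
    omega
  have htri : ∀ {X : Finset V} {e₁ e₂ e₃ : V × V}, cutOut M X ≤ 2 → e₁ ∈ M → e₂ ∈ M → e₃ ∈ M →
      e₁ ≠ e₂ → e₁ ≠ e₃ → e₂ ≠ e₃ → e₁.1 ∈ X → e₁.2 ∉ X → e₂.1 ∈ X → e₂.2 ∉ X →
      e₃.1 ∈ X → e₃.2 ∉ X → False := by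
    intro X e₁ e₂ e₃ hX h1 h2 h3 h12 h13 h23 a1 b1 a2 b2 a3 b3
    have := card_le_cutOut (M := M) (W := {e₁, e₂, e₃}) (X := X)
      (by simp [h1, h2, h3]) (by simp [a1, b1, a2, b2, a3, b3])
    rw [Finset.card_eq_three.2 ⟨e₁, e₂, e₃, h12, h13, h23, rfl⟩] at this
    omega
  have hone : ∀ X, p X → ∀ x₁ ∈ I, ∀ x₂ ∈ I, x₁ ∈ X → x₂ ∈ X → x₁ = x₂ := by
    intro X hX x₁ hx₁ x₂ hx₂ hx₁X hx₂X
    by_contra hne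
    have hx₃ : ∃ x₃ ∈ I, x₃ ∉ X := by
      by_contra! hall
      have := card_inNeighbors_le_cutOut (fun x hx => (hIM x).1 hx) hall hX.1
      have := hX.2.2
      omega
    obtain ⟨x₃, hx₃, hx₃X⟩ := hx₃
    obtain ⟨Y, hx₃Y, hY⟩ := hex x₃ hx₃
    have h13 : x₁ ≠ x₃ := by
      rintro rfl
      exact hx₃X hx₁X
    have h23 : x₂ ≠ x₃ := by
      rintro rfl
      exact hx₃X hx₂X
    by_cases hXY : ∃ s ∈ S, s ∈ X ∧ s ∈ Y
    · have hU := hunion X Y hX hY hXY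
      exact htri (e₁ := (x₁, t)) (e₂ := (x₂, t)) (e₃ := (x₃, t)) hU.2.2 ((hIM _).1 hx₁)
        ((hIM _).1 hx₂) ((hIM _).1 hx₃) (by simpa using hne) (by simpa using h13)
        (by simpa using h23) (by simp [hx₁X]) hU.1 (by simp [hx₂X]) hU.1 (by simp [hx₃Y]) hU.1
    · push Not at hXY
      have hback : ∀ x ∈ I, x ∈ X → x ≠ x₃ → (x₃, x) ∈ M := by
        intro x hx hxX hxx₃
        refine (hsc x (hIS x hx) x₃ (hIS x₃ hx₃) hxx₃).resolve_left fun hm => ?_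
        refine htri (e₁ := (x₁, t)) (e₂ := (x₂, t)) (e₃ := (x, x₃)) hX.2.2 ((hIM _).1 hx₁)
          ((hIM _).1 hx₂) hm (by simpa using hne) ?_ ?_ hx₁X hX.1 hx₂X hX.1 hxX hx₃X
        · rintro ⟨⟩
          exact htS (hIS _ hx₃)
        · rintro ⟨⟩
          exact htS (hIS _ hx₃)
      refine htri (e₁ := (x₃, x₁)) (e₂ := (x₃, x₂)) (e₃ := (x₃, t)) hY.2.2 (hback _ hx₁ hx₁X h13)
        (hback _ hx₂ hx₂X h23) ((hIM _).1 hx₃) (by simpa using hne) ?_ ?_ hx₃Y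
        (hXY x₁ (hIS _ hx₁) hx₁X) hx₃Y (hXY x₂ (hIS _ hx₂) hx₂X) hx₃Y hY.1
      · rintro ⟨⟩
        exact htS (hIS _ hx₁)
      · rintro ⟨⟩
        exact htS (hIS _ hx₂)
  have hout : ∀ i ∈ I, ∀ j ∈ I, ∀ k ∈ I, i ≠ j → i ≠ k → j ≠ k → (i, j) ∈ M → (i, k) ∉ M := by
    intro i hi j hj k hk hij hik hjk hmj hmk
    obtain ⟨X, hiX, hX⟩ := hex i hi
    refine htri (e₁ := (i, j)) (e₂ := (i, k)) (e₃ := (i, t)) hX.2.2 hmj hmk ((hIM _).1 hi)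
      (by simpa using hjk) ?_ ?_ hiX (fun hjX => hij (hone X hX i hi j hj hiX hjX)) hiX
      (fun hkX => hik (hone X hX i hi k hk hiX hkX)) hiX hX.1
    · rintro ⟨⟩
      exact htS (hIS _ hj)
    · rintro ⟨⟩
      exact htS (hIS _ hk)
  obtain ⟨J, hJI, hJ⟩ := Finset.exists_subset_card_eq h4
  obtain ⟨a, b, c, d, hab, hac, had, hbc, hbd, hcd, rfl⟩ := Finset.card_eq_four.1 hJ
  have ha : a ∈ I := hJI (by simp)
  have hb : b ∈ I := hJI (by simp)
  have hc : c ∈ I := hJI (by simp)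
  have hd : d ∈ I := hJI (by simp)
  have hadj : ∀ i ∈ I, ∀ j ∈ I, i ≠ j → (i, j) ∈ M ∨ (j, i) ∈ M :=
    fun i hi j hj hij => hsc i (hIS i hi) j (hIS j hj) hij
  have key : ∀ i ∈ I, ∀ j ∈ I, i ≠ a → j ≠ a → i ≠ j → (a, i) ∈ M ∨ (a, j) ∈ M := by
    intro i hi j hj hia hja hij
    by_contra! h
    have h1 := (hadj a ha i hi hia.symm).resolve_left h.1
    have h2 := (hadj a ha j hj hja.symm).resolve_left h.2
    rcases hadj i hi j hj hij with h3 | h3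
    · exact hout i hi a ha j hj hia hij hja.symm h1 h3
    · exact hout j hj a ha i hi hja hij.symm hia.symm h2 h3
  have e1 := key b hb c hc hab.symm hac.symm hbc
  have e2 := key b hb d hd hab.symm had.symm hbd
  have e3 := key c hc d hd hac.symm had.symm hcd
  have f1 := hout a ha b hb c hc hab hac hbc
  have f2 := hout a ha b hb d hd hab had hbd
  have f3 := hout a ha c hc d hd hac had hcd
  tauto

theorem cutOut_map_swap (M : Multiset (V × V)) (X : Finset V) :
    cutOut (M.map Prod.swap) X = cutIn M X := by
  rw [cutOut, cutIn, Multiset.countP_map, Multiset.countP_eq_card_filter]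
  congr 1
  refine Multiset.filter_congr fun e _ => ?_
  simp [and_comm]

theorem ConnOn.map_swap (hconn : ConnOn S M) : ConnOn S (M.map Prod.swap) := by
  intro X hX hX'
  rw [cutOut_map_swap]
  exact hconn.two_le_cutIn X hX hX'

theorem mem_map_swap {x y : V} : (x, y) ∈ M.map Prod.swap ↔ (y, x) ∈ M :=
  Multiset.mem_map_of_injective Prod.swap_injective (a := (y, x))

/-- An arc out of a vertex with four out-neighbours can be deleted. -/
theorem ConnOn.exists_erase_out (hconn : ConnOn S M) (htS : t ∉ S)
    (hout : ∀ x, (t, x) ∈ M → x ∈ S)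
    (hsc : ∀ x ∈ S, ∀ y ∈ S, x ≠ y → (x, y) ∈ M ∨ (y, x) ∈ M)
    (h4 : 4 ≤ (Finset.univ.filter fun x => (t, x) ∈ M).card) :
    ∃ x, (t, x) ∈ M ∧ ConnOn S (M.erase (t, x)) := by
  obtain ⟨x, hx, hx'⟩ := hconn.map_swap.exists_erase htS (t := t)
    (fun x hx => hout x (mem_map_swap.1 hx))
    (fun x hx y hy hxy => by
      rw [mem_map_swap, mem_map_swap]
      exact (hsc x hx y hy hxy).symm)
    (by simpa only [mem_map_swap] using h4)
  refine ⟨x, mem_map_swap.1 hx, ?_⟩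
  have := hx'.map_swap
  rw [Multiset.map_erase _ Prod.swap_injective, Multiset.map_map] at this
  simpa using this

theorem mInDeg_le_card (h1 : ∀ x, M.count (x, t) ≤ 1) :
    mInDeg M t ≤ (Finset.univ.filter fun x => (x, t) ∈ M).card := by
  have hnd : (M.filter fun e => e.2 = t).Nodup := by
    rw [Multiset.nodup_iff_count_le_one]
    rintro ⟨a, b⟩
    by_cases hb : b = t
    · subst hb
      exact (Multiset.count_le_of_le _ (Multiset.filter_le _ _)).trans (h1 a)
    · rw [Multiset.count_eq_zero.2 (by simp [hb])]
      exact Nat.zero_le _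
  rw [mInDeg, Multiset.countP_eq_card_filter, ← Multiset.toFinset_card_of_nodup hnd]
  refine Finset.card_le_card_of_injOn Prod.fst ?_ ?_
  · rintro ⟨a, b⟩ he
    simp only [Finset.mem_coe, Multiset.mem_toFinset, Multiset.mem_filter] at he
    obtain ⟨he, rfl⟩ := he
    simpa using he
  · rintro ⟨a, b⟩ he ⟨c, d⟩ he' h
    simp only [Finset.mem_coe, Multiset.mem_toFinset, Multiset.mem_filter] at he he'
    simp_all

theorem mOutDeg_map_swap (M : Multiset (V × V)) (t : V) :
    mInDeg (M.map Prod.swap) t = mOutDeg M t := by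
  rw [mInDeg, mOutDeg, Multiset.countP_map, Multiset.countP_eq_card_filter]
  rfl

theorem mOutDeg_le_card (h1 : ∀ x, M.count (t, x) ≤ 1) :
    mOutDeg M t ≤ (Finset.univ.filter fun x => (t, x) ∈ M).card := by
  have := mInDeg_le_card (M := M.map Prod.swap) (t := t) fun x => by
    rw [show (x, t) = Prod.swap (t, x) from rfl,
      Multiset.count_map_eq_count' _ _ Prod.swap_injective]
    exact h1 x
  rw [mOutDeg_map_swap] at this
  simpa only [mem_map_swap] using this

end Elimination

section Elimination

variable {V : Type*} [DecidableEq V] {S : Finset V} {M M' M'' : Multiset (V × V)} {t : V}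

/-- `M'` arises from `M` by operations at the vertex `t ∉ S` that keep the connectivity between
vertices of `S` and can be undone in a rooted pair. -/
structure Reduction (S : Finset V) (t : V) (M M' : Multiset (V × V)) : Prop where
  conn : ConnOn S M'
  mem : ∀ x ∈ S, ∀ y ∈ S, (x, y) ∈ M → (x, y) ∈ M'
  filter_eq : (M'.filter fun e => (e.1 ∉ S ∨ e.2 ∉ S) ∧ e.1 ≠ t ∧ e.2 ≠ t) =
    M.filter fun e => (e.1 ∉ S ∨ e.2 ∉ S) ∧ e.1 ≠ t ∧ e.2 ≠ t
  lift : ∀ u v, HasRootedPairOn S M' u v → HasRootedPairOn S M u v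

theorem Reduction.trans (h : Reduction S t M M') (h' : Reduction S t M' M'') :
    Reduction S t M M'' :=
  ⟨h'.conn, fun x hx y hy hxy => h'.mem x hx y hy (h.mem x hx y hy hxy),
    h'.filter_eq.trans h.filter_eq, fun u v huv => h.lift u v (h'.lift u v huv)⟩

theorem Reduction.erase {e : V × V} (hconn : ConnOn S (M.erase e)) (htS : t ∉ S)
    (he : e.1 = t ∨ e.2 = t) : Reduction S t M (M.erase e) := by
  refine ⟨hconn, fun x hx y hy hxy => (Multiset.mem_erase_of_ne ?_).2 hxy, ?_,
    fun u v h => h.mono (Multiset.erase_le _ _)⟩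
  · rintro rfl
    rcases he with rfl | rfl
    exacts [htS hx, htS hy]
  · by_cases hM : e ∈ M
    · conv_rhs => rw [← Multiset.cons_erase hM]
      rw [Multiset.filter_cons_of_neg]
      tauto
    · rw [Multiset.erase_of_notMem hM]

theorem Reduction.split {x y : V} (hxt : (x, t) ∈ M) (hty : (t, y) ∈ M) (htS : t ∉ S) (hx : x ∈ S)
    (hy : y ∈ S) (hconn : ConnOn S ((x, y) ::ₘ (M.erase (x, t)).erase (t, y))) :
    Reduction S t M ((x, y) ::ₘ (M.erase (x, t)).erase (t, y)) := by
  have hty' : (t, y) ∈ M.erase (x, t) := by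
    refine (Multiset.mem_erase_of_ne ?_).2 hty
    rintro ⟨⟩
    exact htS hx
  have hM : M = (x, t) ::ₘ (t, y) ::ₘ (M.erase (x, t)).erase (t, y) := by
    rw [Multiset.cons_erase hty', Multiset.cons_erase hxt]
  generalize hN : (M.erase (x, t)).erase (t, y) = N at *
  subst hM
  refine ⟨hconn, fun a ha b hb hab => ?_, ?_, fun u v h => h.of_split⟩
  · simp only [Multiset.mem_cons, Prod.mk.injEq] at hab ⊢
    rcases hab with ⟨_, rfl⟩ | ⟨rfl, _⟩ | hab
    exacts [absurd hb htS, absurd ha htS, .inr hab]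
  · rw [Multiset.filter_cons_of_neg, Multiset.filter_cons_of_neg, Multiset.filter_cons_of_neg]
    all_goals simp [hx, hy]

variable [Fintype V]

/-- A vertex outside `S` of equal in- and out-degree can be eliminated. -/
theorem exists_reduction_of_balanced (htS : t ∉ S) (n : ℕ) (hconn : ConnOn S M)
    (hin : ∀ e ∈ M, e.2 = t → e.1 ∈ S) (hout : ∀ e ∈ M, e.1 = t → e.2 ∈ S)
    (hn : mInDeg M t = n) (hn' : mOutDeg M t = n) :
    ∃ M', Reduction S t M M' ∧ ∀ e ∈ M', e.1 ≠ t ∧ e.2 ≠ t := by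
  induction n generalizing M with
  | zero =>
    refine ⟨M, ⟨hconn, fun _ _ _ _ h => h, rfl, fun _ _ h => h⟩, fun e he => ⟨?_, ?_⟩⟩
    · exact Multiset.countP_eq_zero.1 hn' e he
    · exact Multiset.countP_eq_zero.1 hn e he
  | succ n ih =>
    obtain ⟨⟨a, y⟩, hy, ha⟩ : ∃ e ∈ M, e.1 = t :=
      Multiset.countP_pos.1 (by rw [mOutDeg] at hn'; omega)
    obtain rfl : a = t := ha
    obtain ⟨x, hx, hconn'⟩ := hconn.exists_split htS hin hout (hn.trans hn'.symm) hy
    have hxS : x ∈ S := hin _ hx rfl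
    have hyS : y ∈ S := hout _ hy rfl
    have hxa : x ≠ a := fun h => htS (h ▸ hxS)
    have hya : y ≠ a := fun h => htS (h ▸ hyS)
    have hred := Reduction.split hx hy htS hxS hyS hconn'
    have hy' : (a, y) ∈ M.erase (x, a) := by
      refine (Multiset.mem_erase_of_ne ?_).2 hy
      rintro ⟨⟩
      exact htS hxS
    have hM : M = (x, a) ::ₘ (a, y) ::ₘ (M.erase (x, a)).erase (a, y) := by
      rw [Multiset.cons_erase hy', Multiset.cons_erase hx]
    generalize hN : (M.erase (x, a)).erase (a, y) = N at *
    have hsub : ∀ e ∈ N, e ∈ M := fun e he => by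
      rw [hM]
      exact Multiset.mem_cons_of_mem (Multiset.mem_cons_of_mem he)
    obtain ⟨M', hM', ht⟩ := ih hconn' (by
        intro e he h
        rcases Multiset.mem_cons.1 he with rfl | he
        exacts [hxS, hin e (hsub e he) h]) (by
        intro e he h
        rcases Multiset.mem_cons.1 he with rfl | he
        exacts [hyS, hout e (hsub e he) h]) (by
        rw [hM] at hn
        simp only [mInDeg, Multiset.countP_cons, hya] at hn ⊢
        simpa using hn) (by
        rw [hM] at hn'
        simp only [mOutDeg, Multiset.countP_cons, hxa] at hn' ⊢
        simpa using hn')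
    exact ⟨M', hred.trans hM', ht⟩

/-- A vertex outside `S` of in- and out-degree at least three can be eliminated. -/
theorem exists_reduction (htS : t ∉ S) (n : ℕ) (hconn : ConnOn S M)
    (hsc : ∀ x ∈ S, ∀ y ∈ S, x ≠ y → (x, y) ∈ M ∨ (y, x) ∈ M)
    (hin : ∀ e ∈ M, e.2 = t → e.1 ∈ S) (hout : ∀ e ∈ M, e.1 = t → e.2 ∈ S)
    (hcin : ∀ x, M.count (x, t) ≤ 1) (hcout : ∀ x, M.count (t, x) ≤ 1)
    (h3 : 3 ≤ mInDeg M t) (h3' : 3 ≤ mOutDeg M t) (hn : mInDeg M t + mOutDeg M t = n) :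
    ∃ M', Reduction S t M M' ∧ ∀ e ∈ M', e.1 ≠ t ∧ e.2 ≠ t := by
  induction n generalizing M with
  | zero => omega
  | succ n ih =>
    have key : ∀ e ∈ M, (e.1 = t ∨ e.2 = t) → ConnOn S (M.erase e) →
        3 ≤ mInDeg (M.erase e) t → 3 ≤ mOutDeg (M.erase e) t →
        mInDeg (M.erase e) t + mOutDeg (M.erase e) t = n →
        ∃ M', Reduction S t M M' ∧ ∀ e ∈ M', e.1 ≠ t ∧ e.2 ≠ t := by
      intro e he het hc h1 h2 h3
      have hred := Reduction.erase hc htS het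
      have hle : M.erase e ≤ M := Multiset.erase_le e M
      obtain ⟨M', hM', ht⟩ := ih hc
        (fun x hx y hy hxy => (hsc x hx y hy hxy).imp (hred.mem x hx y hy) (hred.mem y hy x hx))
        (fun e he => hin e (Multiset.mem_of_le hle he))
        (fun e he => hout e (Multiset.mem_of_le hle he))
        (fun x => (Multiset.count_le_of_le _ hle).trans (hcin x))
        (fun x => (Multiset.count_le_of_le _ hle).trans (hcout x)) h1 h2 h3
      exact ⟨M', hred.trans hM', ht⟩
    rcases lt_trichotomy (mInDeg M t) (mOutDeg M t) with hlt | heq | hgt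
    · obtain ⟨x, hx, hc⟩ := hconn.exists_erase_out htS (fun x hx => hout _ hx rfl) hsc
        (le_trans (by omega) (mOutDeg_le_card hcout))
      have hxt : x ≠ t := fun h => htS (h ▸ hout _ hx rfl)
      have h1 : mInDeg M t = mInDeg (M.erase (t, x)) t := by
        conv_lhs => rw [← Multiset.cons_erase hx]
        simp [mInDeg, hxt]
      have h2 : mOutDeg M t = mOutDeg (M.erase (t, x)) t + 1 := by
        conv_lhs => rw [← Multiset.cons_erase hx]
        simp [mOutDeg]
      exact key _ hx (.inl rfl) hc (by omega) (by omega) (by omega)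
    · exact exists_reduction_of_balanced htS _ hconn hin hout rfl heq.symm
    · obtain ⟨x, hx, hc⟩ := hconn.exists_erase htS (fun x hx => hin _ hx rfl) hsc
        (le_trans (by omega) (mInDeg_le_card hcin))
      have hxt : x ≠ t := fun h => htS (h ▸ hin _ hx rfl)
      have h1 : mOutDeg M t = mOutDeg (M.erase (x, t)) t := by
        conv_lhs => rw [← Multiset.cons_erase hx]
        simp [mOutDeg, hxt]
      have h2 : mInDeg M t = mInDeg (M.erase (x, t)) t + 1 := by
        conv_lhs => rw [← Multiset.cons_erase hx]
        simp [mInDeg]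
      exact key _ hx (.inr rfl) hc (by omega) (by omega) (by omega)

/-- Two arc-disjoint rooted arc sets covering `S`, in a digraph whose other vertices form an
independent set and have large degrees. -/
theorem hasRootedPairOn_of_independent {T : Finset V} {u v : V} (hu : u ∈ S) (hv : v ∈ S)
    (hST : ∀ t ∈ T, t ∉ S) (hconn : ConnOn S M)
    (hsc : ∀ x ∈ S, ∀ y ∈ S, x ≠ y → (x, y) ∈ M ∨ (y, x) ∈ M)
    (hM : ∀ e ∈ M, (e.1 ∈ S ∧ e.2 ∈ S) ∨ (e.1 ∈ S ∧ e.2 ∈ T) ∨ (e.1 ∈ T ∧ e.2 ∈ S))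
    (hT : ∀ t ∈ T, 3 ≤ mInDeg M t ∧ 3 ≤ mOutDeg M t ∧ (∀ x, M.count (x, t) ≤ 1) ∧
      ∀ x, M.count (t, x) ≤ 1) : HasRootedPairOn S M u v := by
  induction T using Finset.induction_on generalizing M with
  | empty => exact hasRootedPairOn_of_semicomplete hu hv (by simpa using hM) hconn hsc
  | insert t T htT ih =>
    have htS := hST t (Finset.mem_insert_self _ _)
    obtain ⟨h1, h2, h3, h4⟩ := hT t (Finset.mem_insert_self _ _)
    have hin : ∀ e ∈ M, e.2 ∉ S → e.1 ∈ S := fun e he h => by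
      have := hM e he
      tauto
    have hout : ∀ e ∈ M, e.1 ∉ S → e.2 ∈ S := fun e he h => by
      have := hM e he
      tauto
    obtain ⟨M', hM', ht⟩ := exists_reduction htS _ hconn hsc (fun e he h => hin e he (h ▸ htS))
      (fun e he h => hout e he (h ▸ htS)) h3 h4 h1 h2 rfl
    have hfil := hM'.filter_eq
    refine hM'.lift u v (ih (fun s hs => hST s (Finset.mem_insert_of_mem hs)) hM'.conn
      (fun x hx y hy hxy => (hsc x hx y hy hxy).imp (hM'.mem x hx y hy) (hM'.mem y hy x hx))
      ?_ ?_)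
    · intro e he
      have hte := ht e he
      by_cases heS : e.1 ∈ S ∧ e.2 ∈ S
      · exact .inl heS
      have heM : e ∈ M := by
        have : e ∈ M'.filter fun e => (e.1 ∉ S ∨ e.2 ∉ S) ∧ e.1 ≠ t ∧ e.2 ≠ t :=
          Multiset.mem_filter.2 ⟨he, by tauto, hte⟩
        rw [hfil] at this
        exact (Multiset.mem_filter.1 this).1
      have := hM e heM
      simp only [Finset.mem_insert] at this
      tauto
    · intro s hs
      have hsS := hST s (Finset.mem_insert_of_mem hs)
      have hst : s ≠ t := fun h => htT (h ▸ hs)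
      obtain ⟨k1, k2, k3, k4⟩ := hT s (Finset.mem_insert_of_mem hs)
      have hcount : ∀ p : V × V → Prop, [DecidablePred p] →
          (∀ e, p e → (e.1 = s ∧ e.1 ∉ S) ∨ (e.2 = s ∧ e.2 ∉ S)) → M'.countP p = M.countP p := by
        intro p _ hp
        have : (M'.filter fun e => (e.1 ∉ S ∨ e.2 ∉ S) ∧ e.1 ≠ t ∧ e.2 ≠ t).countP p =
            (M.filter fun e => (e.1 ∉ S ∨ e.2 ∉ S) ∧ e.1 ≠ t ∧ e.2 ≠ t).countP p := by rw [hfil]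
        rw [Multiset.countP_filter, Multiset.countP_filter] at this
        rw [← Multiset.countP_congr rfl (s := M') (s' := M') (p := fun e => p e ∧
          (e.1 ∉ S ∨ e.2 ∉ S) ∧ e.1 ≠ t ∧ e.2 ≠ t), this]
        · refine Multiset.countP_congr rfl fun e he => ?_
          have := hin e he
          have := hout e he
          have := hp e
          grind
        · intro e he
          have := ht e he
          have := hp e
          grind
      refine ⟨?_, ?_, fun x => ?_, fun x => ?_⟩
      · rw [mInDeg, hcount _ fun e he => .inr ⟨he, he ▸ hsS⟩]
        exact k1
      · rw [mOutDeg, hcount _ fun e he => .inl ⟨he, he ▸ hsS⟩]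
        exact k2
      · have := hcount (fun e => (x, s) = e) (by rintro _ rfl; exact .inr ⟨rfl, hsS⟩)
        rw [Multiset.count, this]
        exact k3 x
      · have := hcount (fun e => (s, x) = e) (by rintro _ rfl; exact .inl ⟨rfl, hsS⟩)
        rw [Multiset.count, this]
        exact k4 x

end Elimination

section RelationPairs

open Relation

variable {V : Type*} {A B B' : V → V → Prop} {u v : V}

theorem Relation.ReflTransGen.of_step_from (huv : ReflTransGen B u v)
    {w : V} (hw : ReflTransGen B' w u)
    (h : ∀ a b, ReflTransGen B' w a → B a b → ReflTransGen B' w b) : ReflTransGen B' w v := by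
  induction huv with
  | refl => exact hw
  | tail _ hab ih => exact h _ _ ih hab

theorem Relation.ReflTransGen.of_step_to (huv : ReflTransGen B u v)
    (h : ∀ a b, B a b → ReflTransGen B' b v → ReflTransGen B' a v) : ReflTransGen B' u v := by
  induction huv using ReflTransGen.head_induction_on with
  | refl => exact .refl
  | head hab _ ih => exact h _ _ hab ih

/-- The set of vertices reachable from `u` is spanned by an out-tree. -/
theorem exists_out_tree (B : V → V → Prop) (u : V) :
    ∃ B' : V → V → Prop, (∀ x y, B' x y → B x y) ∧ (∀ x y z, B' x z → B' y z → x = y) ∧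
      (∀ x, ¬ B' x u) ∧ ∀ x, ReflTransGen B u x → ReflTransGen B' u x := by
  classical
  obtain ⟨d, hd⟩ : ∃ d : V → ℕ, ∀ x, ReflTransGen B u x → x ≠ u →
      ∃ y, B y x ∧ ReflTransGen B u y ∧ d y < d x := by
    let W : ℕ → V → Prop := Nat.rec (fun x => x = u) fun _ P x => ∃ y, P y ∧ B y x
    have hW : ∀ n x, W n x → ReflTransGen B u x := by
      intro n
      induction n with
      | zero =>
        intro x (hx : x = u)
        rw [hx]
      | succ n ih =>
        rintro x ⟨y, hy, hyx⟩
        exact (ih y hy).tail hyx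
    have hex : ∀ x, ReflTransGen B u x → ∃ n, W n x := by
      intro x hx
      induction hx with
      | refl => exact ⟨0, rfl⟩
      | tail _ hab ih =>
        obtain ⟨n, hn⟩ := ih
        exact ⟨n + 1, _, hn, hab⟩
    refine ⟨fun x => sInf {n | W n x}, fun x hx hxu => ?_⟩
    have hmem : W (sInf {n | W n x}) x := Nat.sInf_mem (s := {n | W n x}) (hex x hx)
    cases hn : sInf {n | W n x} with
    | zero =>
      rw [hn] at hmem
      exact absurd hmem hxu
    | succ n =>
      rw [hn] at hmem
      obtain ⟨y, hy, hyx⟩ := hmem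
      refine ⟨y, hyx, hW n y hy, ?_⟩
      change sInf {n | W n y} < sInf {n | W n x}
      rw [hn]
      exact Nat.lt_succ_of_le (Nat.sInf_le hy)
  choose! p hp using hd
  refine ⟨fun y x => x ≠ u ∧ ReflTransGen B u x ∧ y = p x, ?_, ?_, ?_, ?_⟩
  · rintro y x ⟨hxu, hx, rfl⟩
    exact (hp x hx hxu).1
  · rintro x y z ⟨_, _, rfl⟩ ⟨_, _, rfl⟩
    rfl
  · rintro x ⟨h, _⟩
    exact h rfl
  · intro x
    induction hn : d x using Nat.strong_induction_on generalizing x with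
    | _ n ih =>
      intro hx
      by_cases hxu : x = u
      · rw [hxu]
      · obtain ⟨_, h2, h3⟩ := hp x hx hxu
        exact (ih _ (hn ▸ h3) _ rfl h2).tail ⟨hxu, hx, rfl⟩

theorem reflTransGen_flip {x y : V} :
    ReflTransGen (fun a b => B b a) x y ↔ ReflTransGen B y x :=
  reflTransGen_swap

/-- The set of vertices reaching `v` is spanned by an in-tree. -/
theorem exists_in_tree (B : V → V → Prop) (v : V) :
    ∃ B' : V → V → Prop, (∀ x y, B' x y → B x y) ∧ (∀ x y z, B' x y → B' x z → y = z) ∧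
      (∀ x, ¬ B' v x) ∧ ∀ x, ReflTransGen B x v → ReflTransGen B' x v := by
  obtain ⟨B', h1, h2, h3, h4⟩ := exists_out_tree (fun a b => B b a) v
  refine ⟨fun a b => B' b a, fun x y h => h1 y x h, fun x y z h h' => h2 y z x h h', h3, ?_⟩
  intro x hx
  exact reflTransGen_flip.2 (h4 x (reflTransGen_flip.2 hx))

theorem not_cyclic_triangle_of_out_tree (h1 : ∀ x y z, B x z → B y z → x = y) (h2 : ∀ x, ¬ B x u)
    {a b c : V} (ha : ReflTransGen B u a) (hab : B a b) (hbc : B b c) (hca : B c a) : False := by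
  have key : ∀ x, ReflTransGen B u x → x ≠ a ∧ x ≠ b ∧ x ≠ c := by
    intro x hx
    induction hx with
    | refl =>
      refine ⟨?_, ?_, ?_⟩ <;> rintro rfl
      exacts [h2 _ hca, h2 _ hab, h2 _ hbc]
    | @tail y z _ hyz ih =>
      refine ⟨?_, ?_, ?_⟩ <;> rintro rfl
      exacts [ih.2.2 (h1 _ _ _ hyz hca), ih.1 (h1 _ _ _ hyz hab), ih.2.1 (h1 _ _ _ hyz hbc)]
  exact (key a ha).1 rfl

theorem not_cyclic_triangle_of_in_tree (h1 : ∀ x y z, B x y → B x z → y = z) (h2 : ∀ x, ¬ B v x)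
    {a b c : V} (ha : ReflTransGen B a v) (hab : B a b) (hbc : B b c) (hca : B c a) : False :=
  not_cyclic_triangle_of_out_tree (B := fun x y => B y x) (fun x y z h h' => h1 z x y h h') h2
    (reflTransGen_flip.2 ha) hca hbc hab

/-- Disjoint subrelations of `A`, one reaching all of `P` from `u`, one reaching `v` from all of
`Q`. -/
def CoverPair (A : V → V → Prop) (P Q : Set V) (u v : V) : Prop :=
  ∃ B₁ B₂ : V → V → Prop, (∀ x y, B₁ x y → A x y) ∧ (∀ x y, B₂ x y → A x y) ∧
    (∀ x y, B₁ x y → ¬ B₂ x y) ∧ (∀ x ∈ P, ReflTransGen B₁ u x) ∧ ∀ x ∈ Q, ReflTransGen B₂ x v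

variable {P Q : Set V}

theorem CoverPair.flip (h : CoverPair A P Q u v) : CoverPair (fun x y => A y x) Q P v u := by
  obtain ⟨B₁, B₂, h1, h2, h3, h4, h5⟩ := h
  exact ⟨fun x y => B₂ y x, fun x y => B₁ y x, fun x y => h2 y x, fun x y => h1 y x,
    fun x y h h' => h3 y x h' h, fun x hx => reflTransGen_flip.2 (h5 x hx),
    fun x hx => reflTransGen_flip.2 (h4 x hx)⟩

theorem CoverPair.exists_trees (h : CoverPair A P Q u v) :
    ∃ B₁ B₂ : V → V → Prop, (∀ x y, B₁ x y → A x y) ∧ (∀ x y, B₂ x y → A x y) ∧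
      (∀ x y, B₁ x y → ¬ B₂ x y) ∧ (∀ x ∈ P, ReflTransGen B₁ u x) ∧
      (∀ x ∈ Q, ReflTransGen B₂ x v) ∧ (∀ x y z, B₁ x z → B₁ y z → x = y) ∧ (∀ x, ¬ B₁ x u) ∧
      (∀ x y z, B₂ x y → B₂ x z → y = z) ∧ ∀ x, ¬ B₂ v x := by
  obtain ⟨B₁, B₂, h1, h2, h3, h4, h5⟩ := h
  obtain ⟨C₁, k1, k2, k3, k4⟩ := exists_out_tree B₁ u
  obtain ⟨C₂, l1, l2, l3, l4⟩ := exists_in_tree B₂ v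
  exact ⟨C₁, C₂, fun x y h => h1 x y (k1 x y h), fun x y h => h2 x y (l1 x y h),
    fun x y h h' => h3 x y (k1 x y h) (l1 x y h'), fun x hx => k4 x (h4 x hx),
    fun x hx => l4 x (h5 x hx), k2, k3, l2, l3⟩

/-- A vertex with three in-neighbours in `S` can be added to the out-tree. -/
theorem CoverPair.insert_left {S : Set V} (h : CoverPair A P Q u v) (hSP : S ⊆ P)
    (hsc : ∀ x ∈ S, ∀ y ∈ S, x ≠ y → A x y ∨ A y x) {t x₁ x₂ x₃ : V} (ht : t ∉ S)
    (h1 : x₁ ∈ S) (h2 : x₂ ∈ S) (h3 : x₃ ∈ S) (h12 : x₁ ≠ x₂) (h13 : x₁ ≠ x₃) (h23 : x₂ ≠ x₃)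
    (ha1 : A x₁ t) (ha2 : A x₂ t) (ha3 : A x₃ t) : CoverPair A (insert t P) Q u v := by
  obtain ⟨B₁, B₂, k1, k2, k3, k4, k5, k6, k7, k8, k9⟩ := h.exists_trees
  by_cases hfree : ∃ x ∈ S, A x t ∧ ¬ B₂ x t
  · obtain ⟨x, hx, hxt, hx2⟩ := hfree
    have hle : ∀ {a b}, ReflTransGen B₁ a b →
        ReflTransGen (fun a b => B₁ a b ∨ (a = x ∧ b = t)) a b :=
      fun h => ReflTransGen.mono (fun a b => Or.inl) _ _ h
    refine ⟨fun a b => B₁ a b ∨ (a = x ∧ b = t), B₂, by grind, k2, by grind, ?_, k5⟩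
    rintro y (rfl | hy)
    · exact (hle (k4 x (hSP hx))).tail (.inr ⟨rfl, rfl⟩)
    · exact hle (k4 y hy)
  have hall : ∀ x ∈ S, A x t → B₂ x t := by
    intro x hx hxt
    by_contra h
    exact hfree ⟨x, hx, hxt, h⟩
  obtain ⟨x, y, hx, hy, hxy, hxt, hyt, hA, hB⟩ : ∃ x y, x ∈ S ∧ y ∈ S ∧ x ≠ y ∧ A x t ∧ A y t ∧
      A x y ∧ ¬ B₁ x y := by
    by_contra! hcon
    have key : ∀ x ∈ S, ∀ y ∈ S, x ≠ y → A x t → A y t → B₁ x y ∨ B₁ y x := by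
      intro x hx y hy hxy hxt hyt
      exact (hsc x hx y hy hxy).imp (hcon x y hx hy hxy hxt hyt)
        (hcon y x hy hx hxy.symm hyt hxt)
    have c1 := not_cyclic_triangle_of_out_tree k6 k7 (k4 x₁ (hSP h1)) (b := x₂) (c := x₃)
    have c2 := not_cyclic_triangle_of_out_tree k6 k7 (k4 x₁ (hSP h1)) (b := x₃) (c := x₂)
    have d1 := key x₁ h1 x₂ h2 h12 ha1 ha2
    have d2 := key x₁ h1 x₃ h3 h13 ha1 ha3
    have d3 := key x₂ h2 x₃ h3 h23 ha2 ha3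
    rcases d1 with d1 | d1 <;> rcases d2 with d2 | d2 <;> rcases d3 with d3 | d3
    exacts [h12 (k6 _ _ _ d2 d3), h13 (k6 _ _ _ d1 d3), c1 d1 d3 d2, h13 (k6 _ _ _ d1 d3),
      h12 (k6 _ _ _ d2 d3), c2 d2 d3 d1, h23 (k6 _ _ _ d1 d2), h23 (k6 _ _ _ d1 d2)]
  have hyt' : y ≠ t := fun h => ht (h ▸ hy)
  refine ⟨fun a b => B₁ a b ∨ (a = x ∧ b = t),
    fun a b => (B₂ a b ∧ ¬ (a = x ∧ b = t)) ∨ (a = x ∧ b = y), by grind, by grind, by grind,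
    ?_, ?_⟩
  · have hle : ∀ {a b}, ReflTransGen B₁ a b →
        ReflTransGen (fun a b => B₁ a b ∨ (a = x ∧ b = t)) a b :=
      fun h => ReflTransGen.mono (fun a b => Or.inl) _ _ h
    rintro z (rfl | hz)
    · exact (hle (k4 x (hSP hx))).tail (.inr ⟨rfl, rfl⟩)
    · exact hle (k4 z hz)
  · intro z hz
    refine (k5 z hz).of_step_to fun a b hab hb => ?_
    by_cases h : a = x ∧ b = t
    · obtain ⟨rfl, rfl⟩ := h
      refine .head (.inr ⟨rfl, rfl⟩) (.head (.inl ⟨hall y hy hyt, ?_⟩) hb)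
      exact fun h => hxy h.1.symm
    · exact .head (.inl ⟨hab, h⟩) hb

theorem CoverPair.mono_left {P' : Set V} (h : CoverPair A P Q u v) (hP : P' ⊆ P) :
    CoverPair A P' Q u v := by
  obtain ⟨B₁, B₂, h1, h2, h3, h4, h5⟩ := h
  exact ⟨B₁, B₂, h1, h2, h3, fun x hx => h4 x (hP hx), h5⟩

/-- If every vertex outside `S` has three in-neighbours in `S`, the out-tree extends to a spanning
one. -/
theorem CoverPair.univ_left [Finite V] {S : Set V} (h : CoverPair A S Q u v)
    (hsc : ∀ x ∈ S, ∀ y ∈ S, x ≠ y → A x y ∨ A y x)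
    (h3 : ∀ t ∉ S, ∃ x ∈ S, ∃ y ∈ S, ∃ z ∈ S, x ≠ y ∧ x ≠ z ∧ y ≠ z ∧ A x t ∧ A y t ∧ A z t) :
    CoverPair A Set.univ Q u v := by
  classical
  have := Fintype.ofFinite V
  have key : ∀ T : Finset V, CoverPair A (S ∪ ↑T) Q u v := by
    intro T
    induction T using Finset.induction_on with
    | empty => simpa using h
    | insert t T _ ih =>
      by_cases ht : t ∈ S
      · exact ih.mono_left (by intro x; simp; grind)
      · obtain ⟨x, hx, y, hy, z, hz, hxy, hxz, hyz, h1, h2, h3⟩ := h3 t ht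
        have := ih.insert_left Set.subset_union_left hsc ht hx hy hz hxy hxz hyz h1 h2 h3
        exact this.mono_left (by intro x; simp)
  exact (key Finset.univ).mono_left (by simp)

theorem CoverPair.univ_right [Finite V] {S : Set V} (h : CoverPair A P S u v)
    (hsc : ∀ x ∈ S, ∀ y ∈ S, x ≠ y → A x y ∨ A y x)
    (h3 : ∀ t ∉ S, ∃ x ∈ S, ∃ y ∈ S, ∃ z ∈ S, x ≠ y ∧ x ≠ z ∧ y ≠ z ∧ A t x ∧ A t y ∧ A t z) :
    CoverPair A P Set.univ u v :=
  (h.flip.univ_left (fun x hx y hy hxy => (hsc x hx y hy hxy).symm) h3).flip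

end RelationPairs

section RootChange

open Relation

variable {V : Type*} {A : V → V → Prop} {u v a b c : V}

/-- Moving the root of the out-tree to a vertex with three transitively joined out-neighbours. -/
theorem CoverPair.root_of_transitive (h : CoverPair A Set.univ Set.univ a v)
    (hab : a ≠ b) (hac : a ≠ c) (hbc : b ≠ c) (hua : A u a) (hub : A u b) (huc : A u c)
    (hne : u ≠ a ∧ u ≠ b ∧ u ≠ c) (hba : A b a) (hca : A c a) (hbc' : A b c) :
    CoverPair A Set.univ Set.univ u v := by
  obtain ⟨B₁, B₂, k1, k2, k3, k4, k5, k6, k7, k8, k9⟩ := h.exists_trees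
  have main : ∀ C₁ C₂ : V → V → Prop, (∀ x y, C₁ x y → A x y) → (∀ x y, C₂ x y → A x y) →
      (∀ x y, C₁ x y → ¬ C₂ x y) → ReflTransGen C₁ u a →
      (∀ x y, ReflTransGen C₁ u x → B₁ x y → ReflTransGen C₁ u y) →
      (∀ x y, B₂ x y → ReflTransGen C₂ y v → ReflTransGen C₂ x v) →
      CoverPair A Set.univ Set.univ u v := fun C₁ C₂ h1 h2 h3 h4 h5 h6 =>
    ⟨C₁, C₂, h1, h2, h3, fun x _ => (k4 x trivial).of_step_from h4 h5,
      fun x _ => (k5 x trivial).of_step_to h6⟩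
  by_cases hu : B₂ u a
  swap
  · refine main (fun x y => B₁ x y ∨ (x = u ∧ y = a)) B₂ (by grind) k2 (by grind)
      (.single (.inr ⟨rfl, rfl⟩)) (fun x y hx hxy => hx.tail (.inl hxy))
      fun x y hxy hy => .head hxy hy
  have detour : ∀ w, B₂ w a → w ≠ u → ∀ x y, B₂ x y →
      ReflTransGen (fun x y => (B₂ x y ∧ ¬ (x = u ∧ y = a)) ∨ (x = u ∧ y = w)) y v →
      ReflTransGen (fun x y => (B₂ x y ∧ ¬ (x = u ∧ y = a)) ∨ (x = u ∧ y = w)) x v := by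
    intro w hw hwu x y hxy hy
    by_cases h : x = u ∧ y = a
    · obtain ⟨rfl, rfl⟩ := h
      exact .head (.inr ⟨rfl, rfl⟩) (.head (.inl ⟨hw, fun h => hwu h.1⟩) hy)
    · exact .head (.inl ⟨hxy, h⟩) hy
  by_cases hb2 : B₂ b a
  swap
  · refine main (fun x y => B₁ x y ∨ (x = u ∧ y = b) ∨ (x = b ∧ y = a)) B₂ (by grind) k2
      (by grind) (.head (.inr (.inl ⟨rfl, rfl⟩)) (.single (.inr (.inr ⟨rfl, rfl⟩))))
      (fun x y hx hxy => hx.tail (.inl hxy)) fun x y hxy hy => .head hxy hy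
  by_cases hc2 : B₂ c a
  swap
  · refine main (fun x y => B₁ x y ∨ (x = u ∧ y = c) ∨ (x = c ∧ y = a)) B₂ (by grind) k2
      (by grind) (.head (.inr (.inl ⟨rfl, rfl⟩)) (.single (.inr (.inr ⟨rfl, rfl⟩))))
      (fun x y hx hxy => hx.tail (.inl hxy)) fun x y hxy hy => .head hxy hy
  by_cases hb1 : B₁ u b
  swap
  · refine main (fun x y => B₁ x y ∨ (x = u ∧ y = a))
      (fun x y => (B₂ x y ∧ ¬ (x = u ∧ y = a)) ∨ (x = u ∧ y = b)) (by grind) (by grind) (by grind)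
      (.single (.inr ⟨rfl, rfl⟩)) (fun x y hx hxy => hx.tail (.inl hxy))
      (detour b hb2 hne.2.1.symm)
  refine main (fun x y => (B₁ x y ∧ ¬ (x = u ∧ y = c)) ∨ (x = b ∧ y = c) ∨ (x = u ∧ y = a))
    (fun x y => (B₂ x y ∧ ¬ (x = u ∧ y = a)) ∨ (x = u ∧ y = c)) (by grind) (by grind) (by grind)
    (.single (.inr (.inr ⟨rfl, rfl⟩))) (fun x y hx hxy => ?_) (detour c hc2 hne.2.2.symm)
  by_cases h : x = u ∧ y = c
  · obtain ⟨rfl, rfl⟩ := h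
    exact .head (.inl ⟨hb1, fun h => hbc h.2⟩) (.single (.inr (.inl ⟨rfl, rfl⟩)))
  · exact hx.tail (.inl ⟨hxy, h⟩)

/-- Moving the root of the out-tree to a vertex with three cyclically joined out-neighbours. -/
theorem CoverPair.root_of_cyclic (h : CoverPair A Set.univ Set.univ a v)
    (hab : a ≠ b) (hac : a ≠ c) (hbc : b ≠ c) (hua : A u a) (hub : A u b) (huc : A u c)
    (hne : u ≠ a ∧ u ≠ b ∧ u ≠ c) (hca : A c a) (hab' : A a b) (hbc' : A b c) :
    CoverPair A Set.univ Set.univ u v := by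
  obtain ⟨B₁, B₂, k1, k2, k3, k4, k5, k6, k7, k8, k9⟩ := h.exists_trees
  have main : ∀ C₁ C₂ : V → V → Prop, (∀ x y, C₁ x y → A x y) → (∀ x y, C₂ x y → A x y) →
      (∀ x y, C₁ x y → ¬ C₂ x y) → ReflTransGen C₁ u a →
      (∀ x y, ReflTransGen C₁ u x → B₁ x y → ReflTransGen C₁ u y) →
      (∀ x y, B₂ x y → ReflTransGen C₂ y v → ReflTransGen C₂ x v) →
      CoverPair A Set.univ Set.univ u v := fun C₁ C₂ h1 h2 h3 h4 h5 h6 =>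
    ⟨C₁, C₂, h1, h2, h3, fun x _ => (k4 x trivial).of_step_from h4 h5,
      fun x _ => (k5 x trivial).of_step_to h6⟩
  have hcyc := not_cyclic_triangle_of_in_tree k8 k9 (k5 a trivial) (b := b) (c := c)
  by_cases hu : B₂ u a
  swap
  · refine main (fun x y => B₁ x y ∨ (x = u ∧ y = a)) B₂ (by grind) k2 (by grind)
      (.single (.inr ⟨rfl, rfl⟩)) (fun x y hx hxy => hx.tail (.inl hxy))
      fun x y hxy hy => .head hxy hy
  by_cases hc2 : B₂ c a
  swap
  · refine main (fun x y => B₁ x y ∨ (x = u ∧ y = c) ∨ (x = c ∧ y = a)) B₂ (by grind) k2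
      (by grind) (.head (.inr (.inl ⟨rfl, rfl⟩)) (.single (.inr (.inr ⟨rfl, rfl⟩))))
      (fun x y hx hxy => hx.tail (.inl hxy)) fun x y hxy hy => .head hxy hy
  have detour : ∀ x y, B₂ x y →
      ReflTransGen (fun x y => (B₂ x y ∧ ¬ (x = u ∧ y = a)) ∨ (x = u ∧ y = c)) y v →
      ReflTransGen (fun x y => (B₂ x y ∧ ¬ (x = u ∧ y = a)) ∨ (x = u ∧ y = c)) x v := by
    intro x y hxy hy
    by_cases h : x = u ∧ y = a
    · obtain ⟨rfl, rfl⟩ := h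
      exact .head (.inr ⟨rfl, rfl⟩) (.head (.inl ⟨hc2, fun h => hne.2.2 h.1.symm⟩) hy)
    · exact .head (.inl ⟨hxy, h⟩) hy
  by_cases hc1 : B₁ u c
  swap
  · refine main (fun x y => B₁ x y ∨ (x = u ∧ y = a))
      (fun x y => (B₂ x y ∧ ¬ (x = u ∧ y = a)) ∨ (x = u ∧ y = c)) (by grind) (by grind) (by grind)
      (.single (.inr ⟨rfl, rfl⟩)) (fun x y hx hxy => hx.tail (.inl hxy)) detour
  by_cases hb2 : B₂ b c
  swap
  · refine main (fun x y => (B₁ x y ∧ ¬ (x = u ∧ y = c)) ∨ (x = u ∧ y = a) ∨ (x = u ∧ y = b) ∨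
        (x = b ∧ y = c))
      (fun x y => (B₂ x y ∧ ¬ (x = u ∧ y = a)) ∨ (x = u ∧ y = c)) (by grind) (by grind) (by grind)
      (.single (.inr (.inl ⟨rfl, rfl⟩))) (fun x y hx hxy => ?_) detour
    by_cases h : x = u ∧ y = c
    · obtain ⟨rfl, rfl⟩ := h
      exact .head (.inr (.inr (.inl ⟨rfl, rfl⟩))) (.single (.inr (.inr (.inr ⟨rfl, rfl⟩))))
    · exact hx.tail (.inl ⟨hxy, h⟩)
  refine main (fun x y => (B₁ x y ∧ ¬ (x = u ∧ y = b)) ∨ (x = u ∧ y = a) ∨ (x = a ∧ y = b))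
    (fun x y => (B₂ x y ∧ ¬ (x = u ∧ y = a)) ∨ (x = u ∧ y = b)) (by grind) (by grind) (by grind)
    (.single (.inr (.inl ⟨rfl, rfl⟩))) (fun x y hx hxy => ?_) fun x y hxy hy => ?_
  · by_cases h : x = u ∧ y = b
    · obtain ⟨rfl, rfl⟩ := h
      exact .head (.inr (.inl ⟨rfl, rfl⟩)) (.single (.inr (.inr ⟨rfl, rfl⟩)))
    · exact hx.tail (.inl ⟨hxy, h⟩)
  · by_cases h : x = u ∧ y = a
    · obtain ⟨rfl, rfl⟩ := h
      exact .head (.inr ⟨rfl, rfl⟩) (.head (.inl ⟨hb2, fun h => hne.2.1 h.1.symm⟩)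
        (.head (.inl ⟨hc2, fun h => hne.2.2 h.1.symm⟩) hy))
    · exact .head (.inl ⟨hxy, h⟩) hy

/-- Moving the root of the out-tree to a vertex with three pairwise joined out-neighbours. -/
theorem CoverPair.root_of_three (hab : a ≠ b) (hac : a ≠ c) (hbc : b ≠ c)
    (hua : A u a) (hub : A u b) (huc : A u c) (hne : u ≠ a ∧ u ≠ b ∧ u ≠ c)
    (hab' : A a b ∨ A b a) (hac' : A a c ∨ A c a) (hbc' : A b c ∨ A c b)
    (h : ∀ w, w = a ∨ w = b ∨ w = c → CoverPair A Set.univ Set.univ w v) :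
    CoverPair A Set.univ Set.univ u v := by
  have ha := h a (by simp)
  have hb := h b (by simp)
  have hc := h c (by simp)
  obtain ⟨n1, n2, n3⟩ := hne
  rcases hab' with d1 | d1 <;> rcases hac' with d2 | d2 <;> rcases hbc' with d3 | d3
  · exact hc.root_of_transitive hac.symm hbc.symm hab huc hua hub ⟨n3, n1, n2⟩ d2 d3 d1
  · exact hb.root_of_transitive hab.symm hbc hac hub hua huc ⟨n2, n1, n3⟩ d1 d3 d2
  · exact ha.root_of_cyclic hab hac hbc hua hub huc ⟨n1, n2, n3⟩ d2 d1 d3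
  · exact hb.root_of_transitive hbc hab.symm hac.symm hub huc hua ⟨n2, n3, n1⟩ d3 d1 d2
  · exact hc.root_of_transitive hbc.symm hac.symm hab.symm huc hub hua ⟨n3, n2, n1⟩ d3 d2 d1
  · exact ha.root_of_cyclic hac hab hbc.symm hua huc hub ⟨n1, n3, n2⟩ d1 d2 d3
  · exact ha.root_of_transitive hab hac hbc hua hub huc ⟨n1, n2, n3⟩ d1 d2 d3
  · exact ha.root_of_transitive hac hab hbc.symm hua huc hub ⟨n1, n3, n2⟩ d2 d1 d3

end RootChange

section GoodPairs

variable {V : Type*} [Fintype V] [DecidableEq V] {A : Finset (V × V)}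

theorem connOn_of_arcStrong (h : ArcStrong 2 A) (S : Finset V) : ConnOn S A.val := by
  intro X ⟨x, hxS, hx⟩ ⟨y, hyS, hy⟩
  by_contra! hlt
  have hcard : (A.filter fun e => e.1 ∈ X ∧ e.2 ∉ X).card < 2 := by
    rwa [cutOut, Multiset.countP_eq_card_filter] at hlt
  have := h _ (Finset.filter_subset _ _) hcard x y
  refine hy ?_
  clear hy hyS hxS
  induction this with
  | refl => exact hx
  | tail _ hab ih =>
    by_contra hb
    simp only [Finset.mem_sdiff, Finset.mem_filter] at hab
    exact hab.2 ⟨hab.1, ih, hb⟩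

theorem HasRootedPairOn.coverPair {S : Finset V} {u v : V} (h : HasRootedPairOn S A.val u v) :
    CoverPair (fun x y => (x, y) ∈ A) S S u v := by
  obtain ⟨M₁, M₂, hle, h1, h2⟩ := h
  have hnd := (Multiset.nodup_add.1 (Multiset.nodup_of_le hle A.nodup)).2.2
  exact ⟨fun x y => (x, y) ∈ M₁, fun x y => (x, y) ∈ M₂,
    fun x y hxy => Multiset.mem_of_le hle (Multiset.mem_add.2 (.inl hxy)),
    fun x y hxy => Multiset.mem_of_le hle (Multiset.mem_add.2 (.inr hxy)),
    fun x y hxy hxy' => Multiset.disjoint_left.1 hnd hxy hxy', h1, h2⟩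

theorem CoverPair.goodPair {u v : V}
    (h : CoverPair (fun x y => (x, y) ∈ A) Set.univ Set.univ u v) : GoodPair A u v := by
  classical
  obtain ⟨B₁, B₂, k1, k2, k3, k4, k5, k6, k7, k8, k9⟩ := h.exists_trees
  have hmem : ∀ B : V → V → Prop, (∀ x y, B x y → (x, y) ∈ A) →
      ∀ x y, (x, y) ∈ A.filter (fun e => B e.1 e.2) ↔ B x y := by
    intro B hB x y
    simpa using hB x y
  refine ⟨A.filter fun e => B₁ e.1 e.2, A.filter fun e => B₂ e.1 e.2,
    ⟨Finset.filter_subset _ _, fun w => ?_, fun w hw => ?_, ?_⟩,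
    ⟨Finset.filter_subset _ _, fun w => ?_, fun w hw => ?_, ?_⟩, ?_⟩
  · simp only [hmem B₁ k1]
    exact k4 w trivial
  · obtain h | ⟨x, _, hx⟩ := (k4 w trivial).cases_tail
    · exact absurd h hw
    rw [Finset.card_eq_one]
    refine ⟨(x, w), ?_⟩
    ext ⟨a, b⟩
    rw [Finset.mem_filter, hmem B₁ k1]
    grind
  · rw [Finset.filter_eq_empty_iff]
    rintro ⟨a, b⟩ hab (rfl : b = u)
    exact k7 a ((hmem B₁ k1 _ _).1 hab)
  · simp only [hmem B₂ k2]
    exact k5 w trivial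
  · obtain h | ⟨x, hx, _⟩ := (k5 w trivial).cases_head
    · exact absurd h hw
    rw [Finset.card_eq_one]
    refine ⟨(w, x), ?_⟩
    ext ⟨a, b⟩
    rw [Finset.mem_filter, hmem B₂ k2]
    grind
  · rw [Finset.filter_eq_empty_iff]
    rintro ⟨a, b⟩ hab (rfl : a = v)
    exact k9 b ((hmem B₂ k2 _ _).1 hab)
  · rw [Finset.disjoint_left]
    rintro ⟨a, b⟩ h1 h2
    exact k3 a b ((hmem B₁ k1 _ _).1 h1) ((hmem B₂ k2 _ _).1 h2)

theorem exists_three_of_outDeg {t : V} (h : 3 ≤ outDeg A t) :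
    ∃ x y z, x ≠ y ∧ x ≠ z ∧ y ≠ z ∧ (t, x) ∈ A ∧ (t, y) ∈ A ∧ (t, z) ∈ A := by
  obtain ⟨⟨a, x⟩, ha, ⟨b, y⟩, hb, ⟨c, z⟩, hc, h1, h2, h3⟩ := Finset.two_lt_card.1 h
  simp only [Finset.mem_filter] at ha hb hc
  obtain ⟨ha, rfl⟩ := ha
  obtain ⟨hb, rfl⟩ := hb
  obtain ⟨hc, rfl⟩ := hc
  exact ⟨x, y, z, by grind, by grind, by grind, ha, hb, hc⟩

theorem exists_three_of_inDeg {t : V} (h : 3 ≤ inDeg A t) :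
    ∃ x y z, x ≠ y ∧ x ≠ z ∧ y ≠ z ∧ (x, t) ∈ A ∧ (y, t) ∈ A ∧ (z, t) ∈ A := by
  obtain ⟨⟨x, a⟩, ha, ⟨y, b⟩, hb, ⟨z, c⟩, hc, h1, h2, h3⟩ := Finset.two_lt_card.1 h
  simp only [Finset.mem_filter] at ha hb hc
  obtain ⟨ha, rfl⟩ := ha
  obtain ⟨hb, rfl⟩ := hb
  obtain ⟨hc, rfl⟩ := hc
  exact ⟨x, y, z, by grind, by grind, by grind, ha, hb, hc⟩

end GoodPairs

/-- Theorem 4.2: a 2-arc-strong split digraph in which every vertex of `V₁` has out-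
and in-degree at least 3 has a good `(u, v)`-pair for every choice of `u, v`. -/
theorem stmt12 {V : Type*} [Fintype V] [DecidableEq V]
    (V₁ V₂ : Finset V) (A : Finset (V × V))
    (hsplit : IsSplitDigraph V₁ V₂ A)
    (h2 : ArcStrong 2 A)
    (hdeg : ∀ t ∈ V₁, 3 ≤ outDeg A t ∧ 3 ≤ inDeg A t) :
    ∀ u v : V, GoodPair A u v := by
  obtain ⟨_, _, hdisj, hunion, hloop, hind, hsc⟩ := hsplit
  have hV1 : ∀ t, t ∉ V₂ → t ∈ V₁ := fun t ht => by
    have : t ∈ V₁ ∪ V₂ := hunion ▸ Finset.mem_univ t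
    exact (Finset.mem_union.1 this).resolve_right ht
  have hV2 : ∀ t ∈ V₁, t ∉ V₂ := fun t ht => Finset.disjoint_left.1 hdisj ht
  have hcount : ∀ e, A.val.count e ≤ 1 := Multiset.nodup_iff_count_le_one.1 A.nodup
  have hout : ∀ t ∉ V₂, ∃ x ∈ V₂, ∃ y ∈ V₂, ∃ z ∈ V₂, x ≠ y ∧ x ≠ z ∧ y ≠ z ∧
      (t, x) ∈ A ∧ (t, y) ∈ A ∧ (t, z) ∈ A := by
    intro t ht
    obtain ⟨x, y, z, hxy, hxz, hyz, hx, hy, hz⟩ := exists_three_of_outDeg (hdeg t (hV1 t ht)).1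
    have key : ∀ w, (t, w) ∈ A → w ∈ V₂ := fun w hw => by
      by_contra h
      exact hind t (hV1 t ht) w (hV1 w h) hw
    exact ⟨x, key x hx, y, key y hy, z, key z hz, hxy, hxz, hyz, hx, hy, hz⟩
  have hin : ∀ t ∉ V₂, ∃ x ∈ V₂, ∃ y ∈ V₂, ∃ z ∈ V₂, x ≠ y ∧ x ≠ z ∧ y ≠ z ∧
      (x, t) ∈ A ∧ (y, t) ∈ A ∧ (z, t) ∈ A := by
    intro t ht
    obtain ⟨x, y, z, hxy, hxz, hyz, hx, hy, hz⟩ := exists_three_of_inDeg (hdeg t (hV1 t ht)).2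
    have key : ∀ w, (w, t) ∈ A → w ∈ V₂ := fun w hw => by
      by_contra h
      exact hind w (hV1 w h) t (hV1 t ht) hw
    exact ⟨x, key x hx, y, key y hy, z, key z hz, hxy, hxz, hyz, hx, hy, hz⟩
  have hcore : ∀ u ∈ V₂, ∀ v ∈ V₂, CoverPair (fun x y => (x, y) ∈ A) Set.univ Set.univ u v := by
    intro u hu v hv
    have hpair : HasRootedPairOn V₂ A.val u v := by
      refine hasRootedPairOn_of_independent (T := V₁) hu hv hV2 (connOn_of_arcStrong h2 V₂) hsc
        ?_ fun t ht => ⟨?_, ?_, fun x => hcount _, fun x => hcount _⟩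
      · rintro ⟨x, y⟩ hxy
        have h := hind x
        by_cases hx : x ∈ V₂ <;> by_cases hy : y ∈ V₂
        · exact .inl ⟨hx, hy⟩
        · exact .inr (.inl ⟨hx, hV1 y hy⟩)
        · exact .inr (.inr ⟨hV1 x hx, hy⟩)
        · exact absurd hxy (hind x (hV1 x hx) y (hV1 y hy))
      · rw [mInDeg, Multiset.countP_eq_card_filter]
        exact (hdeg t ht).2
      · rw [mOutDeg, Multiset.countP_eq_card_filter]
        exact (hdeg t ht).1
    exact (hpair.coverPair.univ_left hsc hin).univ_right hsc hout
  have hleft : ∀ u, ∀ v ∈ V₂, CoverPair (fun x y => (x, y) ∈ A) Set.univ Set.univ u v := by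
    intro u v hv
    by_cases hu : u ∈ V₂
    · exact hcore u hu v hv
    obtain ⟨x, hx, y, hy, z, hz, hxy, hxz, hyz, h1, h2, h3⟩ := hout u hu
    refine CoverPair.root_of_three hxy hxz hyz h1 h2 h3 (by grind) (hsc x hx y hy hxy)
      (hsc x hx z hz hxz) (hsc y hy z hz hyz) ?_
    rintro w (rfl | rfl | rfl)
    exacts [hcore _ hx v hv, hcore _ hy v hv, hcore _ hz v hv]
  intro u v
  refine CoverPair.goodPair ?_
  by_cases hv : v ∈ V₂
  · exact hleft u v hv
  obtain ⟨x, hx, y, hy, z, hz, hxy, hxz, hyz, h1, h2, h3⟩ := hin v hv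
  refine (CoverPair.root_of_three (A := fun x y => (y, x) ∈ A) hxy hxz hyz h1 h2 h3 (by grind)
    (hsc x hx y hy hxy).symm (hsc x hx z hz hxz).symm (hsc y hy z hz hyz).symm ?_).flip
  rintro w (rfl | rfl | rfl)
  exacts [(hleft u _ hx).flip, (hleft u _ hy).flip, (hleft u _ hz).flip]
end

section
/- Every 3-arc-strong split digraph contains a good (u,v)-pair for every ordered pair of vertices u,v. -/
open Relation Finset

/-- `x` can be reached from `u` by a walk of length `n` along `r`. -/
inductive WalkOfLength {α : Type*} (r : α → α → Prop) (u : α) : ℕ → α → Prop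
  | zero : WalkOfLength r u 0 u
  | succ {n : ℕ} {x y : α} : WalkOfLength r u n x → r x y → WalkOfLength r u (n + 1) y

theorem WalkOfLength.reflTransGen {α : Type*} {r : α → α → Prop} {u : α} {n : ℕ} {x : α}
    (h : WalkOfLength r u n x) : ReflTransGen r u x := by
  induction h with
  | zero => exact .refl
  | succ _ hr ih => exact ih.tail hr

theorem exists_walkOfLength {α : Type*} {r : α → α → Prop} {u x : α}
    (h : ReflTransGen r u x) : ∃ n, WalkOfLength r u n x := by
  induction h with
  | refl => exact ⟨0, .zero⟩
  | tail _ hr ih => exact ih.imp' (· + 1) fun _ hn => hn.succ hr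

/-- The vertices reachable from `u` carry a breadth-first search tree rooted at `u`. -/
theorem exists_parent {α : Type*} (r : α → α → Prop) (u : α) :
    ∃ (g : α → α) (d : α → ℕ), ∀ x, ReflTransGen r u x → x ≠ u →
      ReflTransGen r u (g x) ∧ r (g x) x ∧ d (g x) < d x := by
  classical
  let d : α → ℕ := fun x => sInf {n | WalkOfLength r u n x}
  have key : ∀ x, ∃ y, ReflTransGen r u x → x ≠ u →
      ReflTransGen r u y ∧ r y x ∧ d y < d x := by
    intro x
    by_cases hx : ReflTransGen r u x ∧ x ≠ u
    · have hmem : WalkOfLength r u (d x) x := Nat.sInf_mem (exists_walkOfLength hx.1)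
      generalize hn : d x = n at hmem
      cases hmem with
      | zero => exact absurd rfl hx.2
      | @succ m y _ hw hr =>
        refine ⟨y, fun _ _ => ⟨hw.reflTransGen, hr, ?_⟩⟩
        have : d y ≤ m := Nat.sInf_le hw
        omega
    · exact ⟨x, fun h1 h2 => absurd ⟨h1, h2⟩ hx⟩
  choose g hg using key
  exact ⟨g, d, hg⟩

/-- The dual of `exists_parent`, for the vertices from which `v` can be reached. -/
theorem exists_successor {α : Type*} (r : α → α → Prop) (v : α) :
    ∃ (f : α → α) (d : α → ℕ), ∀ x, ReflTransGen r x v → x ≠ v →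
      ReflTransGen r (f x) v ∧ r x (f x) ∧ d (f x) < d x := by
  obtain ⟨f, d, h⟩ := exists_parent (Function.swap r) v
  refine ⟨f, d, fun x hx hxv => ?_⟩
  obtain ⟨h1, h2, h3⟩ := h x (reflTransGen_swap.2 hx) hxv
  exact ⟨reflTransGen_swap.1 h1, h2, h3⟩

theorem exists_crossing {α : Type*} {r : α → α → Prop} {a b : α} (X : Set α)
    (h : ReflTransGen r a b) (ha : a ∉ X) (hb : b ∈ X) : ∃ c d, r c d ∧ c ∉ X ∧ d ∈ X := by
  induction h with
  | refl => exact absurd hb ha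
  | @tail c d _ hr ih =>
    by_cases hc : c ∈ X
    · exact ih hc
    · exact ⟨c, d, hr, hc, hb⟩

theorem ArcStrong.three_arcs_entering {V : Type*} [DecidableEq V] {A : Finset (V × V)}
    (h3 : ArcStrong 3 A) (X : Set V) {a b : V} (ha : a ∉ X) (hb : b ∈ X) :
    ∃ e : Fin 3 → V × V, Function.Injective e ∧ ∀ i, e i ∈ A ∧ (e i).1 ∉ X ∧ (e i).2 ∈ X := by
  classical
  set B := A.filter fun e => e.1 ∉ X ∧ e.2 ∈ X with hB
  have hcard : 2 < B.card := by
    by_contra hlt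
    obtain ⟨c, d, hcd, hc, hd⟩ :=
      exists_crossing X (h3 B (filter_subset _ _) (by omega) a b) ha hb
    simp only [hB, mem_sdiff, mem_filter] at hcd
    exact hcd.2 ⟨hcd.1, hc, hd⟩
  obtain ⟨f⟩ : Nonempty (Fin 3 ↪ B) :=
    Function.Embedding.nonempty_of_card_le (by simpa using Nat.succ_le_of_lt hcard)
  refine ⟨fun i => f i, fun i j h => f.injective (Subtype.ext h), fun i => ?_⟩
  exact mem_filter.1 (f i).2

/-- A forest contains no triangle. -/
theorem forest_not_triangle {α : Type*} {E : α → α → Prop} (g : α → α) (d : α → ℕ)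
    (hE : ∀ a b, E a b → a = g b ∧ d a < d b) {p : Fin 3 → α} (hp : Function.Injective p)
    (h : ∀ i j, i ≠ j → E (p i) (p j) ∨ E (p j) (p i)) : False := by
  have h01 : p 0 ≠ p 1 := hp.ne (by decide)
  have h02 : p 0 ≠ p 2 := hp.ne (by decide)
  have h12 : p 1 ≠ p 2 := hp.ne (by decide)
  have k := fun i j => hE (p i) (p j)
  rcases h 0 1 (by decide) with a | a <;> rcases h 0 2 (by decide) with b | b <;>
    rcases h 1 2 (by decide) with c | c <;>
    have a' := k _ _ a <;> have b' := k _ _ b <;> have c' := k _ _ c <;> grind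

/-- Among three pairwise adjacent vertices some arc lies outside a given forest. -/
theorem exists_arc_not_mem_forest {V : Type*} {A : Finset (V × V)} {E : V → V → Prop}
    (g : V → V) (d : V → ℕ) (hE : ∀ a b, E a b → a = g b ∧ d a < d b) {p : Fin 3 → V}
    (hp : Function.Injective p)
    (hadj : ∀ i j, i ≠ j → (p i, p j) ∈ A ∨ (p j, p i) ∈ A) :
    ∃ i j, i ≠ j ∧ (p i, p j) ∈ A ∧ ¬ E (p i) (p j) := by
  by_contra hcon
  push Not at hcon
  exact forest_not_triangle g d hE hp fun i j hij =>
    (hadj i j hij).imp (hcon i j hij) (hcon j i hij.symm)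

/-- `f` maps every vertex other than `v` to its out-neighbour in a spanning in-tree of `A`
rooted at `v`. -/
def IsInTree {V : Type*} (A : Finset (V × V)) (v : V) (f : V → V) : Prop :=
  f v = v ∧ (∀ x, x ≠ v → (x, f x) ∈ A) ∧ ∀ x, ReflTransGen (fun a b => b = f a) x v

/-- The arcs not occupied by the in-tree `f`, where the leaves of `f` outside `V₂` do not
occupy any arc. -/
def Avail {V : Type*} (A : Finset (V × V)) (V₂ : Finset V) (f : V → V) (a b : V) : Prop :=
  (a, b) ∈ A ∧ ¬ (b = f a ∧ (a ∈ V₂ ∨ ∃ x, f x = a))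

theorem IsInTree.update {V : Type*} [DecidableEq V] {A : Finset (V × V)} {v : V} {f : V → V}
    (hf : IsInTree A v f) {p q : V} (hpv : p ≠ v) (hpq : (p, q) ∈ A)
    (hq : ReflTransGen (fun a b => b = f a ∧ a ≠ p) q v) :
    IsInTree A v (Function.update f p q) := by
  obtain ⟨h1, h2, h3⟩ := hf
  refine ⟨by rw [Function.update_of_ne hpv.symm, h1], fun x hx => ?_, fun x => ?_⟩
  · by_cases hxp : x = p
    · subst hxp; simpa using hpq
    · simpa [Function.update_of_ne hxp] using h2 x hx
  · have hq' : ReflTransGen (fun a b => b = Function.update f p q a) q v :=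
      ReflTransGen.mono (fun a b h => by rw [Function.update_of_ne h.2]; exact h.1) _ _ hq
    induction h3 x using ReflTransGen.head_induction_on with
    | refl => exact .refl
    | @head a c hac _ ih =>
      by_cases hap : a = p
      · subst hap
        exact hq'.head (by simp)
      · exact ih.head (by rw [Function.update_of_ne hap]; exact hac)

theorem reflTransGen_avoiding {V : Type*} {f : V → V} {x v p : V} (Q : Set V)
    (hQ : ∀ x ∈ Q, f x ∈ Q) (hx : x ∈ Q) (hp : p ∉ Q)
    (h : ReflTransGen (fun a b => b = f a) x v) :
    ReflTransGen (fun a b => b = f a ∧ a ≠ p) x v := by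
  have : ReflTransGen (fun a b => b = f a ∧ a ≠ p) x v ∧ v ∈ Q := by
    induction h with
    | refl => exact ⟨.refl, hx⟩
    | @tail b c _ hr ih =>
      exact ⟨ih.1.tail ⟨hr, fun h => hp (h ▸ ih.2)⟩, hr ▸ hQ _ ih.2⟩
  exact this.1

theorem reachable_of_parent {V : Type*} {r : V → V → Prop} {u : V} {R : Set V}
    (g : V → V) (d : V → ℕ) (h : ∀ x ∈ R, x ≠ u → g x ∈ R ∧ d (g x) < d x ∧ r (g x) x) :
    ∀ x ∈ R, ReflTransGen r u x := by
  suffices H : ∀ n x, d x = n → x ∈ R → ReflTransGen r u x from fun x hx => H _ x rfl hx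
  intro n
  induction n using Nat.strong_induction_on with
  | _ n ih =>
    intro x hn hx
    by_cases hxu : x = u
    · exact hxu ▸ .refl
    · obtain ⟨h1, h2, h3⟩ := h x hx hxu
      exact (ih _ (hn ▸ h2) _ rfl h1).tail h3

/-- If three arcs of an in-tree leave the set `R` spanned by an out-tree `g` from `u` and end in
a set `Q` that is closed under the in-tree, then the in-tree can be changed so that more
vertices become reachable from `u`. -/
theorem IsInTree.exists_reroute {V : Type*} [Fintype V] [DecidableEq V] {V₂ : Finset V}
    {A : Finset (V × V)} (hind : ∀ a ∉ V₂, ∀ b ∉ V₂, (a, b) ∉ A)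
    (hsemi : ∀ a ∈ V₂, ∀ b ∈ V₂, a ≠ b → (a, b) ∈ A ∨ (b, a) ∈ A)
    {u v : V} {R Q : Set V} {g : V → V} {d : V → ℕ}
    (hg : ∀ x ∈ R, x ≠ u → g x ∈ R ∧ d (g x) < d x) (hvQ : v ∈ Q)
    {r : Fin 3 → V} (hr : Function.Injective r) (hrR : ∀ i, r i ∈ R) (hrQ : ∀ i, r i ∉ Q)
    {f : V → V} (hf : IsInTree A v f) (havail : ∀ x ∈ R, x ≠ u → Avail A V₂ f (g x) x)
    (hQ : ∀ x ∈ Q, f x ∈ Q) (hfrQ : ∀ i, f (r i) ∈ Q) (hfrR : ∀ i, f (r i) ∉ R) :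
    ∃ f', IsInTree A v f' ∧ ∃ y ∉ R, ∀ x ∈ insert y R, ReflTransGen (Avail A V₂ f') u x := by
  induction hn : (univ.filter fun x => f x ∉ V₂).card using Nat.strong_induction_on
    generalizing f with
  | _ n ih =>
  have grow : ∀ f', IsInTree A v f' → (∀ x ∈ R, x ≠ u → Avail A V₂ f' (g x) x) →
      ∀ i, Avail A V₂ f' (r i) (f (r i)) → ∃ f', IsInTree A v f' ∧
        ∃ y ∉ R, ∀ x ∈ insert y R, ReflTransGen (Avail A V₂ f') u x := by
    intro f' hf' hav i hi
    have hR := reachable_of_parent g d fun x hx hxu =>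
      ⟨(hg x hx hxu).1, (hg x hx hxu).2, hav x hx hxu⟩
    refine ⟨f', hf', f (r i), hfrR i, fun x hx => ?_⟩
    rcases hx with rfl | hx
    · exact (hR _ (hrR i)).tail hi
    · exact hR x hx
  have hrv : ∀ i, r i ≠ v := fun i h => hrQ i (h ▸ hvQ)
  have hrA : ∀ i, (r i, f (r i)) ∈ A := fun i => hf.2.1 _ (hrv i)
  by_cases hleaf : ∃ i, r i ∉ V₂ ∧ ∀ x, f x ≠ r i
  · obtain ⟨i, hi, hx⟩ := hleaf
    exact grow f hf havail i ⟨hrA i, by simp [hi, hx]⟩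
  push Not at hleaf
  have hp : ∀ i, ∃ p ∈ V₂, p ∉ Q ∧ (p = r i ∨ r i ∉ V₂ ∧ f p = r i) := by
    intro i
    by_cases hi : r i ∈ V₂
    · exact ⟨r i, hi, hrQ i, .inl rfl⟩
    · obtain ⟨x, hx⟩ := hleaf i hi
      have hxQ : x ∉ Q := fun h => hrQ i (hx ▸ hQ x h)
      refine ⟨x, ?_, hxQ, .inr ⟨hi, hx⟩⟩
      by_contra hxV
      exact hind x hxV _ hi (hx ▸ hf.2.1 x fun h => hxQ (h ▸ hvQ))
  choose p hpV hpQ hpr using hp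
  have hpr' : ∀ i j, i ≠ j → p i ≠ r j := by
    intro i j hij h
    rcases hpr i with h' | h'
    · exact hij (hr (h'.symm.trans h))
    · exact hrQ i (by rw [← h'.2, h]; exact hfrQ j)
  have hpinj : Function.Injective p := by
    intro i j h
    by_contra hij
    rcases hpr j with h' | h'
    · exact hpr' i j hij (h.trans h')
    · rcases hpr i with h'' | h''
      · exact hpr' j i (Ne.symm hij) (h.symm.trans h'')
      · exact hij (hr (by rw [← h''.2, ← h'.2, h]))
  obtain ⟨i, j, hij, hA, hE⟩ := exists_arc_not_mem_forest (A := A)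
    (E := fun a b => (b ∈ R ∧ b ≠ u) ∧ a = g b) g d
    (fun a b h => ⟨h.2, h.2 ▸ (hg b h.1.1 h.1.2).2⟩) hpinj
    (fun i j hij => hsemi _ (hpV i) _ (hpV j) (hpinj.ne hij))
  have hpath : ReflTransGen (fun a b => b = f a ∧ a ≠ p i) (p j) v := by
    have h1 : ReflTransGen (fun a b => b = f a ∧ a ≠ p i) (r j) v :=
      (reflTransGen_avoiding Q hQ (hfrQ j) (hpQ i) (hf.2.2 _)).head
        ⟨rfl, (hpr' i j hij).symm⟩
    rcases hpr j with h' | h'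
    · rwa [h']
    · exact h1.head ⟨h'.2.symm, hpinj.ne hij.symm⟩
  have hf' := hf.update (ne_of_mem_of_not_mem hvQ (hpQ i)).symm hA hpath
  set f' := Function.update f (p i) (p j) with hf'def
  have hne : ∀ x, x ≠ p i → f' x = f x := fun x hx => Function.update_of_ne hx _ _
  have hpi : f' (p i) = p j := Function.update_self _ _ _
  have havail' : ∀ x ∈ R, x ≠ u → Avail A V₂ f' (g x) x := by
    intro x hx hxu
    obtain ⟨ha, hb⟩ := havail x hx hxu
    refine ⟨ha, fun ⟨h1, h2⟩ => ?_⟩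
    by_cases hgx : g x = p i
    · rw [hgx, hpi] at h1
      exact hE ⟨⟨h1 ▸ hx, h1 ▸ hxu⟩, by rw [← h1, hgx]⟩
    · rw [hne _ hgx] at h1
      refine hb ⟨h1, ?_⟩
      rcases h2 with h2 | ⟨y, hy⟩
      · exact .inl h2
      · by_cases hyp : y = p i
        · rw [hyp, hpi] at hy
          exact .inl (hy ▸ hpV j)
        · exact .inr ⟨y, by rw [← hne y hyp, hy]⟩
  rcases hpr i with h' | ⟨hiV, hfi⟩
  · refine grow f' hf' havail' i ⟨hrA i, fun h => hpQ j ?_⟩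
    rw [← h', hpi] at h
    rw [← h.1, h']
    exact hfrQ i
  · have hri : ∀ k, f' (r k) = f (r k) := fun k => hne _ fun h => by
      have := hfrQ k
      rw [h, hfi] at this
      exact hrQ i this
    refine ih _ ?_ hf' havail' (fun x hx => ?_) (fun k => hri k ▸ hfrQ k)
      (fun k => hri k ▸ hfrR k) rfl
    · rw [← hn]
      refine card_lt_card ?_
      rw [ssubset_iff_of_subset]
      · exact ⟨p i, by simpa [hfi] using hiV, by simpa [hpi] using hpV j⟩
      · intro x
        simp only [mem_filter, mem_univ, true_and]
        by_cases hx : x = p i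
        · rw [hx, hpi]
          exact fun h => absurd (hpV j) h
        · rw [hne x hx]
          exact id
    · rw [hne x fun h => hpQ i (h ▸ hx)]
      exact hQ x hx

/-- In a 3-arc-strong split digraph, an in-tree that leaves some vertex unreachable from `u` can
be replaced by one that leaves fewer vertices unreachable. -/
theorem IsInTree.exists_larger_reach {V : Type*} [Fintype V] [DecidableEq V] {V₂ : Finset V}
    {A : Finset (V × V)} (h3 : ArcStrong 3 A) (hloop : ∀ a, (a, a) ∉ A)
    (hind : ∀ a ∉ V₂, ∀ b ∉ V₂, (a, b) ∉ A)
    (hsemi : ∀ a ∈ V₂, ∀ b ∈ V₂, a ≠ b → (a, b) ∈ A ∨ (b, a) ∈ A)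
    {u v s : V} {f : V → V} (hf : IsInTree A v f) (hs : ¬ ReflTransGen (Avail A V₂ f) u s) :
    ∃ f', IsInTree A v f' ∧ ∃ y, ¬ ReflTransGen (Avail A V₂ f) u y ∧
      ReflTransGen (Avail A V₂ f') u y ∧
      ∀ x, ReflTransGen (Avail A V₂ f) u x → ReflTransGen (Avail A V₂ f') u x := by
  classical
  set R : Set V := {x | ReflTransGen (Avail A V₂ f) u x} with hR
  let ρ : V → V → Prop := fun a b => (a ∉ R ∧ (a, b) ∈ A) ∨
    (a ∈ R ∧ b ∈ R ∧ b = f a ∧ (a ∈ V₂ ∨ ∃ x, f x = a))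
  let Q : Set V := {x | ReflTransGen ρ x v}
  have hvQ : v ∈ Q := ReflTransGen.refl
  have hQS : ∃ x ∈ Q, x ∉ R := by
    have key : ∀ x, x ∈ Q ∨ (∃ x ∈ Q, x ∉ R) ∨ (x ∈ R ∧ ¬ ∃ y, f y = x) := by
      intro x
      induction hf.2.2 x using ReflTransGen.head_induction_on with
      | refl => exact .inl hvQ
      | @head a c hac _ ih =>
        rcases ih with ih | ih | ih
        · by_cases hav : a = v
          · exact .inl (hav ▸ hvQ)
          by_cases haR : a ∈ R
          · by_cases hcR : c ∈ R
            · by_cases hch : ∃ y, f y = a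
              · exact .inl (ReflTransGen.head (.inr ⟨haR, hcR, hac, .inr hch⟩) ih)
              · exact .inr (.inr ⟨haR, hch⟩)
            · exact .inr (.inl ⟨c, ih, hcR⟩)
          · exact .inl (ReflTransGen.head (.inl ⟨haR, hac ▸ hf.2.1 a hav⟩) ih)
        · exact .inr (.inl ih)
        · exact absurd ⟨a, hac.symm⟩ ih.2
    rcases key s with h | h | h
    · exact ⟨s, h, hs⟩
    · exact h
    · exact absurd h.1 hs
  obtain ⟨z, hzQ, hzR⟩ := hQS
  have huR : u ∈ R := ReflTransGen.refl
  obtain ⟨e, he, heX⟩ := h3.three_arcs_entering (Q \ R) (a := u) (b := z)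
    (fun h => h.2 huR) ⟨hzQ, hzR⟩
  have heR : ∀ i, (e i).1 ∈ R := by
    intro i
    by_contra h
    exact (heX i).2.1 ⟨ReflTransGen.head (.inl ⟨h, (heX i).1⟩) (heX i).2.2.1, h⟩
  have hef : ∀ i, (e i).2 = f (e i).1 := by
    intro i
    by_contra h
    exact (heX i).2.2.2 (ReflTransGen.tail (heR i) ⟨(heX i).1, fun h' => h h'.1⟩)
  have hev : ∀ i, (e i).1 ≠ v := by
    intro i h
    have h1 := (heX i).1
    rw [← Prod.mk.eta (p := e i), hef, h, hf.1] at h1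
    exact hloop v h1
  have heQ : ∀ i, (e i).1 ∉ Q := by
    intro i h
    rcases ReflTransGen.cases_head h with h | ⟨c, hc, -⟩
    · exact hev i h
    · rcases hc with hc | hc
      · exact hc.1 (heR i)
      · exact (heX i).2.2.2 (by rw [hef, ← hc.2.2.1]; exact hc.2.1)
  obtain ⟨g₀, d₀, hg₀⟩ := exists_successor ρ v
  let f₁ : V → V := fun x => if x ∈ Q ∧ x ≠ v then g₀ x else f x
  have hf₁Q : ∀ x ∈ Q, x ≠ v → f₁ x = g₀ x := fun x hx hxv => if_pos ⟨hx, hxv⟩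
  have hf₁n : ∀ x, x ∉ Q → f₁ x = f x := fun x hx => if_neg fun h => hx h.1
  have hf₁v : f₁ v = v := (if_neg fun h => h.2 rfl).trans hf.1
  have hf₁R : ∀ x ∈ R, f₁ x = f x := by
    intro x hx
    by_cases hxQ : x ∈ Q ∧ x ≠ v
    · rw [hf₁Q x hxQ.1 hxQ.2]
      rcases (hg₀ x hxQ.1 hxQ.2).2.1 with h | h
      · exact absurd hx h.1
      · exact h.2.2.1
    · exact if_neg hxQ
  have hclosed : ∀ x ∈ Q, f₁ x ∈ Q := by
    intro x hx
    by_cases hxv : x = v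
    · rw [hxv, hf₁v]; exact hvQ
    · rw [hf₁Q x hx hxv]; exact (hg₀ x hx hxv).1
  have hQpath : ∀ x ∈ Q, ReflTransGen (fun a b => b = f₁ a) x v := fun x hx =>
    reflTransGen_swap.1 <| reachable_of_parent (R := Q) (u := v) f₁ d₀ (fun x hx hxv =>
      ⟨hclosed x hx, by rw [hf₁Q x hx hxv]; exact (hg₀ x hx hxv).2.2, rfl⟩) x hx
  have hf₁ : IsInTree A v f₁ := by
    refine ⟨hf₁v, fun x hxv => ?_, fun x => ?_⟩
    · by_cases hx : x ∈ Q
      · rw [hf₁Q x hx hxv]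
        rcases (hg₀ x hx hxv).2.1 with h | h
        · exact h.2
        · rw [h.2.2.1]; exact hf.2.1 x hxv
      · rw [hf₁n x hx]; exact hf.2.1 x hxv
    · induction hf.2.2 x using ReflTransGen.head_induction_on with
      | refl => exact .refl
      | @head a c hac _ ih =>
        by_cases ha : a ∈ Q
        · exact hQpath a ha
        · exact ih.head (by rw [hf₁n a ha]; exact hac)
  obtain ⟨g, d, hg⟩ := exists_parent (Avail A V₂ f) u
  have havail : ∀ x ∈ R, x ≠ u → Avail A V₂ f₁ (g x) x := by
    intro x hx hxu
    obtain ⟨hgR, ⟨ha, hb⟩, -⟩ := hg x hx hxu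
    refine ⟨ha, fun ⟨h1, h2⟩ => ?_⟩
    rw [hf₁R _ hgR] at h1
    refine hb ⟨h1, ?_⟩
    rcases h2 with h2 | ⟨y, hy⟩
    · exact .inl h2
    by_cases hyQ : y ∈ Q
    · have hgQ : g x ∈ Q := hy ▸ hclosed y hyQ
      rcases ReflTransGen.cases_head hgQ with h | ⟨c, hc, -⟩
      · rw [h, hf.1] at h1
        rw [h, h1] at ha
        exact absurd ha (hloop v)
      · rcases hc with hc | hc
        · exact absurd hgR hc.1
        · exact hc.2.2.2
    · exact .inr ⟨y, by rw [← hf₁n y hyQ, hy]⟩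
  have hefst : ∀ i, f₁ (e i).1 = (e i).2 := fun i => by rw [hf₁n _ (heQ i), hef]
  obtain ⟨f', hf', y, hyR, hy⟩ := hf₁.exists_reroute hind hsemi (r := fun i => (e i).1)
    (fun x hx hxu => ⟨(hg x hx hxu).1, (hg x hx hxu).2.2⟩) hvQ
    (fun i j h => he (Prod.ext h (by rw [hef, hef]; exact congrArg f h))) heR heQ havail hclosed
    (fun i => by rw [hefst]; exact (heX i).2.2.1) (fun i => by rw [hefst]; exact (heX i).2.2.2)
  exact ⟨f', hf', y, hyR, hy y (Set.mem_insert _ _), fun x hx => hy x (Set.mem_insert_of_mem _ hx)⟩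

theorem exists_inTree_forall_reachable {V : Type*} [Fintype V] [DecidableEq V] {V₂ : Finset V}
    {A : Finset (V × V)} (h3 : ArcStrong 3 A) (hloop : ∀ a, (a, a) ∉ A)
    (hind : ∀ a ∉ V₂, ∀ b ∉ V₂, (a, b) ∉ A)
    (hsemi : ∀ a ∈ V₂, ∀ b ∈ V₂, a ≠ b → (a, b) ∈ A ∨ (b, a) ∈ A) (u v : V) :
    ∃ f, IsInTree A v f ∧ ∀ x, ReflTransGen (Avail A V₂ f) u x := by
  classical
  have hstrong : ∀ x y, ReflTransGen (fun a b => (a, b) ∈ A) x y := by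
    simpa [DigraphStrong] using h3 ∅ (empty_subset _) (by simp)
  have hex : ∃ f, IsInTree A v f := by
    obtain ⟨f, d, hf⟩ := exists_successor (fun a b => (a, b) ∈ A) v
    have hne : ∀ x, x ≠ v → Function.update f v v x = f x :=
      fun x hx => Function.update_of_ne hx _ _
    refine ⟨Function.update f v v, by simp, fun x hx => ?_, fun x => ?_⟩
    · rw [hne x hx]; exact (hf x (hstrong x v) hx).2.1
    · refine reflTransGen_swap.1 <| reachable_of_parent (R := Set.univ) (u := v)
        (Function.update f v v) d (fun x _ hx => ⟨trivial, ?_, rfl⟩) x trivial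
      rw [hne x hx]; exact (hf x (hstrong x v) hx).2.2
  obtain ⟨f, hf, hmax⟩ := Set.exists_max_image {f | IsInTree A v f}
    (fun f => (univ.filter fun x => ReflTransGen (Avail A V₂ f) u x).card)
    (Set.toFinite _) hex
  refine ⟨f, hf, fun s => ?_⟩
  by_contra hs
  obtain ⟨f', hf', y, hy, hy', hsub⟩ := IsInTree.exists_larger_reach h3 hloop hind hsemi hf hs
  refine (hmax f' hf').not_gt (card_lt_card ?_)
  rw [ssubset_iff_of_subset]
  · exact ⟨y, by simpa using hy', by simpa using hy⟩
  · intro x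
    simpa using hsub x

/-- `g` maps every vertex other than `u` to its in-neighbour in a spanning out-tree of `A`
rooted at `u`. -/
def IsOutTree {V : Type*} [DecidableEq V] (A : Finset (V × V)) (u : V) (g : V → V) : Prop :=
  IsInTree (A.image Prod.swap) u g

theorem mem_image_swap {V : Type*} [DecidableEq V] {A : Finset (V × V)} {a b : V} :
    (a, b) ∈ A.image Prod.swap ↔ (b, a) ∈ A := by
  simp

theorem IsOutTree.mem {V : Type*} [DecidableEq V] {A : Finset (V × V)} {u x : V} {g : V → V}
    (hg : IsOutTree A u g) (hx : x ≠ u) : (g x, x) ∈ A :=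
  mem_image_swap.1 (hg.2.1 x hx)

theorem IsInTree.exists_depth {V : Type*} {A : Finset (V × V)} {v : V} {f : V → V}
    (hf : IsInTree A v f) : ∃ d : V → ℕ, ∀ x, x ≠ v → d (f x) < d x := by
  obtain ⟨f₀, d, h⟩ := exists_successor (fun a b => b = f a) v
  exact ⟨d, fun x hx => by rw [← (h x (hf.2.2 x) hx).2.1]; exact (h x (hf.2.2 x) hx).2.2⟩

/-- If an out-tree and an in-tree only share arcs that leave leaves of the in-tree outside `V₂`,
then they can be made arc-disjoint. -/
theorem exists_arc_disjoint_trees {V : Type*} [Fintype V] [DecidableEq V] {V₂ : Finset V}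
    {A : Finset (V × V)} (h3 : ArcStrong 3 A) (hloop : ∀ a, (a, a) ∉ A)
    (hind : ∀ a ∉ V₂, ∀ b ∉ V₂, (a, b) ∉ A)
    (hsemi : ∀ a ∈ V₂, ∀ b ∈ V₂, a ≠ b → (a, b) ∈ A ∨ (b, a) ∈ A) {u v : V} {f g : V → V}
    (hf : IsInTree A v f) (hg : IsOutTree A u g)
    (hshare : ∀ x, x ≠ v → f x ≠ u → g (f x) = x → x ∉ V₂ ∧ ∀ y, f y ≠ x) :
    ∃ f' g', IsInTree A v f' ∧ IsOutTree A u g' ∧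
      ∀ x, x ≠ v → f' x ≠ u → g' (f' x) ≠ x := by
  induction hn : (univ.filter fun x => x ≠ v ∧ f x ≠ u ∧ g (f x) = x).card
    using Nat.strong_induction_on generalizing f g with
  | _ n ih =>
  by_cases hbad : ∃ t, t ≠ v ∧ f t ≠ u ∧ g (f t) = t
  swap
  · exact ⟨f, g, hf, hg, fun x h1 h2 h3 => hbad ⟨x, h1, h2, h3⟩⟩
  obtain ⟨t, htv, htu, htg⟩ := hbad
  obtain ⟨htV, htl⟩ := hshare t htv htu htg
  -- it suffices to find an out-arc of `t` outside an out-tree sharing no further arcs with `f`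
  have finish : ∀ g', IsOutTree A u g' → (∀ x, g' x = g x ∨ g' x ∈ V₂ ∧ f (g' x) ≠ x ∨
      g' x = v) → ∀ z, (t, z) ∈ A → (z ≠ u → g' z ≠ t) → ∃ f' g', IsInTree A v f' ∧
      IsOutTree A u g' ∧ ∀ x, x ≠ v → f' x ≠ u → g' (f' x) ≠ x := by
    intro g' hg' hgg z hz hzg
    have hzt : z ≠ t := fun h => hloop t (h ▸ hz)
    have hf' : IsInTree A v (Function.update f t z) :=
      hf.update htv hz <| reflTransGen_avoiding {x | x ≠ t}
        (fun x _ => htl x) hzt (fun h => h rfl) (hf.2.2 z)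
    set f' := Function.update f t z with hf'def
    have hne : ∀ x, x ≠ t → f' x = f x := fun x hx => Function.update_of_ne hx _ _
    have ht : f' t = z := Function.update_self _ _ _
    have hold : ∀ x, x ≠ v → f' x ≠ u → g' (f' x) = x → x ≠ t ∧ f x ≠ u ∧ g (f x) = x := by
      intro x hxv hxu hx
      have hxt : x ≠ t := by
        rintro rfl
        rw [ht] at hx hxu
        exact hzg hxu hx
      rw [hne x hxt] at hx hxu
      refine ⟨hxt, hxu, ?_⟩
      rcases hgg (f x) with h | h | h
      · rw [← h, hx]
      · rw [hx] at h; exact absurd rfl h.2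
      · exact absurd (hx.symm.trans h) hxv
    refine ih _ ?_ hf' hg' (fun x hxv hxu hx => ?_) rfl
    · rw [← hn]
      refine card_lt_card ?_
      rw [ssubset_iff_of_subset]
      · refine ⟨t, by simp [htv, htu, htg], ?_⟩
        simp only [mem_filter, mem_univ, true_and]
        exact fun h => (hold t h.1 h.2.1 h.2.2).1 rfl
      · intro x
        simp only [mem_filter, mem_univ, true_and]
        exact fun h => ⟨h.1, (hold x h.1 h.2.1 h.2.2).2⟩
    · obtain ⟨hxt, h1, h2⟩ := hold x hxv hxu hx
      obtain ⟨h4, h5⟩ := hshare x hxv h1 h2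
      refine ⟨h4, fun y => ?_⟩
      by_cases hy : y = t
      · rw [hy, ht]
        rintro rfl
        exact hind t htV _ h4 hz
      · rw [hne y hy]; exact h5 y
  by_cases hfree : ∃ z, (t, z) ∈ A ∧ (z ≠ u → g z ≠ t)
  · obtain ⟨z, hz, hzg⟩ := hfree
    exact finish g hg (fun _ => .inl rfl) z hz hzg
  push Not at hfree
  obtain ⟨e, he, heX⟩ := h3.three_arcs_entering {x | x ≠ t} (a := t) (b := v)
    (fun h => h rfl) htv.symm
  have het : ∀ i, (e i).1 = t := fun i => by simpa using (heX i).2.1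
  have heA : ∀ i, (t, (e i).2) ∈ A := fun i => by rw [← het i]; exact (heX i).1
  have heV : ∀ i, (e i).2 ∈ V₂ := fun i => by
    by_contra h
    exact hind t htV _ h (heA i)
  have heinj : Function.Injective fun i => (e i).2 := fun i j h =>
    he (Prod.ext (by rw [het, het]) h)
  obtain ⟨δ, hδ⟩ := hf.exists_depth
  obtain ⟨i, j, hij, hA, hE⟩ : ∃ i j, i ≠ j ∧ ((e i).2, (e j).2) ∈ A ∧
      ¬ ((e i).2 ≠ v ∧ f (e i).2 = (e j).2) := by
    by_contra hcon
    push Not at hcon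
    refine forest_not_triangle (E := fun a b => b ≠ v ∧ f b = a) f δ
      (fun a b h => ⟨h.2.symm, h.2 ▸ hδ b h.1⟩) heinj fun i j hij => ?_
    exact ((hsemi _ (heV i) _ (heV j) (heinj.ne hij)).imp (hcon i j hij)
      (hcon j i hij.symm)).symm
  have hj := hfree _ (heA j)
  have hti : (e i).2 ≠ t := fun h => hloop t (by simpa [h] using heA i)
  obtain ⟨d, hd⟩ := IsInTree.exists_depth hg
  have hpath : ReflTransGen (fun a b => b = g a ∧ a ≠ (e j).2) t u := by
    refine reflTransGen_avoiding {x | d x < d (e j).2} (fun x hx => ?_) ?_ (by simp) (hg.2.2 t)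
    · by_cases hxu : x = u
      · rw [hxu, hg.1, ← hxu]; exact hx
      · exact (hd x hxu).trans hx
    · have := hd _ hj.1
      rwa [hj.2] at this
  have hg' : IsOutTree A u (Function.update g (e j).2 (e i).2) :=
    IsInTree.update hg hj.1 (mem_image_swap.2 hA)
      (hpath.head ⟨(hfree _ (heA i)).2.symm, heinj.ne hij⟩)
  refine finish _ hg' (fun x => ?_) (e j).2 (heA j) fun _ => by simpa using hti
  by_cases hx : x = (e j).2
  · rw [hx, Function.update_self]
    by_cases hv : (e i).2 = v
    · exact .inr (.inr hv)
    · exact .inr (.inl ⟨heV i, fun h => hE ⟨hv, h⟩⟩)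
  · exact .inl (Function.update_of_ne hx _ _)

theorem IsInTree.isInBranching {V : Type*} [Fintype V] [DecidableEq V] {A : Finset (V × V)}
    {v : V} {f : V → V} (hf : IsInTree A v f) :
    IsInBranching A v ((univ.filter (· ≠ v)).image fun x => (x, f x)) := by
  refine ⟨fun e he => ?_, fun x => ?_, fun x hx => ?_, ?_⟩
  · obtain ⟨x, hx, rfl⟩ := mem_image.1 he
    exact hf.2.1 x (mem_filter.1 hx).2
  · induction hf.2.2 x using ReflTransGen.head_induction_on with
    | refl => exact .refl
    | @head a c hac _ ih =>
      by_cases ha : a = v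
      · exact ha ▸ .refl
      · exact ih.head (by simp [ha, hac])
  · rw [card_eq_one]
    refine ⟨(x, f x), ?_⟩
    ext ⟨a, b⟩
    simp only [mem_filter, mem_image, mem_univ, true_and, Prod.mk.injEq, mem_singleton]
    grind
  · ext ⟨a, b⟩
    simp only [mem_filter, mem_image, mem_univ, true_and, Prod.mk.injEq, notMem_empty]
    grind

theorem IsOutTree.isOutBranching {V : Type*} [Fintype V] [DecidableEq V] {A : Finset (V × V)}
    {u : V} {g : V → V} (hg : IsOutTree A u g) :
    IsOutBranching A u ((univ.filter (· ≠ u)).image fun x => (g x, x)) := by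
  refine ⟨fun e he => ?_, fun x => ?_, fun x hx => ?_, ?_⟩
  · obtain ⟨x, hx, rfl⟩ := mem_image.1 he
    exact hg.mem (mem_filter.1 hx).2
  · induction hg.2.2 x using ReflTransGen.head_induction_on with
    | refl => exact .refl
    | @head a c hac _ ih =>
      by_cases ha : a = u
      · exact ha ▸ .refl
      · exact ih.tail (by simp [ha, hac])
  · rw [card_eq_one]
    refine ⟨(g x, x), ?_⟩
    ext ⟨a, b⟩
    simp only [mem_filter, mem_image, mem_univ, true_and, Prod.mk.injEq, mem_singleton]
    grind
  · ext ⟨a, b⟩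
    simp only [mem_filter, mem_image, mem_univ, true_and, Prod.mk.injEq, notMem_empty]
    grind

/-- Corollary 4.3: every 3-arc-strong split digraph contains a good `(u, v)`-pair for
every choice of `u, v`. -/
theorem stmt13 {V : Type*} [Fintype V] [DecidableEq V]
    (V₁ V₂ : Finset V) (A : Finset (V × V))
    (hsplit : IsSplitDigraph V₁ V₂ A)
    (h3 : ArcStrong 3 A) :
    ∀ u v : V, GoodPair A u v := by
  intro u v
  obtain ⟨-, -, -, hunion, hloop, hind₁, hsemi⟩ := hsplit
  have hV₁ : ∀ a ∉ V₂, a ∈ V₁ := fun a ha =>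
    (mem_union.1 (hunion ▸ mem_univ a)).resolve_right ha
  have hind : ∀ a ∉ V₂, ∀ b ∉ V₂, (a, b) ∉ A := fun a ha b hb =>
    hind₁ a (hV₁ a ha) b (hV₁ b hb)
  obtain ⟨f, hf, hreach⟩ := exists_inTree_forall_reachable h3 hloop hind hsemi u v
  obtain ⟨g, d, hg⟩ := exists_parent (Avail A V₂ f) u
  have hne : ∀ x, x ≠ u → Function.update g u u x = g x :=
    fun x hx => Function.update_of_ne hx _ _
  have hg' : IsOutTree A u (Function.update g u u) := by
    refine ⟨Function.update_self _ _ _, fun x hx => ?_, fun x => ?_⟩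
    · rw [hne x hx]
      exact mem_image_swap.2 (hg x (hreach x) hx).2.1.1
    · refine reflTransGen_swap.1 <| reachable_of_parent (R := Set.univ) (u := u)
        (Function.update g u u) d (fun x _ hx => ⟨trivial, ?_, rfl⟩) x trivial
      rw [hne x hx]
      exact (hg x (hreach x) hx).2.2
  obtain ⟨f', g', hf', hg', hdisj⟩ := exists_arc_disjoint_trees h3 hloop hind hsemi hf hg'
    fun x _ hxu hx => by
      have h := (hg (f x) (hreach _) hxu).2.1.2
      rw [hne _ hxu] at hx
      rw [hx] at h
      simpa using h
  refine ⟨_, _, hg'.isOutBranching, hf'.isInBranching, disjoint_left.2 fun e he he' => ?_⟩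
  obtain ⟨x, hx, rfl⟩ := mem_image.1 he
  obtain ⟨y, hy, hxy⟩ := mem_image.1 he'
  obtain ⟨rfl, h⟩ := Prod.mk.inj hxy
  exact hdisj _ (mem_filter.1 hy).2 (fun hu => (mem_filter.1 hx).2 (h.symm.trans hu))
    (congrArg g' h)
end

section
/- Let D be a 2-arc-strong digraph, let u be a vertex of D, and let S be an induced subdigraph of D which is semicomplete and contains u. If every vertex of V(D)∖V(S) has at least two in-neighbors in V(S) and at least two out-neighbors in V(S), then D has a good (u,u)-pair. -/
/-- `ArcReach M x y`: there is a directed path from `x` to `y` using only arcs of `M`. -/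
def ArcReach {V : Type*} (M : Finset (V × V)) (x y : V) : Prop :=
  Relation.ReflTransGen (fun a b => (a, b) ∈ M) x y

namespace ArcReach

variable {V : Type*} {M N : Finset (V × V)} {x y z : V}

theorem mono (h : M ⊆ N) (hr : ArcReach M x y) : ArcReach N x y :=
  Relation.ReflTransGen.mono (fun _ _ hab => h hab) _ _ hr

theorem trans (h₁ : ArcReach M x y) (h₂ : ArcReach M y z) : ArcReach M x z :=
  Relation.ReflTransGen.trans h₁ h₂

theorem arc (h : (x, y) ∈ M) : ArcReach M x y :=
  Relation.ReflTransGen.single h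

variable [DecidableEq V]

/-- Reversing all arcs reverses reachability. -/
theorem image_swap_iff : ArcReach (M.image Prod.swap) x y ↔ ArcReach M y x := by
  unfold ArcReach
  rw [← Relation.reflTransGen_swap]
  have : (Function.swap fun a b => (a, b) ∈ M.image Prod.swap) = fun a b => (a, b) ∈ M := by
    funext a b
    simp [Function.swap]
  rw [this]

/-- The part of a path after its last visit to `U`. -/
theorem exists_last_visit (U : Finset V) (hx : x ∈ U) (h : ArcReach M x z) :
    ∃ w ∈ U, ArcReach (M.filter fun e => e.2 ∉ U) w z := by
  induction h with
  | refl => exact ⟨x, hx, .refl⟩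
  | @tail b c _ hbc ih =>
    by_cases hc : c ∈ U
    · exact ⟨c, hc, .refl⟩
    · obtain ⟨w, hw, hwb⟩ := ih
      exact ⟨w, hw, Relation.ReflTransGen.tail hwb (by simp [hbc, hc])⟩

/-- The part of a path before its first visit to `U`. -/
theorem exists_first_visit (U : Finset V) (hz : z ∈ U) (h : ArcReach M x z) :
    ∃ w ∈ U, ArcReach (M.filter fun e => e.1 ∉ U) x w := by
  induction h using Relation.ReflTransGen.head_induction_on with
  | refl => exact ⟨z, hz, .refl⟩
  | @head a b hab _ ih =>
    by_cases ha : a ∈ U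
    · exact ⟨a, ha, .refl⟩
    · obtain ⟨w, hw, hbw⟩ := ih
      exact ⟨w, hw, Relation.ReflTransGen.head (by simp [hab, ha]) hbw⟩

/-- The arcs of `M` contain an out-tree rooted at `x` that reaches everything reachable
from `x`. -/
theorem exists_out_tree (M : Finset (V × V)) (x : V) :
    ∃ B ⊆ M, (∀ v, ArcReach M x v → ArcReach B x v) ∧ (∀ e ∈ B, e.2 ≠ x) ∧
      ∀ e ∈ B, ∀ f ∈ B, e.2 = f.2 → e = f := by
  classical
  let C := M.powerset.filter fun B => (∀ e ∈ B, ArcReach B x e.2) ∧ (∀ e ∈ B, e.2 ≠ x) ∧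
    ∀ e ∈ B, ∀ f ∈ B, e.2 = f.2 → e = f
  have hC : C.Nonempty := ⟨∅, by simp [C]⟩
  obtain ⟨B, hB, hmax⟩ := C.exists_max_image Finset.card hC
  simp only [C, Finset.mem_filter, Finset.mem_powerset] at hB hmax
  obtain ⟨hBM, hreach, hroot, huniq⟩ := hB
  refine ⟨B, hBM, fun v hv => ?_, hroot, huniq⟩
  induction hv with
  | refl => exact .refl
  | @tail b c _ hbc ih =>
    by_contra hc
    have hcB : ∀ e ∈ B, e.2 ≠ c := fun e he h => hc (h ▸ hreach e he)
    have hnew : (b, c) ∉ B := fun h => hcB _ h rfl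
    have hsub : B ⊆ insert (b, c) B := Finset.subset_insert _ _
    have hle := hmax (insert (b, c) B) ⟨?_, ?_, ?_, ?_⟩
    · rw [Finset.card_insert_of_notMem hnew] at hle
      omega
    · exact Finset.insert_subset hbc hBM
    · intro e he
      rcases Finset.mem_insert.1 he with rfl | he
      · exact (ih.mono hsub).trans (arc (Finset.mem_insert_self _ _))
      · exact (hreach e he).mono hsub
    · intro e he
      rcases Finset.mem_insert.1 he with rfl | he
      · rintro rfl
        exact hc .refl
      · exact hroot e he
    · intro e he f hf hef
      rcases Finset.mem_insert.1 he with rfl | he <;> rcases Finset.mem_insert.1 hf with rfl | hf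
      · rfl
      · exact absurd hef.symm (hcB f hf)
      · exact absurd hef (hcB e he)
      · exact huniq e he f hf hef

/-- The arcs of `M` contain an in-tree rooted at `x` that contains everything which
reaches `x`. -/
theorem exists_in_tree (M : Finset (V × V)) (x : V) :
    ∃ B ⊆ M, (∀ v, ArcReach M v x → ArcReach B v x) ∧ (∀ e ∈ B, e.1 ≠ x) ∧
      ∀ e ∈ B, ∀ f ∈ B, e.1 = f.1 → e = f := by
  obtain ⟨B, hB, hreach, hroot, huniq⟩ := exists_out_tree (M.image Prod.swap) x
  have hmem : ∀ e, e ∈ B.image Prod.swap → e.swap ∈ B := by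
    intro e he
    obtain ⟨f, hf, rfl⟩ := Finset.mem_image.1 he
    simpa using hf
  refine ⟨B.image Prod.swap, ?_, fun v hv => ?_, fun e he => hroot _ (hmem e he),
    fun e he f hf hef => Prod.swap_injective (huniq _ (hmem e he) _ (hmem f hf) hef)⟩
  · intro e he
    simpa using hB (hmem e he)
  · exact image_swap_iff.2 (hreach v (image_swap_iff.2 hv))

end ArcReach

section Menger

variable {V : Type*} [DecidableEq V] {A : Finset (V × V)} {x v w : V}

/-- Two arc-disjoint paths from `x` to `v` extend to two arc-disjoint paths from `x` to `w`:
one follows the arc `(v, w)`, the other leaves the first path at `t` and avoids both afterwards. -/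
theorem exists_disjoint_arcReach_step {M N : Finset (V × V)}
    (hM : M ⊆ A) (hN : N ⊆ A) (hMN : Disjoint M N)
    (hNv : ArcReach N x v) (hMe : ∀ e ∈ M, e.1 ≠ v)
    (hvw : (v, w) ∈ A) {U : Finset V}
    (hU : ∀ z, z ∈ U ↔ ArcReach M x z ∨ ArcReach N x z) {t : V} (ht : ArcReach M x t)
    (htw : ArcReach ((A.erase (v, w)).filter fun e => e.2 ∉ U) t w) :
    ∃ M' ⊆ A, ∃ N' ⊆ A, Disjoint M' N' ∧ ArcReach M' x w ∧ ArcReach N' x w := by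
  have hN' : ArcReach (N.filter fun e => e.2 ∈ U) x v := by
    have : ∀ z, ArcReach N x z → ArcReach (N.filter fun e => e.2 ∈ U) x z := by
      intro z hz
      induction hz with
      | refl => exact .refl
      | @tail b c hb hbc ih =>
        exact Relation.ReflTransGen.tail ih
          (by simpa [hbc] using (hU c).2 (.inr (Relation.ReflTransGen.tail hb hbc)))
    exact this v hNv
  refine ⟨M ∪ (A.erase (v, w)).filter fun e => e.2 ∉ U, ?_,
    insert (v, w) (N.filter fun e => e.2 ∈ U), ?_, ?_, ?_, ?_⟩
  · exact Finset.union_subset hM ((Finset.filter_subset _ _).trans (Finset.erase_subset _ _))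
  · exact Finset.insert_subset hvw ((Finset.filter_subset _ _).trans hN)
  · rw [Finset.disjoint_left]
    intro e he he'
    simp only [Finset.mem_union, Finset.mem_filter, Finset.mem_erase, Finset.mem_insert] at he he'
    rcases he with he | ⟨⟨hne, _⟩, heU⟩ <;> rcases he' with rfl | ⟨heN, heU'⟩
    · exact hMe _ he rfl
    · exact Finset.disjoint_left.1 hMN he heN
    · exact hne rfl
    · exact heU heU'
  · exact (ht.mono Finset.subset_union_left).trans (htw.mono Finset.subset_union_right)
  · exact (hN'.mono (Finset.subset_insert _ _)).trans
      (ArcReach.arc (Finset.mem_insert_self _ _))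

/-- The case `k = 2` of the arc version of Menger's theorem. -/
theorem ArcStrong.exists_disjoint_arcReach [Fintype V] (h2 : ArcStrong 2 A) (x y : V) :
    ∃ M ⊆ A, ∃ N ⊆ A, Disjoint M N ∧ ArcReach M x y ∧ ArcReach N x y := by
  classical
  have hxy : ArcReach A x y := by
    simpa [ArcReach] using h2 ∅ (Finset.empty_subset _) (by simp) x y
  induction hxy with
  | refl => exact ⟨∅, by simp, ∅, by simp, by simp, .refl, .refl⟩
  | @tail v w _ hvw ih =>
    obtain ⟨M₀, hM₀, N₀, hN₀, hd, hMv, hNv⟩ := ih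
    obtain ⟨M, hM, hMr, hMe, -⟩ := ArcReach.exists_in_tree M₀ v
    obtain ⟨N, hN, hNr, hNe, -⟩ := ArcReach.exists_in_tree N₀ v
    replace hMv := hMr x hMv
    replace hNv := hNr x hNv
    replace hd : Disjoint M N := Finset.disjoint_of_subset_left hM
      (Finset.disjoint_of_subset_right hN hd)
    replace hM := hM.trans hM₀
    replace hN := hN.trans hN₀
    let U : Finset V := Finset.univ.filter fun z => ArcReach M x z ∨ ArcReach N x z
    have hU : ∀ z, z ∈ U ↔ ArcReach M x z ∨ ArcReach N x z := by simp [U]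
    have hR : ArcReach (A.erase (v, w)) x w := by
      rw [Finset.erase_eq]
      exact h2 {(v, w)} (by simpa using hvw) (by simp) x w
    obtain ⟨t, htU, htw⟩ := hR.exists_last_visit U ((hU x).2 (.inl .refl))
    rcases (hU t).1 htU with ht | ht
    · exact exists_disjoint_arcReach_step hM hN hd hNv hMe hvw hU ht htw
    · exact exists_disjoint_arcReach_step hN hM hd.symm hMv hNe hvw
        (fun z => (hU z).trans or_comm) ht htw

end Menger

section Branchings

variable {V : Type*} [DecidableEq V] {A : Finset (V × V)}

theorem exists_isOutBranching {M : Finset (V × V)} {u : V} (hM : M ⊆ A)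
    (h : ∀ v, ArcReach M u v) : ∃ B ⊆ M, IsOutBranching A u B := by
  obtain ⟨B, hB, hreach, hroot, huniq⟩ := ArcReach.exists_out_tree M u
  refine ⟨B, hB, hB.trans hM, fun v => hreach v (h v), fun v hv => ?_,
    Finset.filter_eq_empty_iff.2 fun {e} he => hroot e he⟩
  obtain rfl | ⟨b, -, hb⟩ := Relation.ReflTransGen.cases_tail (hreach v (h v))
  · exact absurd rfl hv
  · refine Finset.card_eq_one.2 ⟨(b, v), Finset.ext fun e => ?_⟩
    simp only [Finset.mem_filter, Finset.mem_singleton]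
    exact ⟨fun he => huniq e he.1 _ hb he.2, fun he => he ▸ ⟨hb, rfl⟩⟩

theorem exists_isInBranching {M : Finset (V × V)} {u : V} (hM : M ⊆ A)
    (h : ∀ v, ArcReach M v u) : ∃ B ⊆ M, IsInBranching A u B := by
  obtain ⟨B, hB, hreach, hroot, huniq⟩ := ArcReach.exists_in_tree M u
  refine ⟨B, hB, hB.trans hM, fun v => hreach v (h v), fun v hv => ?_,
    Finset.filter_eq_empty_iff.2 fun {e} he => hroot e he⟩
  obtain rfl | ⟨b, hb, -⟩ := Relation.ReflTransGen.cases_head (hreach v (h v))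
  · exact absurd rfl hv
  · refine Finset.card_eq_one.2 ⟨(v, b), Finset.ext fun e => ?_⟩
    simp only [Finset.mem_filter, Finset.mem_singleton]
    exact ⟨fun he => huniq e he.1 _ hb he.2, fun he => he ▸ ⟨hb, rfl⟩⟩

/-- A nonempty semicomplete digraph has a vertex that reaches all others. -/
theorem exists_source_of_semicomplete (Y : Finset V) (hY : Y.Nonempty)
    (hsemi : ∀ a ∈ Y, ∀ b ∈ Y, a ≠ b → (a, b) ∈ A ∨ (b, a) ∈ A) :
    ∃ y ∈ Y, ∀ v ∈ Y, ArcReach (A.filter fun e => e.1 ∈ Y ∧ e.2 ∈ Y) y v := by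
  induction hY using Finset.Nonempty.cons_induction with
  | singleton a =>
    refine ⟨a, by simp, fun v hv => ?_⟩
    rw [Finset.mem_singleton.1 hv]
    exact .refl
  | cons a s ha hs ih =>
    obtain ⟨y, hy, hreach⟩ := ih fun b hb c hc =>
      hsemi b (Finset.mem_cons_of_mem hb) c (Finset.mem_cons_of_mem hc)
    have hsub : (A.filter fun e => e.1 ∈ s ∧ e.2 ∈ s) ⊆
        A.filter fun e => e.1 ∈ Finset.cons a s ha ∧ e.2 ∈ Finset.cons a s ha := by
      intro e he
      simp only [Finset.mem_filter, Finset.mem_cons] at he ⊢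
      exact ⟨he.1, .inr he.2.1, .inr he.2.2⟩
    have hne : y ≠ a := fun h => ha (h ▸ hy)
    rcases hsemi y (Finset.mem_cons_of_mem hy) a (Finset.mem_cons_self _ _) hne with h | h
    · refine ⟨y, Finset.mem_cons_of_mem hy, fun v hv => ?_⟩
      rcases Finset.mem_cons.1 hv with rfl | hv
      · exact ArcReach.arc (by simp [h, hy])
      · exact (hreach v hv).mono hsub
    · refine ⟨a, Finset.mem_cons_self _ _, fun v hv => ?_⟩
      rcases Finset.mem_cons.1 hv with rfl | hv
      · exact .refl
      · exact (ArcReach.arc (by simp [h, hy])).trans ((hreach v hv).mono hsub)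

/-- A nonempty semicomplete digraph has a vertex reached by all others. -/
theorem exists_sink_of_semicomplete (X : Finset V) (hX : X.Nonempty)
    (hsemi : ∀ a ∈ X, ∀ b ∈ X, a ≠ b → (a, b) ∈ A ∨ (b, a) ∈ A) :
    ∃ x ∈ X, ∀ v ∈ X, ArcReach (A.filter fun e => e.1 ∈ X ∧ e.2 ∈ X) v x := by
  obtain ⟨x, hx, h⟩ := exists_source_of_semicomplete (A := A.image Prod.swap) X hX
    fun a ha b hb hab => by simpa using (hsemi a ha b hb hab).symm
  refine ⟨x, hx, fun v hv => ArcReach.image_swap_iff.1 ((h v hv).mono fun e he => ?_)⟩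
  simp only [Finset.mem_filter, Finset.mem_image] at he ⊢
  obtain ⟨⟨f, hf, rfl⟩, h₁, h₂⟩ := he
  exact ⟨f, ⟨hf, h₂, h₁⟩, rfl⟩

end Branchings

/-- Theorem 4.5: let `D` be a 2-arc-strong digraph, `u` a vertex of `D`, and `S` a
set of vertices containing `u` inducing a semicomplete subdigraph.  If every vertex
outside `S` has at least two in-neighbours and at least two out-neighbours in `S`,
then `D` has a good `(u, u)`-pair. -/
theorem stmt14 {V : Type*} [Fintype V] [DecidableEq V]
    (A : Finset (V × V)) (hloop : ∀ v : V, (v, v) ∉ A)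
    (h2 : ArcStrong 2 A)
    (u : V) (S : Finset V) (huS : u ∈ S)
    (hsemi : ∀ a ∈ S, ∀ b ∈ S, a ≠ b → (a, b) ∈ A ∨ (b, a) ∈ A)
    (hin : ∀ v : V, v ∉ S → 2 ≤ (S.filter fun w => (w, v) ∈ A).card)
    (hout : ∀ v : V, v ∉ S → 2 ≤ (S.filter fun w => (v, w) ∈ A).card) :
    GoodPair A u u := by
  classical
  let UP : Finset V := S.filter fun v => v = u ∨ (u, v) ∈ A
  let UQ : Finset V := S.filter fun v => v = u ∨ (v, u) ∈ A
  let X : Finset V := S \ UQ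
  let Y : Finset V := S \ UP
  have huP : u ∈ UP := by simp [UP, huS]
  have huQ : u ∈ UQ := by simp [UQ, huS]
  have hXP : X ⊆ UP := fun v hv => by
    simp only [X, UP, UQ, Finset.mem_sdiff, Finset.mem_filter] at hv ⊢
    grind
  have hYQ : Y ⊆ UQ := fun v hv => by
    simp only [Y, UP, UQ, Finset.mem_sdiff, Finset.mem_filter] at hv ⊢
    grind
  obtain ⟨x, hxP, hxX⟩ : ∃ x ∈ UP, ∀ v ∈ X,
      ArcReach (A.filter fun e => e.1 ∈ X ∧ e.2 ∈ X) v x := by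
    rcases X.eq_empty_or_nonempty with h | h
    · exact ⟨u, huP, by simp [h]⟩
    · obtain ⟨x, hx, hr⟩ := exists_sink_of_semicomplete X h fun a ha b hb =>
        hsemi a (Finset.sdiff_subset ha) b (Finset.sdiff_subset hb)
      exact ⟨x, hXP hx, hr⟩
  obtain ⟨y, hyQ, hyY⟩ : ∃ y ∈ UQ, ∀ v ∈ Y,
      ArcReach (A.filter fun e => e.1 ∈ Y ∧ e.2 ∈ Y) y v := by
    rcases Y.eq_empty_or_nonempty with h | h
    · exact ⟨u, huQ, by simp [h]⟩
    · obtain ⟨y, hy, hr⟩ := exists_source_of_semicomplete Y h fun a ha b hb =>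
        hsemi a (Finset.sdiff_subset ha) b (Finset.sdiff_subset hb)
      exact ⟨y, hYQ hy, hr⟩
  obtain ⟨M, hM, N, hN, hMN, hMr, hNr⟩ := h2.exists_disjoint_arcReach x y
  -- `P` gets out-degrees at most one and `Q` gets in-degrees at most one.
  obtain ⟨P₀, hP₀, hP₀r, -, hP₀u⟩ := ArcReach.exists_in_tree M y
  obtain ⟨Q₀, hQ₀, hQ₀r, -, hQ₀u⟩ := ArcReach.exists_out_tree N x
  obtain ⟨p, hp, hpy⟩ := (hP₀r x hMr).exists_last_visit UP hxP
  obtain ⟨q, hq, hxq⟩ := (hQ₀r y hNr).exists_first_visit UQ hyQ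
  set P := P₀.filter fun e => e.2 ∉ UP
  set Q := Q₀.filter fun e => e.1 ∉ UQ
  have hPQ : ∀ e ∈ P, e ∉ Q := fun e he he' =>
    Finset.disjoint_left.1 hMN (hP₀ (Finset.mem_filter.1 he).1) (hQ₀ (Finset.mem_filter.1 he').1)
  have hPA : P ⊆ A := ((Finset.filter_subset _ _).trans hP₀).trans hM
  have hQA : Q ⊆ A := ((Finset.filter_subset _ _).trans hQ₀).trans hN
  let O : Finset (V × V) := A.filter fun e => e.1 = u ∨ (e.1 ∈ Y ∧ e.2 ∈ Y) ∨
    (e.1 ∈ S ∧ e.2 ∉ S ∧ e ∉ Q) ∨ e ∈ P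
  let I : Finset (V × V) := A.filter fun e => e.2 = u ∨ (e.1 ∈ X ∧ e.2 ∈ X) ∨
    (e.1 ∉ S ∧ e.2 ∈ S ∧ e ∉ P) ∨ e ∈ Q
  have hPO : P ⊆ O := fun e he => Finset.mem_filter.2 ⟨hPA he, .inr (.inr (.inr he))⟩
  have hQI : Q ⊆ I := fun e he => Finset.mem_filter.2 ⟨hQA he, .inr (.inr (.inr he))⟩
  have hOP : ∀ v ∈ UP, ArcReach O u v := by
    intro v hv
    obtain ⟨-, rfl | h⟩ := Finset.mem_filter.1 hv
    · exact .refl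
    · exact ArcReach.arc (Finset.mem_filter.2 ⟨h, .inl rfl⟩)
  have hIQ : ∀ v ∈ UQ, ArcReach I v u := by
    intro v hv
    obtain ⟨-, rfl | h⟩ := Finset.mem_filter.1 hv
    · exact .refl
    · exact ArcReach.arc (Finset.mem_filter.2 ⟨h, .inl rfl⟩)
  have hOS : ∀ v ∈ S, ArcReach O u v := by
    intro v hv
    by_cases hvP : v ∈ UP
    · exact hOP v hvP
    · refine ((hOP p hp).trans (hpy.mono hPO)).trans
        ((hyY v (Finset.mem_sdiff.2 ⟨hv, hvP⟩)).mono fun e he => ?_)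
      rw [Finset.mem_filter] at he ⊢
      exact ⟨he.1, .inr (.inl he.2)⟩
  have hIS : ∀ v ∈ S, ArcReach I v u := by
    intro v hv
    by_cases hvQ : v ∈ UQ
    · exact hIQ v hvQ
    · refine ArcReach.trans ((hxX v (Finset.mem_sdiff.2 ⟨hv, hvQ⟩)).mono fun e he => ?_)
        ((hxq.mono hQI).trans (hIQ q hq))
      rw [Finset.mem_filter] at he ⊢
      exact ⟨he.1, .inr (.inl he.2)⟩
  have hO : ∀ v, ArcReach O u v := by
    intro v
    by_cases hv : v ∈ S
    · exact hOS v hv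
    · have key : ∀ a, a ∈ S ∧ (a, v) ∈ A → (a, v) ∉ Q → ArcReach O u v := fun a ha h =>
        (hOS a ha.1).trans
          (ArcReach.arc (Finset.mem_filter.2 ⟨ha.2, .inr (.inr (.inl ⟨ha.1, hv, h⟩))⟩))
      obtain ⟨a, ha, b, hb, hab⟩ := Finset.one_lt_card.1 (hin v hv)
      rw [Finset.mem_filter] at ha hb
      by_cases h : (a, v) ∈ Q
      · exact key b hb fun h' => hab (congrArg Prod.fst
          (hQ₀u _ (Finset.mem_filter.1 h).1 _ (Finset.mem_filter.1 h').1 rfl))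
      · exact key a ha h
  have hI : ∀ v, ArcReach I v u := by
    intro v
    by_cases hv : v ∈ S
    · exact hIS v hv
    · have key : ∀ a, a ∈ S ∧ (v, a) ∈ A → (v, a) ∉ P → ArcReach I v u := fun a ha h =>
        ArcReach.trans
          (ArcReach.arc (Finset.mem_filter.2 ⟨ha.2, .inr (.inr (.inl ⟨hv, ha.1, h⟩))⟩))
          (hIS a ha.1)
      obtain ⟨a, ha, b, hb, hab⟩ := Finset.one_lt_card.1 (hout v hv)
      rw [Finset.mem_filter] at ha hb
      by_cases h : (v, a) ∈ P
      · exact key b hb fun h' => hab (congrArg Prod.snd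
          (hP₀u _ (Finset.mem_filter.1 h).1 _ (Finset.mem_filter.1 h').1 rfl))
      · exact key a ha h
  have hOI : Disjoint O I := by
    rw [Finset.disjoint_left]
    rintro ⟨a, b⟩ he he'
    obtain ⟨hA, he⟩ := Finset.mem_filter.1 he
    obtain ⟨-, he'⟩ := Finset.mem_filter.1 he'
    have hl : a = u → b ≠ u := by
      rintro rfl rfl
      exact hloop _ hA
    have hp : (a, b) ∈ P → b ∉ UP := fun h => (Finset.mem_filter.1 h).2
    have hq : (a, b) ∈ Q → a ∉ UQ := fun h => (Finset.mem_filter.1 h).2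
    have hpq := hPQ (a, b)
    have hau : a = u → a ∈ UQ := by rintro rfl; exact huQ
    have hbu : b = u → b ∈ UP := by rintro rfl; exact huP
    have haS : a = u → a ∈ S := by rintro rfl; exact huS
    have hbS : b = u → b ∈ S := by rintro rfl; exact huS
    have hbXP := @hXP b
    have haYQ := @hYQ a
    have haX : a ∈ X → a ∈ S ∧ a ∉ UQ := Finset.mem_sdiff.1
    have hbX : b ∈ X → b ∈ S ∧ b ∉ UQ := Finset.mem_sdiff.1
    have haY : a ∈ Y → a ∈ S ∧ a ∉ UP := Finset.mem_sdiff.1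
    have hbY : b ∈ Y → b ∈ S ∧ b ∉ UP := Finset.mem_sdiff.1
    clear_value P Q X Y UP UQ
    clear * - he he' hl hp hq hpq hau hbu haS hbS hbXP haYQ haX hbX haY hbY
    grind
  obtain ⟨B₁, hB₁, hB₁'⟩ := exists_isOutBranching (Finset.filter_subset _ _) hO
  obtain ⟨B₂, hB₂, hB₂'⟩ := exists_isInBranching (Finset.filter_subset _ _) hI
  exact ⟨B₁, B₂, hB₁', hB₂', Finset.disjoint_of_subset_left hB₁
    (Finset.disjoint_of_subset_right hB₂ hOI)⟩
end
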